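/- (Conjecture.) Fix an integer k > 1. Then lim_{n→∞} (β_{k,n} − n) = frac((3k+5)/8) + (k−1)/(8(2k+1)), and this value is a sharp lower bound for β_{k,n} − n over the range of n on which β_{k,n} − n is decreasing. Equivalently, the difference between the mean β_{k,n} and the mode m_k = n − ⌊(3k+5)/8⌋ satisfies lim_{n→∞} (β_{k,n} − m_k(n/κ)) = (6k+11)/16 − 3/(16(2k+1)), and this is a sharp lower bound for β_{k,n} − m_k(n/κ). -/

import Mathlib

open scoped BigOperators

/-- The pmf of the Poisson distribution of order `k` with parameter `lam`:
`f_k(n;λ) = e^{-kλ} Σ_{n₁+2n₂+⋯+k n_k = n} λ^{n₁+⋯+n_k}/(n₁!⋯n_k!)`. -/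
noncomputable def poissonOrderKPmf (k : ℕ) (lam : ℝ) (n : ℕ) : ℝ :=
  Real.exp (-(k * lam)) *
    ∑' v : Fin k → ℕ,
      if (∑ i : Fin k, ((i : ℕ) + 1) * v i) = n then
        lam ^ (∑ i : Fin k, v i) / ((∏ i : Fin k, Nat.factorial (v i) : ℕ) : ℝ)
      else 0

/-- The median of the Poisson distribution of order `k` with parameter `lam`:
the least integer `n` such that `P(X ≤ n) ≥ 1/2`. -/
noncomputable def poissonOrderKMedian (k : ℕ) (lam : ℝ) : ℕ :=
  sInf {n : ℕ | (1 : ℝ) / 2 ≤ ∑ j ∈ Finset.range (n + 1), poissonOrderKPmf k lam j}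

/-- β_(k,n): the value of the mean κλ at the λ > 0 for which the Poisson distribution of
order k has a double mode at m = n − ⌊(3k+5)/8⌋ and m + 1. -/
noncomputable def poissonOrderKBeta (k n : ℕ) : ℝ :=
  ((k * (k + 1) / 2 : ℕ) : ℝ) *
    sInf {lam : ℝ | 0 < lam ∧
      poissonOrderKPmf k lam (n - (3 * k + 5) / 8) =
        poissonOrderKPmf k lam (n - (3 * k + 5) / 8 + 1) ∧
      (∀ j : ℕ, poissonOrderKPmf k lam j ≤ poissonOrderKPmf k lam (n - (3 * k + 5) / 8))}

namespace PoissonOrderK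

/-- The weight `v₀ + 2 v₁ + ⋯ + k v_{k-1}` of a multi-index. -/
def weight {k : ℕ} (v : Fin k → ℕ) : ℕ := ∑ i : Fin k, ((i : ℕ) + 1) * v i

/-- The multivariate exponential coefficient attached to a multi-index. -/
noncomputable def expTerm {k : ℕ} (lam : ℝ) (v : Fin k → ℕ) : ℝ :=
  ∏ i : Fin k, lam ^ v i / (Nat.factorial (v i) : ℝ)

/-- The unnormalised mass `e^{kλ} f_k(n;λ)`, extended by zero to negative integers. -/
noncomputable def mass (k : ℕ) (lam : ℝ) (n : ℤ) : ℝ :=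
  ∑' v : Fin k → ℕ, if (weight v : ℤ) = n then expTerm lam v else 0

theorem expTerm_nonneg {k : ℕ} {lam : ℝ} (h : 0 ≤ lam) (v : Fin k → ℕ) :
    0 ≤ expTerm lam v :=
  Finset.prod_nonneg fun i _ => by positivity

theorem pmf_eq_mass (k : ℕ) (lam : ℝ) (n : ℕ) :
    poissonOrderKPmf k lam n = Real.exp (-(k * lam)) * mass k lam n := by
  unfold poissonOrderKPmf mass
  congr 1
  refine tsum_congr fun v => ?_
  have h : ((weight v : ℤ) = (n : ℤ)) ↔ (∑ i : Fin k, ((i : ℕ) + 1) * v i) = n := by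
    unfold weight; exact Nat.cast_inj
  by_cases hv : (∑ i : Fin k, ((i : ℕ) + 1) * v i) = n
  · rw [if_pos hv, if_pos (h.2 hv), expTerm, Finset.prod_div_distrib, Finset.prod_pow_eq_pow_sum]
    push_cast
    rfl
  · rw [if_neg hv, if_neg (mt h.1 hv)]

theorem hasSum_pi_prod : ∀ {k : ℕ} (g : Fin k → ℕ → ℂ) (s : Fin k → ℂ),
    (∀ i, Summable fun n => ‖g i n‖) → (∀ i, HasSum (g i) (s i)) →
    (Summable fun v : Fin k → ℕ => ‖∏ i, g i (v i)‖) ∧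
      HasSum (fun v : Fin k → ℕ => ∏ i, g i (v i)) (∏ i, s i)
  | 0, g, s, _, _ => by
    constructor
    · exact Summable.of_finite
    · simp only [Finset.univ_eq_empty, Finset.prod_empty]
      simpa only [Finset.univ_unique, Finset.sum_singleton] using
        hasSum_fintype (fun _ : Fin 0 → ℕ => (1 : ℂ))
  | k + 1, g, s, hn, hs => by
    obtain ⟨h1, h2⟩ := hasSum_pi_prod (fun i : Fin k => g i.succ) (fun i => s i.succ)
      (fun i => hn _) (fun i => hs _)
    let E : ℕ × (Fin k → ℕ) ≃ (Fin (k + 1) → ℕ) := Fin.consEquiv fun _ => ℕ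
    have e : ∀ x : ℕ × (Fin k → ℕ), ∏ i, g i (E x i) =
        g 0 x.1 * ∏ i : Fin k, g i.succ (x.2 i) := fun x => by
      rw [Fin.prod_univ_succ]; rfl
    have hsn := Summable.mul_norm (hn 0) h1
    constructor
    · refine E.summable_iff.1 (hsn.congr fun x => ?_)
      rw [Function.comp_apply, e]
    · refine E.hasSum_iff.1 ?_
      rw [Fin.prod_univ_succ]
      have h3 := (hs 0).mul h2 hsn.of_norm
      refine h3.congr_fun fun x => ?_
      rw [Function.comp_apply, e]

theorem hasSum_expTerm (k : ℕ) (lam : ℝ) (z : ℂ) :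
    (Summable fun v : Fin k → ℕ => ‖(expTerm lam v : ℂ) * z ^ weight v‖) ∧
    HasSum (fun v : Fin k → ℕ => (expTerm lam v : ℂ) * z ^ weight v)
      (Complex.exp (lam * ∑ j ∈ Finset.range k, z ^ (j + 1))) := by
  have key := hasSum_pi_prod (k := k)
    (fun i n => (lam * z ^ ((i : ℕ) + 1)) ^ n / (Nat.factorial n : ℂ))
    (fun i => Complex.exp (lam * z ^ ((i : ℕ) + 1)))
    (fun i => NormedSpace.norm_expSeries_div_summable (lam * z ^ ((i : ℕ) + 1)))
    (fun i => by
      have := NormedSpace.expSeries_div_hasSum_exp (lam * z ^ ((i : ℕ) + 1) : ℂ)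
      rwa [← Complex.exp_eq_exp_ℂ] at this)
  have e : ∀ v : Fin k → ℕ, (∏ i : Fin k, (lam * z ^ ((i : ℕ) + 1)) ^ v i /
      (Nat.factorial (v i) : ℂ)) = (expTerm lam v : ℂ) * z ^ weight v := by
    intro v
    rw [expTerm, weight, ← Finset.prod_pow_eq_pow_sum]
    push_cast
    rw [← Finset.prod_mul_distrib]
    refine Finset.prod_congr rfl fun i _ => ?_
    rw [mul_pow, pow_mul]; ring
  simp only [e] at key
  rw [← Complex.exp_sum, ← Finset.mul_sum, Fin.sum_univ_eq_sum_range (fun i => z ^ (i + 1))] at key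
  exact key

theorem summable_expTerm (k : ℕ) (lam : ℝ) :
    Summable fun v : Fin k → ℕ => expTerm lam v := by
  have h := (hasSum_expTerm k lam 1).1
  simp only [one_pow, mul_one, Complex.norm_real] at h
  exact h.of_norm

theorem summable_ite_expTerm (k : ℕ) (lam : ℝ) (n : ℤ) :
    Summable fun v : Fin k → ℕ => if (weight v : ℤ) = n then expTerm lam v else 0 := by
  refine Summable.of_norm_bounded (summable_expTerm k lam).norm fun v => ?_
  split_ifs <;> simp

theorem mass_nonneg {k : ℕ} {lam : ℝ} (h : 0 ≤ lam) (n : ℤ) : 0 ≤ mass k lam n :=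
  tsum_nonneg fun v => by split_ifs <;> [exact expTerm_nonneg h v; rfl]

theorem mass_of_neg (k : ℕ) (lam : ℝ) {n : ℤ} (h : n < 0) : mass k lam n = 0 := by
  unfold mass
  refine (tsum_congr fun v => if_neg ?_).trans tsum_zero
  omega

theorem mass_zero (k : ℕ) (lam : ℝ) : mass k lam 0 = 1 := by
  unfold mass
  rw [tsum_eq_single 0]
  · simp [weight, expTerm]
  · intro v hv
    rw [if_neg]
    intro h
    apply hv
    funext i
    have : weight v = 0 := by exact_mod_cast h
    have := (Finset.sum_eq_zero_iff.1 this) i (Finset.mem_univ i)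
    simpa using this

theorem hasSum_mass_mul_pow (k : ℕ) (lam : ℝ) {z : ℂ} :
    HasSum (fun n : ℤ => (mass k lam n : ℂ) * z ^ n)
      (Complex.exp (lam * ∑ j ∈ Finset.range k, z ^ (j + 1))) := by
  have h := (hasSum_expTerm k lam z).2
  have h2 := (Equiv.sigmaFiberEquiv fun v : Fin k → ℕ => (weight v : ℤ)).hasSum_iff.2 h
  refine h2.sigma fun n => ?_
  have h3 : HasSum (fun v : {v : Fin k → ℕ // (weight v : ℤ) = n} => expTerm lam v.1)
      (mass k lam n) := by
    have := (summable_ite_expTerm k lam n).hasSum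
    have h4 := hasSum_subtype_iff_indicator (f := fun v : Fin k → ℕ => expTerm lam v)
      (s := {v | (weight v : ℤ) = n}) (a := mass k lam n)
    refine h4.2 ?_
    have h5 : (Set.indicator {v | (weight v : ℤ) = n} fun v : Fin k → ℕ => expTerm lam v) =
        fun v => if (weight v : ℤ) = n then expTerm lam v else 0 := by
      funext v
      by_cases h : (weight v : ℤ) = n <;> simp [Set.indicator, h]
    rw [h5]
    exact this
  have h5 := ((Complex.hasSum_ofReal).2 h3).mul_right (z ^ n)
  refine h5.congr_fun fun v => ?_
  simp only [Function.comp_apply, Equiv.sigmaFiberEquiv_apply]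
  rw [← zpow_natCast, v.2]

theorem hasSum_mass (k : ℕ) (lam : ℝ) : HasSum (mass k lam) (Real.exp (k * lam)) := by
  have h := hasSum_mass_mul_pow k lam (z := 1)
  simp only [one_zpow, mul_one, one_pow, Finset.sum_const, Finset.card_range, nsmul_eq_mul] at h
  rw [← Complex.hasSum_ofReal]
  push_cast
  rwa [mul_comm]

theorem tsum_apply_mul_expTerm (k : ℕ) (lam : ℝ) (n : ℤ) (i : Fin k) :
    ∑' v : Fin k → ℕ, (if (weight v : ℤ) = n then (v i : ℝ) * expTerm lam v else 0) =
      lam * mass k lam (n - (((i : ℕ) : ℤ) + 1)) := by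
  have hinj : Function.Injective fun v : Fin k → ℕ => v + Pi.single i 1 :=
    add_left_injective _
  have hw : ∀ v : Fin k → ℕ, weight (v + Pi.single i 1) = weight v + ((i : ℕ) + 1) := by
    intro v
    simp [weight, mul_add, Finset.sum_add_distrib, Pi.single_apply]
  have ht : ∀ v : Fin k → ℕ, (((v + Pi.single i 1 : Fin k → ℕ) i : ℕ) : ℝ) *
      expTerm lam (v + Pi.single i 1) = lam * expTerm lam v := by
    intro v
    unfold expTerm
    rw [← Finset.mul_prod_erase _ _ (Finset.mem_univ i),
      ← Finset.mul_prod_erase _ (fun j => lam ^ v j / _) (Finset.mem_univ i)]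
    have : ∀ j ∈ Finset.univ.erase i, lam ^ (v + Pi.single i 1 : Fin k → ℕ) j /
        (Nat.factorial ((v + Pi.single i 1 : Fin k → ℕ) j) : ℝ) =
        lam ^ v j / (Nat.factorial (v j) : ℝ) := by
      intro j hj
      have : j ≠ i := Finset.ne_of_mem_erase hj
      simp [this]
    rw [Finset.prod_congr rfl this]
    simp only [Pi.add_apply, Pi.single_eq_same, Nat.factorial_succ, pow_succ]
    have : (Nat.factorial (v i) : ℝ) ≠ 0 := by positivity
    push_cast
    field_simp
  rw [← hinj.tsum_eq]
  · rw [mass, ← tsum_mul_left]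
    refine tsum_congr fun v => ?_
    simp only [hw]
    by_cases h : (weight v : ℤ) = n - (((i : ℕ) : ℤ) + 1)
    · rw [if_pos h, if_pos (by push_cast; omega), ht]
    · rw [if_neg h, if_neg (by push_cast; omega), mul_zero]
  · intro v hv
    have hvi : v i ≠ 0 := by
      rintro h
      simp [h] at hv
    refine ⟨v - Pi.single i 1, ?_⟩
    funext j
    by_cases hj : j = i
    · subst hj; simp; omega
    · simp [hj]

/-- The defining recurrence of the Poisson distribution of order `k`. -/
theorem mass_recurrence (k : ℕ) (lam : ℝ) (n : ℤ) :
    (n : ℝ) * mass k lam n =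
      lam * ∑ i ∈ Finset.range k, ((i : ℝ) + 1) * mass k lam (n - ((i : ℤ) + 1)) := by
  have hs : ∀ i : Fin k, Summable fun v : Fin k → ℕ =>
      (if (weight v : ℤ) = n then (v i : ℝ) * expTerm lam v else 0) := by
    intro i
    refine Summable.of_norm_bounded ((summable_expTerm k lam).norm.mul_left |(n : ℝ)|) fun v => ?_
    split_ifs with h
    · rw [norm_mul]
      gcongr
      have h1 : v i ≤ weight v := by
        refine le_trans ?_ (Finset.single_le_sum (f := fun i : Fin k => ((i : ℕ) + 1) * v i)
          (fun _ _ => Nat.zero_le _) (Finset.mem_univ i))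
        nlinarith [Nat.zero_le ((i : ℕ) * v i)]
      rw [← h]
      simp only [Real.norm_natCast, Int.cast_natCast, Nat.abs_cast]
      exact_mod_cast h1
    · simp; positivity
  rw [← Fin.sum_univ_eq_sum_range
    (fun i => ((i : ℝ) + 1) * mass k lam (n - ((i : ℤ) + 1))), Finset.mul_sum]
  have : ∀ i : Fin k, lam * ((((i : ℕ) : ℝ) + 1) * mass k lam (n - (((i : ℕ) : ℤ) + 1))) =
      ∑' v : Fin k → ℕ, (((i : ℕ) : ℝ) + 1) *
        (if (weight v : ℤ) = n then (v i : ℝ) * expTerm lam v else 0) := by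
    intro i
    rw [tsum_mul_left, tsum_apply_mul_expTerm]; ring
  simp only [this]
  rw [← Summable.tsum_finsetSum fun i _ => (hs i).mul_left _, mass, ← tsum_mul_left]
  refine tsum_congr fun v => ?_
  split_ifs with h
  · rw [← h, weight]
    push_cast
    rw [Finset.sum_mul]
    exact Finset.sum_congr rfl fun i _ => by ring
  · simp

theorem hasDerivAt_mass (k : ℕ) (lam : ℝ) (n : ℤ) :
    HasDerivAt (fun x => mass k x n)
      (∑ i ∈ Finset.range k, mass k lam (n - ((i : ℤ) + 1))) lam := by
  rcases lt_or_ge n 0 with hn | hn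
  · have h1 : (fun x => mass k x n) = fun _ => 0 := funext fun x => mass_of_neg k x hn
    rw [h1, Finset.sum_eq_zero fun i _ => mass_of_neg k lam (by omega)]
    exact hasDerivAt_const _ _
  obtain ⟨N, rfl⟩ := Int.eq_ofNat_of_zero_le hn
  induction N using Nat.strong_induction_on with
  | _ N ih =>
    rcases Nat.eq_zero_or_pos N with rfl | hN
    · have h1 : (fun x => mass k x ((0 : ℕ) : ℤ)) = fun _ => 1 :=
        funext fun x => mass_zero k x
      rw [h1, Finset.sum_eq_zero fun i _ => mass_of_neg k lam (by omega)]
      exact hasDerivAt_const _ _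
    have hN' : (N : ℝ) ≠ 0 := by positivity
    have hd : ∀ i ∈ Finset.range k,
        HasDerivAt (fun x => mass k x ((N : ℤ) - ((i : ℤ) + 1)))
          (∑ j ∈ Finset.range k, mass k lam ((N : ℤ) - ((i : ℤ) + 1) - ((j : ℤ) + 1))) lam := by
      intro i _
      rcases lt_or_ge ((N : ℤ) - ((i : ℤ) + 1)) 0 with h | h
      · have h1 : (fun x => mass k x ((N : ℤ) - ((i : ℤ) + 1))) = fun _ => 0 :=
          funext fun x => mass_of_neg k x h
        rw [h1, Finset.sum_eq_zero fun i _ => mass_of_neg k lam (by omega)]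
        exact hasDerivAt_const _ _
      · have h2 := ih (N - (i + 1)) (by omega) (by omega)
        have h3 : ((N - (i + 1) : ℕ) : ℤ) = (N : ℤ) - ((i : ℤ) + 1) := by omega
        rwa [h3] at h2
    have h1 : (fun x => mass k x (N : ℤ)) = fun x => (N : ℝ)⁻¹ * (x * ∑ i ∈ Finset.range k,
        ((i : ℝ) + 1) * mass k x ((N : ℤ) - ((i : ℤ) + 1))) := by
      funext x
      rw [← mass_recurrence]
      simp [hN']
    rw [h1]
    have h2 := ((hasDerivAt_id lam).mul (HasDerivAt.fun_sum fun i hi =>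
      (hd i hi).const_mul ((i : ℝ) + 1))).const_mul (N : ℝ)⁻¹
    refine h2.congr_deriv ?_
    have h3 : ∑ i ∈ Finset.range k, ((i : ℝ) + 1) * ∑ j ∈ Finset.range k,
        mass k lam ((N : ℤ) - ((i : ℤ) + 1) - ((j : ℤ) + 1)) =
        ∑ j ∈ Finset.range k, ∑ i ∈ Finset.range k, ((i : ℝ) + 1) *
        mass k lam ((N : ℤ) - ((j : ℤ) + 1) - ((i : ℤ) + 1)) := by
      rw [Finset.sum_comm]
      simp only [Finset.mul_sum]
      refine Finset.sum_congr rfl fun i _ => Finset.sum_congr rfl fun j _ => ?_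
      rw [show (N : ℤ) - ((j : ℤ) + 1) - ((i : ℤ) + 1) = N - ((i : ℤ) + 1) - ((j : ℤ) + 1) by ring]
    rw [id, one_mul, h3, Finset.mul_sum _ _ lam]
    have h4 : ∀ j : ℕ, lam * ∑ i ∈ Finset.range k, ((i : ℝ) + 1) *
        mass k lam ((N : ℤ) - ((j : ℤ) + 1) - ((i : ℤ) + 1)) =
        ((N : ℝ) - ((j : ℝ) + 1)) * mass k lam ((N : ℤ) - ((j : ℤ) + 1)) := by
      intro j
      rw [← mass_recurrence]
      push_cast; ring
    simp only [h4]
    rw [← Finset.sum_add_distrib, inv_mul_eq_iff_eq_mul₀ hN', Finset.mul_sum]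
    exact Finset.sum_congr rfl fun i _ => by ring

/-- The mean per unit `λ`, i.e. `1 + 2 + ⋯ + k`. -/
noncomputable def kap (k : ℕ) : ℝ := (k : ℝ) * (k + 1) / 2

/-- The variance per unit `λ`, i.e. `1² + 2² + ⋯ + k²`. -/
noncomputable def sqs (k : ℕ) : ℝ := (k : ℝ) * (k + 1) * (2 * k + 1) / 6

theorem sum_range_succ_cast (k : ℕ) : ∑ i ∈ Finset.range k, ((i : ℝ) + 1) = kap k := by
  unfold kap
  induction k with
  | zero => simp
  | succ k ih => rw [Finset.sum_range_succ, ih]; push_cast; ring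

theorem sum_range_succ_cast_sq (k : ℕ) :
    ∑ i ∈ Finset.range k, ((i : ℝ) + 1) ^ 2 = sqs k := by
  unfold sqs
  induction k with
  | zero => simp
  | succ k ih => rw [Finset.sum_range_succ, ih]; push_cast; ring

theorem kap_pos {k : ℕ} (hk : 0 < k) : 0 < kap k := by unfold kap; positivity

theorem sqs_pos {k : ℕ} (hk : 0 < k) : 0 < sqs k := by unfold sqs; positivity

theorem hasSum_shift {f : ℤ → ℝ} {a : ℝ} (h : HasSum f a) (c : ℤ) :
    HasSum (fun n => f (n - c)) a :=
  (Equiv.subRight c).hasSum_iff.2 h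

theorem hasSum_mul_mass (k : ℕ) (lam : ℝ) :
    HasSum (fun n : ℤ => (n : ℝ) * mass k lam n) (lam * kap k * Real.exp (k * lam)) := by
  simp only [mass_recurrence]
  rw [mul_assoc, ← sum_range_succ_cast, Finset.sum_mul]
  refine HasSum.mul_left _ (hasSum_sum fun i _ => ?_)
  exact (hasSum_shift (hasSum_mass k lam) _).mul_left _

theorem hasSum_sq_mul_mass (k : ℕ) (lam : ℝ) :
    HasSum (fun n : ℤ => (n : ℝ) ^ 2 * mass k lam n)
      (((lam * kap k) ^ 2 + lam * sqs k) * Real.exp (k * lam)) := by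
  have h : ∀ n : ℤ, (n : ℝ) ^ 2 * mass k lam n = lam * ∑ i ∈ Finset.range k,
      (((i : ℝ) + 1) * (((n - ((i : ℤ) + 1) : ℤ) : ℝ) * mass k lam (n - ((i : ℤ) + 1))) +
        ((i : ℝ) + 1) ^ 2 * mass k lam (n - ((i : ℤ) + 1))) := by
    intro n
    rw [sq, mul_assoc, mass_recurrence, mul_left_comm, Finset.mul_sum]
    congr 1
    refine Finset.sum_congr rfl fun i _ => ?_
    push_cast; ring
  simp only [h]
  have h2 : ((lam * kap k) ^ 2 + lam * sqs k) * Real.exp (k * lam) =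
      lam * ∑ i ∈ Finset.range k, (((i : ℝ) + 1) * (lam * kap k * Real.exp (k * lam)) +
        ((i : ℝ) + 1) ^ 2 * Real.exp (k * lam)) := by
    rw [Finset.sum_add_distrib, ← Finset.sum_mul, ← Finset.sum_mul, sum_range_succ_cast,
      sum_range_succ_cast_sq]
    ring
  rw [h2]
  refine HasSum.mul_left _ (hasSum_sum fun i _ => HasSum.add ?_ ?_)
  · exact (hasSum_shift (hasSum_mul_mass k lam) _).mul_left _
  · exact (hasSum_shift (hasSum_mass k lam) _).mul_left _

/-- Integral of the clamped parabola `max (c² - y²) 0`, up to a constant. -/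
noncomputable def clampCubic (c y : ℝ) : ℝ :=
  c ^ 2 * max (-c) (min c y) - (max (-c) (min c y)) ^ 3 / 3

theorem clampCubic_le {c : ℝ} (hc : 0 ≤ c) (y : ℝ) : clampCubic c y ≤ 2 * c ^ 3 / 3 := by
  unfold clampCubic
  have h1 : max (-c) (min c y) ≤ c := max_le (by linarith) (min_le_left _ _)
  have h2 : -c ≤ max (-c) (min c y) := le_max_left _ _
  generalize max (-c) (min c y) = t at *
  nlinarith [mul_nonneg (sq_nonneg (c - t)) (by linarith : 0 ≤ 2 * c + t)]

theorem neg_le_clampCubic {c : ℝ} (hc : 0 ≤ c) (y : ℝ) : -(2 * c ^ 3 / 3) ≤ clampCubic c y := by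
  unfold clampCubic
  have h1 : max (-c) (min c y) ≤ c := max_le (by linarith) (min_le_left _ _)
  have h2 : -c ≤ max (-c) (min c y) := le_max_left _ _
  generalize max (-c) (min c y) = t at *
  nlinarith [mul_nonneg (sq_nonneg (c + t)) (by linarith : 0 ≤ 2 * c - t)]

theorem clampCubic_mono {c : ℝ} (hc : 0 ≤ c) {x y : ℝ} (hxy : x ≤ y) :
    clampCubic c x ≤ clampCubic c y := by
  unfold clampCubic
  have h : max (-c) (min c x) ≤ max (-c) (min c y) :=
    max_le_max le_rfl (min_le_min le_rfl hxy)
  have h1 : max (-c) (min c y) ≤ c := max_le (by linarith) (min_le_left _ _)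
  have h2 : -c ≤ max (-c) (min c x) := le_max_left _ _
  generalize max (-c) (min c x) = s at *
  generalize max (-c) (min c y) = t at *
  have hs : s ^ 2 ≤ c ^ 2 := by nlinarith
  have ht : t ^ 2 ≤ c ^ 2 := by nlinarith
  have hst : s * t ≤ c ^ 2 := by nlinarith [sq_nonneg (s - t)]
  nlinarith [mul_nonneg (sub_nonneg.2 h) (by linarith : 0 ≤ 3 * c ^ 2 - s ^ 2 - t ^ 2 - s * t)]

theorem clampCubic_sub_ge {c : ℝ} (hc : 0 ≤ c) (x : ℝ) :
    c ^ 2 - x ^ 2 - 1 / 12 ≤ clampCubic c (x + 1 / 2) - clampCubic c (x - 1 / 2) := by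
  have hP : ∀ y : ℝ, -c ≤ y → c ^ 2 * y - y ^ 3 / 3 ≤ clampCubic c y := by
    intro y hy
    rcases le_total y c with h | h
    · unfold clampCubic
      rw [min_eq_right h, max_eq_right hy]
    · unfold clampCubic
      rw [min_eq_left h, max_eq_right (by linarith)]
      nlinarith [mul_nonneg (sq_nonneg (y - c)) (by linarith : 0 ≤ 2 * c + y)]
  have hQ : ∀ y : ℝ, y ≤ c → clampCubic c y ≤ c ^ 2 * y - y ^ 3 / 3 := by
    intro y hy
    rcases le_total (-c) y with h | h
    · unfold clampCubic
      rw [min_eq_right hy, max_eq_right h]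
    · unfold clampCubic
      rw [min_eq_right hy, max_eq_left h]
      nlinarith [mul_nonneg (sq_nonneg (y + c)) (by linarith : 0 ≤ 2 * c - y)]
  have hm := clampCubic_mono hc (show x - 1 / 2 ≤ x + 1 / 2 by linarith)
  by_cases h1 : -c ≤ x + 1 / 2
  · by_cases h2 : x - 1 / 2 ≤ c
    · have := hP _ h1
      have := hQ _ h2
      nlinarith
    · push Not at h2
      nlinarith
  · push Not at h1
    nlinarith

theorem sum_parabola_le {c : ℝ} (hc : 0 ≤ c) (mu : ℝ) (s : Finset ℤ) :
    ∑ n ∈ s, max 0 (c ^ 2 - ((n : ℝ) - mu) ^ 2 - 1 / 12) ≤ 4 * c ^ 3 / 3 := by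
  obtain ⟨N, hN⟩ : ∃ N : ℕ, ∀ n ∈ s, n.natAbs ≤ N :=
    ⟨s.sup Int.natAbs, fun n hn => Finset.le_sup (f := Int.natAbs) hn⟩
  set G : ℤ → ℝ := fun n => clampCubic c ((n : ℝ) - mu - 1 / 2) with hG
  have hterm : ∀ n : ℤ, max 0 (c ^ 2 - ((n : ℝ) - mu) ^ 2 - 1 / 12) ≤ G (n + 1) - G n := by
    intro n
    have e : G (n + 1) = clampCubic c ((n : ℝ) - mu + 1 / 2) := by
      simp only [hG]; push_cast; ring_nf
    rw [e]
    refine max_le ?_ (clampCubic_sub_ge hc _)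
    exact sub_nonneg.2 (clampCubic_mono hc (by linarith))
  have himg : s ⊆ (Finset.range (2 * N + 1)).image fun i : ℕ => (i : ℤ) - N := by
    intro n hn
    have := hN n hn
    refine Finset.mem_image.2 ⟨(n + N).toNat, Finset.mem_range.2 (by omega), by omega⟩
  calc ∑ n ∈ s, max 0 (c ^ 2 - ((n : ℝ) - mu) ^ 2 - 1 / 12)
      ≤ ∑ n ∈ (Finset.range (2 * N + 1)).image fun i : ℕ => (i : ℤ) - N,
          max 0 (c ^ 2 - ((n : ℝ) - mu) ^ 2 - 1 / 12) :=
        Finset.sum_le_sum_of_subset_of_nonneg himg fun _ _ _ => le_max_left _ _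
    _ = ∑ i ∈ Finset.range (2 * N + 1),
          max 0 (c ^ 2 - ((((i : ℤ) - N : ℤ) : ℝ) - mu) ^ 2 - 1 / 12) :=
        Finset.sum_image fun a _ b _ h => by simpa using h
    _ ≤ ∑ i ∈ Finset.range (2 * N + 1), (G (((i + 1 : ℕ) : ℤ) - N) - G ((i : ℤ) - N)) := by
        refine Finset.sum_le_sum fun i _ => (hterm _).trans (le_of_eq ?_)
        congr 2
        push_cast; ring
    _ = G (((2 * N + 1 : ℕ) : ℤ) - N) - G (((0 : ℕ) : ℤ) - N) :=
        Finset.sum_range_sub (fun i : ℕ => G ((i : ℤ) - N)) _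
    _ ≤ 4 * c ^ 3 / 3 := by
        have h1 := clampCubic_le hc ((((2 * N + 1 : ℕ) : ℤ) - N : ℤ) - mu - 1 / 2)
        have h2 := neg_le_clampCubic hc ((((0 : ℕ) : ℤ) - N : ℤ) - mu - 1 / 2)
        simp only [hG]
        linarith

/-- The maximal mass is bounded below in terms of the variance. -/
theorem exp_le_mul_sqrt_of_mass_le {k : ℕ} {lam M : ℝ} (hl : 0 ≤ lam)
    (hM : ∀ n, mass k lam n ≤ M) :
    Real.exp (k * lam) ≤ M * Real.sqrt (12 * (lam * sqs k) + 1) := by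
  have hM0 : 0 ≤ M := (mass_nonneg hl 0).trans (hM 0)
  have hs : 0 ≤ lam * sqs k := mul_nonneg hl (by unfold sqs; positivity)
  set v := lam * sqs k with hv
  set W := Real.exp (k * lam)
  set c := Real.sqrt (12 * v + 1) / 2 with hc
  have hc0 : 0 < c := by positivity
  have hc2 : c ^ 2 = 3 * v + 1 / 4 := by
    rw [hc, div_pow, Real.sq_sqrt (by positivity)]; ring
  set mu := lam * kap k with hmu
  have hsum : HasSum (fun n : ℤ => mass k lam n * (c ^ 2 - ((n : ℝ) - mu) ^ 2 - 1 / 12))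
      ((2 * c ^ 2 / 3) * W) := by
    have h0 := hasSum_mass k lam
    have h1 := hasSum_mul_mass k lam
    have h2 := hasSum_sq_mul_mass k lam
    have h3 := ((h0.mul_left (c ^ 2 - 1 / 12 - mu ^ 2)).add (h1.mul_left (2 * mu))).sub h2
    have e1 : (2 * c ^ 2 / 3) * W = (c ^ 2 - 1 / 12 - mu ^ 2) * Real.exp (k * lam) +
        2 * mu * (lam * kap k * Real.exp (k * lam)) -
        ((lam * kap k) ^ 2 + lam * sqs k) * Real.exp (k * lam) := by
      rw [← hmu, ← hv, hc2]; ring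
    rw [e1]
    refine h3.congr_fun fun n => ?_
    ring
  have hle : (2 * c ^ 2 / 3) * W ≤ M * (4 * c ^ 3 / 3) := by
    refine hasSum_le_of_sum_le hsum fun s => ?_
    calc ∑ n ∈ s, mass k lam n * (c ^ 2 - ((n : ℝ) - mu) ^ 2 - 1 / 12)
        ≤ ∑ n ∈ s, M * max 0 (c ^ 2 - ((n : ℝ) - mu) ^ 2 - 1 / 12) := by
          refine Finset.sum_le_sum fun n _ => ?_
          refine (mul_le_mul_of_nonneg_left (le_max_right 0 _) (mass_nonneg hl n)).trans ?_
          exact mul_le_mul_of_nonneg_right (hM n) (le_max_left _ _)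
      _ ≤ M * (4 * c ^ 3 / 3) := by
          rw [← Finset.mul_sum]
          exact mul_le_mul_of_nonneg_left (sum_parabola_le hc0.le mu s) hM0
  have h4 : Real.sqrt (12 * v + 1) = 2 * c := by rw [hc]; ring
  rw [h4]
  have h5 : 0 < 2 * c ^ 2 / 3 := by positivity
  refine le_of_mul_le_mul_left ?_ h5
  linarith [hle, show (2 * c ^ 2 / 3) * (M * (2 * c)) = M * (4 * c ^ 3 / 3) by ring]

end PoissonOrderK

open MeasureTheory in
/-- Even moments of a centred Gaussian weight. -/
theorem PoissonOrderK.integral_pow_mul_exp (j : ℕ) {s : ℝ} (hs : 0 < s) :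
    Integrable (fun x : ℝ => x ^ (2 * j) * Real.exp (-((s * x) ^ 2 / 2))) ∧
    ∫ x : ℝ, x ^ (2 * j) * Real.exp (-((s * x) ^ 2 / 2)) =
      Real.sqrt (2 * Real.pi) * (Nat.doubleFactorial (2 * j - 1) : ℝ) / s ^ (2 * j + 1) := by
  have hb : 0 < s ^ 2 / 2 := by positivity
  have e1 : ∀ x : ℝ, x ^ (2 * j) * Real.exp (-((s * x) ^ 2 / 2)) =
      |x| ^ (2 * j) * Real.exp (-(s ^ 2 / 2) * |x| ^ 2) := by
    intro x
    rw [pow_mul, pow_mul, sq_abs, mul_pow]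
    congr 2; ring
  constructor
  · have h := integrable_rpow_mul_exp_neg_mul_sq hb
      (s := (2 * j : ℕ)) (by have : (0 : ℝ) ≤ (2 * j : ℕ) := by positivity
                             linarith)
    refine h.congr (Filter.Eventually.of_forall fun x => ?_)
    simp only [Real.rpow_natCast]
    rw [mul_pow]; ring_nf
  · simp only [e1]
    rw [integral_comp_abs (f := fun x => x ^ (2 * j) * Real.exp (-(s ^ 2 / 2) * x ^ 2))]
    have h := integral_rpow_mul_exp_neg_mul_rpow (p := 2) (q := (2 * j : ℕ)) (b := s ^ 2 / 2)
      (by norm_num) (by have : (0 : ℝ) ≤ (2 * j : ℕ) := by positivity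
                        linarith) hb
    have e2 : ∀ x : ℝ, x ^ (((2 * j : ℕ) : ℝ)) * Real.exp (-(s ^ 2 / 2) * x ^ (2 : ℝ)) =
        x ^ (2 * j) * Real.exp (-(s ^ 2 / 2) * x ^ 2) := by
      intro x
      rw [Real.rpow_natCast, Real.rpow_two]
    simp only [e2] at h
    rw [h]
    have e3 : (((2 * j : ℕ) : ℝ) + 1) / 2 = (j : ℝ) + 1 / 2 := by push_cast; ring
    have e4 : (s ^ 2 / 2) ^ (-(((2 * j : ℕ) : ℝ) + 1) / 2) =
        Real.sqrt 2 * 2 ^ j / s ^ (2 * j + 1) := by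
      rw [neg_div, Real.rpow_neg hb.le, e3, Real.rpow_add hb, Real.rpow_natCast, ← Real.sqrt_eq_rpow,
        Real.sqrt_div (by positivity), Real.sqrt_sq hs.le, div_pow, ← pow_mul]
      field_simp
      ring
    rw [e3, e4, Real.Gamma_nat_add_half, Real.sqrt_mul (by norm_num)]
    field_simp

namespace PoissonOrderK

theorem cos_le_quartic (x : ℝ) : Real.cos x ≤ 1 - x ^ 2 / 2 + x ^ 4 / 24 := by
  wlog hx : 0 ≤ x with H
  · have := H (-x) (by linarith)
    rw [Real.cos_neg] at this
    nlinarith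
  have hm : MonotoneOn (fun y : ℝ => 1 - y ^ 2 / 2 + y ^ 4 / 24 - Real.cos y) (Set.Ici 0) := by
    refine monotoneOn_of_deriv_nonneg (convex_Ici 0) (by fun_prop) (by fun_prop) fun y hy => ?_
    rw [interior_Ici, Set.mem_Ioi] at hy
    have hd : HasDerivAt (fun y : ℝ => 1 - y ^ 2 / 2 + y ^ 4 / 24 - Real.cos y)
        (-y + y ^ 3 / 6 + Real.sin y) y := by
      have h1 := (hasDerivAt_pow 2 y).div_const 2
      have h2 := (hasDerivAt_pow 4 y).div_const 24
      refine ((((hasDerivAt_const y (1 : ℝ)).sub h1).add h2).sub (Real.hasDerivAt_cos y)).congr_deriv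
        ?_
      push_cast; ring
    rw [hd.deriv]
    linarith [Real.sin_ge_sub_cube hy.le]
  have := hm (Set.mem_Ici.2 le_rfl) (Set.mem_Ici.2 hx) hx
  simp only [Real.cos_zero] at this
  linarith

/-- The exponent of the modulus of the characteristic function. -/
noncomputable def charExp (k : ℕ) (lam θ : ℝ) : ℝ :=
  lam * ∑ j ∈ Finset.range k, (1 - Real.cos (((j : ℝ) + 1) * θ))

theorem sum_range_succ_cast_pow_four (k : ℕ) :
    ∑ i ∈ Finset.range k, ((i : ℝ) + 1) ^ 4 =
      (k : ℝ) * (k + 1) * (2 * k + 1) / 6 * (3 * k ^ 2 + 3 * k - 1) / 5 := by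
  induction k with
  | zero => simp
  | succ k ih => rw [Finset.sum_range_succ, ih]; push_cast; ring

theorem charExp_ge_quartic {k : ℕ} {lam : ℝ} (hl : 0 ≤ lam) (θ : ℝ) :
    lam * sqs k * (θ ^ 2 / 2 - ((k : ℝ) + 1 / 2) ^ 2 * θ ^ 4 / 40) ≤ charExp k lam θ := by
  rw [charExp, mul_assoc]
  refine mul_le_mul_of_nonneg_left ?_ hl
  have h1 : ∑ j ∈ Finset.range k, (((j : ℝ) + 1) ^ 2 * (θ ^ 2 / 2) -
      ((j : ℝ) + 1) ^ 4 * (θ ^ 4 / 24)) ≤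
      ∑ j ∈ Finset.range k, (1 - Real.cos (((j : ℝ) + 1) * θ)) := by
    refine Finset.sum_le_sum fun j _ => ?_
    have := cos_le_quartic (((j : ℝ) + 1) * θ)
    rw [mul_pow, mul_pow] at this
    linarith
  refine le_trans ?_ h1
  rw [Finset.sum_sub_distrib, ← Finset.sum_mul, ← Finset.sum_mul, sum_range_succ_cast_sq,
    sum_range_succ_cast_pow_four]
  have h2 : 0 ≤ sqs k * θ ^ 4 := by unfold sqs; positivity
  have h3 : (k : ℝ) * (k + 1) * (2 * k + 1) / 6 * (3 * k ^ 2 + 3 * k - 1) / 5 =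
      sqs k * (3 * ((k : ℝ) + 1 / 2) ^ 2 - 7 / 4) / 5 := by unfold sqs; ring
  rw [h3]
  nlinarith

theorem two_mul_sin_mul_sum_cos (k : ℕ) (θ : ℝ) :
    2 * Real.sin (θ / 2) * ∑ j ∈ Finset.range k, Real.cos (((j : ℝ) + 1) * θ) =
      Real.sin (((k : ℝ) + 1 / 2) * θ) - Real.sin (θ / 2) := by
  induction k with
  | zero => simp; ring_nf
  | succ k ih =>
    rw [Finset.sum_range_succ, mul_add, ih]
    push_cast
    rw [show ((k : ℝ) + 1 / 2) * θ = ((k : ℝ) + 1) * θ - θ / 2 by ring,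
      show ((k : ℝ) + 1 + 1 / 2) * θ = ((k : ℝ) + 1) * θ + θ / 2 by ring, Real.sin_sub, Real.sin_add]
    ring

theorem sin_mul_le {h θ : ℝ} (hh : 5 / 2 ≤ h) (h1 : 5 / 2 ≤ h * θ) (h2 : θ ≤ Real.pi) :
    Real.sin (h * θ) ≤ 0.27 * h * (2 * Real.sin (θ / 2)) := by
  have hh0 : 0 < h := by linarith
  have hθ : 0 < θ := by
    by_contra hc
    push Not at hc
    nlinarith
  have hs : 0 ≤ Real.sin (θ / 2) :=
    Real.sin_nonneg_of_nonneg_of_le_pi (by linarith) (by linarith)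
  have hpi := Real.pi_lt_d4
  have hpi3 := Real.pi_gt_three
  rcases le_or_gt (h * θ) Real.pi with h3 | h3
  · have e1 : Real.sin (h * θ) ≤ 0.6416 := by
      rw [← Real.sin_pi_sub]
      have := Real.sin_le (show 0 ≤ Real.pi - h * θ by linarith)
      linarith
    set u := 1.25 / h with hu
    have hu0 : 0 < u := by positivity
    have hu1 : u ≤ 1 / 2 := by rw [hu, div_le_iff₀ hh0]; linarith
    have huθ : u ≤ θ / 2 := by rw [hu, div_le_iff₀ hh0]; linarith
    have e2 : Real.sin u ≤ Real.sin (θ / 2) :=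
      Real.sin_le_sin_of_le_of_le_pi_div_two (by linarith) (by linarith) huθ
    have e3 := Real.sin_ge_sub_cube hu0.le
    have e4 : h * u = 1.25 := by rw [hu]; field_simp
    have e5 : 1.25 * (1 - 1 / 24) ≤ h * Real.sin (θ / 2) := by
      have : h * (u * (1 - 1 / 24)) ≤ h * Real.sin (θ / 2) := by
        refine mul_le_mul_of_nonneg_left ?_ hh0.le
        refine le_trans ?_ (e3.trans e2)
        nlinarith [mul_nonneg hu0.le (by nlinarith : 0 ≤ 1 / 4 - u ^ 2)]
      nlinarith
    nlinarith
  · rcases le_or_gt (h * θ) (2 * Real.pi) with h4 | h4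
    · have : Real.sin (h * θ) ≤ 0 := by
        have e : Real.sin (h * θ) = Real.sin (h * θ - 2 * Real.pi) := by
          rw [Real.sin_sub_two_pi]
        rw [e]
        exact Real.sin_nonpos_of_nonpos_of_neg_pi_le (by linarith) (by linarith)
      exact this.trans (by positivity)
    · have e1 := Real.mul_le_sin (x := θ / 2) (by linarith) (by linarith)
      have e2 := Real.sin_le_one (h * θ)
      have e3 : 2 ≤ h * Real.sin (θ / 2) := by
        have : h * (2 / Real.pi * (θ / 2)) ≤ h * Real.sin (θ / 2) :=
          mul_le_mul_of_nonneg_left e1 hh0.le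
        refine le_trans ?_ this
        rw [show h * (2 / Real.pi * (θ / 2)) = h * θ / Real.pi by ring,
          le_div_iff₀ (by linarith)]
        linarith
      nlinarith

theorem charExp_abs (k : ℕ) (lam θ : ℝ) : charExp k lam |θ| = charExp k lam θ := by
  rcases abs_choice θ with h | h <;> rw [h]
  simp [charExp]

theorem charExp_ge_tail {k : ℕ} (hk : 2 ≤ k) {lam θ : ℝ} (hl : 0 ≤ lam)
    (h1 : 5 / 2 ≤ ((k : ℝ) + 1 / 2) * |θ|) (h2 : |θ| ≤ Real.pi) :
    0.73 * (lam * ((k : ℝ) + 1 / 2)) ≤ charExp k lam θ := by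
  rw [← charExp_abs]
  set t := |θ| with ht
  have hk' : (2 : ℝ) ≤ k := by exact_mod_cast hk
  have ht0 : 0 < t := by
    rcases (abs_nonneg θ).lt_or_eq with h | h
    · exact h
    · rw [← ht] at h; rw [← h] at h1; norm_num at h1
  have hs : 0 < Real.sin (t / 2) :=
    Real.sin_pos_of_pos_of_lt_pi (by linarith) (by linarith [Real.pi_pos])
  have h3 := sin_mul_le (by linarith : 5 / 2 ≤ (k : ℝ) + 1 / 2) h1 h2
  have h4 := two_mul_sin_mul_sum_cos k t
  have h5 : ∑ j ∈ Finset.range k, Real.cos (((j : ℝ) + 1) * t) ≤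
      0.27 * ((k : ℝ) + 1 / 2) - 1 / 2 := by
    have : (2 * Real.sin (t / 2)) * ∑ j ∈ Finset.range k, Real.cos (((j : ℝ) + 1) * t) ≤
        (2 * Real.sin (t / 2)) * (0.27 * ((k : ℝ) + 1 / 2) - 1 / 2) := by
      rw [h4]; linarith
    exact le_of_mul_le_mul_left this (by linarith)
  rw [charExp, Finset.sum_sub_distrib, Finset.sum_const, Finset.card_range, nsmul_eq_mul]
  rw [show 0.73 * (lam * ((k : ℝ) + 1 / 2)) = lam * (0.73 * ((k : ℝ) + 1 / 2)) by ring]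
  refine mul_le_mul_of_nonneg_left ?_ hl
  linarith

theorem exp_le_quadratic {y : ℝ} (hy : 0 ≤ y) :
    Real.exp y ≤ 1 + y + y ^ 2 / 2 * Real.exp y := by
  have h1 := Real.one_sub_le_exp_neg y
  have hm : MonotoneOn (fun y : ℝ => (1 + y) * Real.exp (-y) + y ^ 2 / 2) (Set.Ici 0) := by
    refine monotoneOn_of_deriv_nonneg (convex_Ici 0) (by fun_prop) (by fun_prop) fun y hy => ?_
    rw [interior_Ici, Set.mem_Ioi] at hy
    have hd : HasDerivAt (fun y : ℝ => (1 + y) * Real.exp (-y) + y ^ 2 / 2)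
        (y * (1 - Real.exp (-y))) y := by
      have h1 := (hasDerivAt_pow 2 y).div_const 2
      have h2 := ((hasDerivAt_id y).neg).exp
      refine ((((hasDerivAt_id y).const_add 1).mul h2).add h1).congr_deriv ?_
      simp only [id, Pi.neg_apply]
      push_cast; ring
    rw [hd.deriv]
    have : Real.exp (-y) ≤ 1 := Real.exp_le_one_iff.2 (by linarith)
    exact mul_nonneg hy.le (by linarith)
  have := hm (Set.mem_Ici.2 le_rfl) (Set.mem_Ici.2 hy) hy
  simp only [neg_zero, Real.exp_zero] at this
  have h2 : 0 < Real.exp y := Real.exp_pos y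
  have h3 : Real.exp (-y) * Real.exp y = 1 := by rw [← Real.exp_add]; simp
  nlinarith [mul_le_mul_of_nonneg_right this h2.le]

/-- Pointwise bound of the modulus of the characteristic function. -/
theorem exp_neg_charExp_le {k : ℕ} (hk : 2 ≤ k) {lam s q θ : ℝ} (hl : 0 ≤ lam)
    (hs : s ^ 2 = lam * sqs k) (hq : q * s ^ 2 = ((k : ℝ) + 1 / 2) ^ 2 / 40) (hq0 : 0 ≤ q)
    (hθ : |θ| ≤ Real.pi) :
    Real.exp (-charExp k lam θ) ≤
      ((1 + q * (s * θ) ^ 4) * Real.exp (-((s * θ) ^ 2 / 2)) +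
        q ^ 2 / 2 * (s * θ) ^ 8 * Real.exp (-((0.829 * s * θ) ^ 2 / 2))) +
      Real.exp (-(0.73 * (lam * ((k : ℝ) + 1 / 2)))) := by
  rcases le_or_gt (5 / 2) (((k : ℝ) + 1 / 2) * |θ|) with h | h
  · have h1 := charExp_ge_tail hk hl h hθ
    have h2 : Real.exp (-charExp k lam θ) ≤ Real.exp (-(0.73 * (lam * ((k : ℝ) + 1 / 2)))) :=
      Real.exp_le_exp.2 (by linarith)
    refine h2.trans (le_add_of_nonneg_left (by positivity))
  · have h1 := charExp_ge_quartic (k := k) hl θ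
    rw [← hs] at h1
    set y := q * (s * θ) ^ 4 with hy
    have hy0 : 0 ≤ y := by positivity
    have e1 : s ^ 2 * (θ ^ 2 / 2 - ((k : ℝ) + 1 / 2) ^ 2 * θ ^ 4 / 40) =
        (s * θ) ^ 2 / 2 - y := by
      rw [hy]
      have : q * (s * θ) ^ 4 = (q * s ^ 2) * (s ^ 2 * θ ^ 4) := by ring
      rw [this, hq]; ring
    rw [e1] at h1
    have h2 : (((k : ℝ) + 1 / 2) * θ) ^ 2 ≤ 25 / 4 := by
      have : (((k : ℝ) + 1 / 2) * |θ|) ^ 2 ≤ (5 / 2) ^ 2 :=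
        pow_le_pow_left₀ (by positivity) h.le 2
      rw [mul_pow, sq_abs] at this
      rw [mul_pow]; linarith
    have h3 : y ≤ 0.3125 * ((s * θ) ^ 2 / 2) := by
      have : y = (s * θ) ^ 2 * ((((k : ℝ) + 1 / 2) * θ) ^ 2 / 40) := by
        rw [hy, show q * (s * θ) ^ 4 = (q * s ^ 2) * (s ^ 2 * θ ^ 4) by ring, hq]; ring
      rw [this]
      nlinarith [mul_le_mul_of_nonneg_left h2 (sq_nonneg (s * θ))]
    refine le_add_of_le_of_nonneg ?_ (Real.exp_pos _).le
    calc Real.exp (-charExp k lam θ) ≤ Real.exp (y + -((s * θ) ^ 2 / 2)) :=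
          Real.exp_le_exp.2 (by linarith)
      _ = Real.exp y * Real.exp (-((s * θ) ^ 2 / 2)) := Real.exp_add _ _
      _ ≤ (1 + y + y ^ 2 / 2 * Real.exp y) * Real.exp (-((s * θ) ^ 2 / 2)) :=
          mul_le_mul_of_nonneg_right (exp_le_quadratic hy0) (Real.exp_pos _).le
      _ = (1 + y) * Real.exp (-((s * θ) ^ 2 / 2)) +
            y ^ 2 / 2 * Real.exp (y + -((s * θ) ^ 2 / 2)) := by rw [Real.exp_add]; ring
      _ ≤ _ := by
          refine add_le_add le_rfl ?_
          have e2 : y ^ 2 / 2 = q ^ 2 / 2 * (s * θ) ^ 8 := by rw [hy]; ring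
          rw [e2]
          refine mul_le_mul_of_nonneg_left (Real.exp_le_exp.2 ?_) (by positivity)
          nlinarith [sq_nonneg (s * θ)]

/-- Backward difference. -/
def bdiff (f : ℤ → ℝ) (n : ℤ) : ℝ := f n - f (n - 1)

theorem integral_exp_int (n : ℤ) :
    ∫ θ in (-Real.pi)..Real.pi, Complex.exp (θ * Complex.I) ^ n =
      if n = 0 then (2 * Real.pi : ℂ) else 0 := by
  split_ifs with h
  · subst h
    simp only [zpow_zero, intervalIntegral.integral_const]
    rw [Complex.real_smul]; push_cast; ring
  · have hc : (n : ℂ) * Complex.I ≠ 0 := by simp [h]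
    have e : ∀ θ : ℝ, Complex.exp (θ * Complex.I) ^ n = Complex.exp ((n * Complex.I) * θ) := by
      intro θ
      rw [← Complex.exp_int_mul]; ring_nf
    simp only [e]
    rw [integral_exp_mul_complex hc, div_eq_zero_iff]
    left
    rw [sub_eq_zero, Complex.exp_eq_exp_iff_exists_int]
    exact ⟨n, by push_cast; ring⟩

/-- Fourier inversion for the masses. -/
theorem integral_char_eq (k : ℕ) (lam : ℝ) (m : ℤ) :
    ∫ θ in (-Real.pi)..Real.pi,
      Complex.exp (lam * ∑ j ∈ Finset.range k, Complex.exp (θ * Complex.I) ^ (j + 1)) *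
        Complex.exp (θ * Complex.I) ^ (-m) = 2 * Real.pi * mass k lam m := by
  have hne : ∀ θ : ℝ, Complex.exp (θ * Complex.I) ≠ 0 := fun θ => Complex.exp_ne_zero _
  have hsum : Summable fun n : ℤ => |mass k lam n| := (hasSum_mass k lam).summable.norm
  have key := intervalIntegral.hasSum_integral_of_dominated_convergence
    (μ := MeasureTheory.volume) (a := -Real.pi) (b := Real.pi)
    (F := fun (n : ℤ) (θ : ℝ) => (mass k lam n : ℂ) * Complex.exp (θ * Complex.I) ^ (n - m))
    (f := fun θ : ℝ => Complex.exp (lam * ∑ j ∈ Finset.range k,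
      Complex.exp (θ * Complex.I) ^ (j + 1)) * Complex.exp (θ * Complex.I) ^ (-m))
    (fun n _ => |mass k lam n|) (fun n => ?_) (fun n => ?_) ?_ ?_ ?_
  · refine key.unique ?_
    have e : ∀ n : ℤ, ∫ θ in (-Real.pi)..Real.pi,
        (mass k lam n : ℂ) * Complex.exp (θ * Complex.I) ^ (n - m) =
        if n = m then 2 * Real.pi * (mass k lam m : ℂ) else 0 := by
      intro n
      rw [intervalIntegral.integral_const_mul, integral_exp_int]
      by_cases h : n = m
      · subst h; simp; ring
      · rw [if_neg h, if_neg (by omega), mul_zero]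
    simp only [e]
    exact hasSum_ite_eq m _
  · refine Continuous.aestronglyMeasurable ?_
    refine continuous_const.mul (Continuous.zpow₀ (by fun_prop) _ fun θ => Or.inl (hne θ))
  · refine Filter.Eventually.of_forall fun θ _ => ?_
    rw [norm_mul, norm_zpow, Complex.norm_exp_ofReal_mul_I, one_zpow, mul_one, Complex.norm_real,
      Real.norm_eq_abs]
  · exact Filter.Eventually.of_forall fun θ _ => hsum
  · exact intervalIntegrable_const
  · refine Filter.Eventually.of_forall fun θ _ => ?_
    have h := (hasSum_mass_mul_pow k lam (z := Complex.exp (θ * Complex.I))).mul_right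
      (Complex.exp (θ * Complex.I) ^ (-m))
    refine h.congr_fun fun n => ?_
    rw [mul_assoc, ← zpow_add₀ (hne θ), sub_eq_add_neg]

theorem continuous_char (k : ℕ) (lam : ℝ) (r : ℕ) (m : ℤ) : Continuous fun θ : ℝ =>
    Complex.exp (lam * ∑ j ∈ Finset.range k, Complex.exp (θ * Complex.I) ^ (j + 1)) *
      Complex.exp (θ * Complex.I) ^ (-m) * (1 - Complex.exp (θ * Complex.I)) ^ r := by
  refine ((by fun_prop : Continuous fun θ : ℝ => Complex.exp (lam * ∑ j ∈ Finset.range k,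
    Complex.exp (θ * Complex.I) ^ (j + 1))).mul (Continuous.zpow₀ (by fun_prop) _ fun θ =>
      Or.inl (Complex.exp_ne_zero _))).mul (by fun_prop)

theorem integral_char_bdiff (k : ℕ) (lam : ℝ) (r : ℕ) (m : ℤ) :
    ∫ θ in (-Real.pi)..Real.pi,
      Complex.exp (lam * ∑ j ∈ Finset.range k, Complex.exp (θ * Complex.I) ^ (j + 1)) *
        Complex.exp (θ * Complex.I) ^ (-m) * (1 - Complex.exp (θ * Complex.I)) ^ r =
      2 * Real.pi * (bdiff^[r] (mass k lam) m : ℝ) := by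
  induction r generalizing m with
  | zero => simpa using integral_char_eq k lam m
  | succ r ih =>
    rw [Function.iterate_succ_apply', bdiff]
    push_cast
    rw [mul_sub, ← ih, ← ih, ← intervalIntegral.integral_sub
      ((continuous_char k lam r m).intervalIntegrable _ _)
      ((continuous_char k lam r (m - 1)).intervalIntegrable _ _)]
    refine intervalIntegral.integral_congr fun θ _ => ?_
    have e : Complex.exp (θ * Complex.I) ^ (-(m - 1)) =
        Complex.exp (θ * Complex.I) ^ (-m) * Complex.exp (θ * Complex.I) := by
      rw [← zpow_add_one₀ (Complex.exp_ne_zero _)]; ring_nf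
    simp only [e]
    ring

/-- Absolute trigonometric moments of the characteristic function. -/
noncomputable def charMoment (k : ℕ) (lam : ℝ) (r : ℕ) : ℝ :=
  ∫ θ in (-Real.pi)..Real.pi,
    ‖1 - Complex.exp (θ * Complex.I)‖ ^ r * Real.exp (-charExp k lam θ)

theorem continuous_charMoment (k : ℕ) (lam : ℝ) (r : ℕ) : Continuous fun θ : ℝ =>
    ‖1 - Complex.exp (θ * Complex.I)‖ ^ r * Real.exp (-charExp k lam θ) := by
  unfold charExp
  fun_prop

theorem norm_char (k : ℕ) (lam θ : ℝ) :
    ‖Complex.exp (lam * ∑ j ∈ Finset.range k, Complex.exp (θ * Complex.I) ^ (j + 1))‖ =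
      Real.exp (k * lam) * Real.exp (-charExp k lam θ) := by
  rw [Complex.norm_exp, ← Real.exp_add]
  congr 1
  have e : ∀ j : ℕ, Complex.exp (θ * Complex.I) ^ (j + 1) =
      Complex.exp (((((j : ℝ) + 1) * θ : ℝ) : ℂ) * Complex.I) := by
    intro j
    rw [← Complex.exp_nat_mul]; push_cast; ring_nf
  simp only [e]
  rw [Complex.re_ofReal_mul, Complex.re_sum, charExp, Finset.sum_sub_distrib]
  simp only [Complex.exp_ofReal_mul_I_re]
  simp
  ring

theorem abs_bdiff_le (k : ℕ) (lam : ℝ) (r : ℕ) (m : ℤ) :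
    |bdiff^[r] (mass k lam) m| ≤
      Real.exp (k * lam) * (charMoment k lam r / (2 * Real.pi)) := by
  have hpi := Real.pi_pos
  have h := integral_char_bdiff k lam r m
  have h2 : ‖(2 * Real.pi * (bdiff^[r] (mass k lam) m : ℝ) : ℂ)‖ ≤
      Real.exp (k * lam) * charMoment k lam r := by
    rw [← h, charMoment, ← intervalIntegral.integral_const_mul]
    refine intervalIntegral.norm_integral_le_of_norm_le (by linarith)
      (Filter.Eventually.of_forall fun θ _ => le_of_eq ?_)
      (((continuous_charMoment k lam r).const_mul _).intervalIntegrable _ _)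
    rw [norm_mul, norm_mul, norm_zpow, Complex.norm_exp_ofReal_mul_I, one_zpow, norm_char,
      norm_pow]
    ring
  rw [norm_mul, Complex.norm_real, Real.norm_eq_abs, norm_mul, Complex.norm_real,
    Real.norm_of_nonneg hpi.le, Complex.norm_ofNat] at h2
  rw [← mul_div_assoc, le_div_iff₀ (by positivity)]
  linarith

theorem charMoment_even_le {k : ℕ} (hk : 2 ≤ k) {lam s q : ℝ} (hl : 0 ≤ lam) (hs0 : 0 < s)
    (hs : s ^ 2 = lam * sqs k) (hq : q * s ^ 2 = ((k : ℝ) + 1 / 2) ^ 2 / 40) (hq0 : 0 ≤ q)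
    (a : ℕ) :
    charMoment k lam (2 * a) ≤ Real.sqrt (2 * Real.pi) / s ^ (2 * a + 1) *
      (Nat.doubleFactorial (2 * a - 1) + q * Nat.doubleFactorial (2 * (a + 2) - 1) +
        q ^ 2 / 2 * (Nat.doubleFactorial (2 * (a + 4) - 1) / 0.829 ^ (2 * a + 9))) +
      2 * Real.pi * (2 ^ (2 * a) * Real.exp (-(0.73 * (lam * ((k : ℝ) + 1 / 2))))) := by
  have hpi := Real.pi_pos
  set T := 2 ^ (2 * a) * Real.exp (-(0.73 * (lam * ((k : ℝ) + 1 / 2)))) with hT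
  set s' := 0.829 * s with hs'
  have hs'0 : 0 < s' := by positivity
  obtain ⟨i1, v1⟩ := integral_pow_mul_exp a hs0
  obtain ⟨i2, v2⟩ := integral_pow_mul_exp (a + 2) hs0
  obtain ⟨i3, v3⟩ := integral_pow_mul_exp (a + 4) hs'0
  set G : ℝ → ℝ := fun x => x ^ (2 * a) * Real.exp (-((s * x) ^ 2 / 2)) +
    q * s ^ 4 * (x ^ (2 * (a + 2)) * Real.exp (-((s * x) ^ 2 / 2))) +
    q ^ 2 / 2 * s ^ 8 * (x ^ (2 * (a + 4)) * Real.exp (-((s' * x) ^ 2 / 2))) with hG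
  have hGi : MeasureTheory.Integrable G := (i1.add (i2.const_mul _)).add (i3.const_mul _)
  have hGv : ∫ x, G x = Real.sqrt (2 * Real.pi) / s ^ (2 * a + 1) *
      (Nat.doubleFactorial (2 * a - 1) + q * Nat.doubleFactorial (2 * (a + 2) - 1) +
        q ^ 2 / 2 * (Nat.doubleFactorial (2 * (a + 4) - 1) / 0.829 ^ (2 * a + 9))) := by
    have i12 : MeasureTheory.Integrable fun x : ℝ => x ^ (2 * a) * Real.exp (-((s * x) ^ 2 / 2)) +
      q * s ^ 4 * (x ^ (2 * (a + 2)) * Real.exp (-((s * x) ^ 2 / 2))) := i1.add (i2.const_mul _)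
    simp only [hG]
    rw [MeasureTheory.integral_add i12 (i3.const_mul _),
      MeasureTheory.integral_add i1 (i2.const_mul _), MeasureTheory.integral_const_mul,
      MeasureTheory.integral_const_mul, v1, v2, v3, hs', mul_pow]
    have e1 : s ^ (2 * (a + 2) + 1) = s ^ (2 * a + 1) * s ^ 4 := by ring
    have e2 : s ^ (2 * (a + 4) + 1) = s ^ (2 * a + 1) * s ^ 8 := by ring
    have e3 : (0.829 : ℝ) ^ (2 * (a + 4) + 1) = 0.829 ^ (2 * a + 9) := by ring
    rw [e1, e2, e3]
    have : (0.829 : ℝ) ^ (2 * a + 9) ≠ 0 := by positivity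
    field_simp
  have hG0 : ∀ x, 0 ≤ G x := fun x => by
    have e : ∀ b : ℕ, 0 ≤ x ^ (2 * b) := fun b => by rw [pow_mul]; positivity
    have := e a
    have := e (a + 2)
    have := e (a + 4)
    simp only [hG]
    positivity
  have hpt : ∀ θ ∈ Set.Icc (-Real.pi) Real.pi,
      ‖1 - Complex.exp (θ * Complex.I)‖ ^ (2 * a) * Real.exp (-charExp k lam θ) ≤ G θ + T := by
    intro θ hθ
    have h1 := exp_neg_charExp_le hk hl hs hq hq0 (abs_le.2 hθ)
    have n1 : ‖1 - Complex.exp (θ * Complex.I)‖ ≤ |θ| := by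
      rw [norm_sub_rev]
      have := Real.norm_exp_I_mul_ofReal_sub_one_le (x := θ)
      rwa [mul_comm, Real.norm_eq_abs] at this
    have n2 : ‖1 - Complex.exp (θ * Complex.I)‖ ≤ 2 := by
      refine (norm_sub_le _ _).trans ?_
      rw [Complex.norm_exp_ofReal_mul_I]; norm_num
    have n3 : ‖1 - Complex.exp (θ * Complex.I)‖ ^ (2 * a) ≤ θ ^ (2 * a) := by
      have := pow_le_pow_left₀ (norm_nonneg _) n1 (2 * a)
      rwa [pow_mul |θ|, sq_abs, ← pow_mul] at this
    have n4 := pow_le_pow_left₀ (norm_nonneg _) n2 (2 * a)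
    refine (mul_le_mul_of_nonneg_left h1 (by positivity)).trans ?_
    rw [mul_add]
    refine add_le_add ?_ (mul_le_mul_of_nonneg_right n4 (Real.exp_pos _).le)
    refine (mul_le_mul_of_nonneg_right n3 (by positivity)).trans (le_of_eq ?_)
    simp only [hG, hs']
    ring
  have hcont := (continuous_charMoment k lam (2 * a)).intervalIntegrable
    (μ := MeasureTheory.volume) (-Real.pi) Real.pi
  calc charMoment k lam (2 * a) ≤ ∫ θ in (-Real.pi)..Real.pi, (G θ + T) :=
        intervalIntegral.integral_mono_on (by linarith) hcont
          (hGi.intervalIntegrable.add intervalIntegrable_const) hpt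
    _ = (∫ θ in (-Real.pi)..Real.pi, G θ) + 2 * Real.pi * T := by
        rw [intervalIntegral.integral_add hGi.intervalIntegrable intervalIntegrable_const,
          intervalIntegral.integral_const, smul_eq_mul]
        ring
    _ ≤ (∫ θ, G θ) + 2 * Real.pi * T := by
        refine add_le_add ?_ le_rfl
        rw [intervalIntegral.integral_of_le (by linarith)]
        exact MeasureTheory.setIntegral_le_integral hGi (Filter.Eventually.of_forall hG0)
    _ = _ := by rw [hGv]

/-- The regime of parameters where the Gaussian approximation is accurate enough. -/
structure Regular (k : ℕ) (lam s : ℝ) : Prop where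
  two_le : 2 ≤ k
  lam_pos : 0 < lam
  s_pos : 0 < s
  sq_eq : s ^ 2 = lam * sqs k
  ten_le : 10 * ((k : ℝ) + 1 / 2) ^ 2 ≤ s ^ 2
  tail_le : 16 * Real.exp (-(0.73 * (lam * ((k : ℝ) + 1 / 2)))) * s ^ 5 ≤ 0.15

theorem sqrt_two_pi_div : Real.sqrt (2 * Real.pi) / (2 * Real.pi) ≤ 0.39895 := by
  have hpi := Real.pi_gt_d4
  have h0 : (0 : ℝ) < 2 * Real.pi := by positivity
  rw [Real.sqrt_div_self', div_le_iff₀ (Real.sqrt_pos.2 h0)]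
  have : (2.50658 : ℝ) ≤ Real.sqrt (2 * Real.pi) := Real.le_sqrt_of_sq_le (by norm_num; linarith)
  nlinarith

namespace Regular

variable {k : ℕ} {lam s : ℝ}

theorem charMoment_le (h : Regular k lam s) {a : ℕ} {c : ℝ}
    (hc : 0.39895 * ((Nat.doubleFactorial (2 * a - 1) : ℝ) +
      1 / 400 * Nat.doubleFactorial (2 * (a + 2) - 1) +
      (1 / 400) ^ 2 / 2 * (Nat.doubleFactorial (2 * (a + 4) - 1) / 0.829 ^ (2 * a + 9))) ≤ c) :
    charMoment k lam (2 * a) / (2 * Real.pi) ≤ c / s ^ (2 * a + 1) +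
      2 ^ (2 * a) * Real.exp (-(0.73 * (lam * ((k : ℝ) + 1 / 2)))) := by
  have hs0 := h.s_pos
  set q := ((k : ℝ) + 1 / 2) ^ 2 / 40 / s ^ 2 with hq
  have hq0 : 0 ≤ q := by positivity
  have hq1 : q ≤ 1 / 400 := by
    rw [hq, div_le_iff₀ (by positivity)]; linarith [h.ten_le]
  have h1 := charMoment_even_le h.two_le h.lam_pos.le hs0 h.sq_eq
    (q := q) (by rw [hq]; field_simp) hq0 a
  have hpi : 0 < 2 * Real.pi := by positivity
  rw [div_le_iff₀ hpi]
  refine h1.trans ?_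
  rw [add_mul, mul_comm (2 * Real.pi) (_ * _)]
  refine add_le_add ?_ le_rfl
  have h2 := sqrt_two_pi_div
  rw [div_le_iff₀ hpi] at h2
  set A : ℝ := (Nat.doubleFactorial (2 * a - 1) : ℝ) +
    q * Nat.doubleFactorial (2 * (a + 2) - 1) +
    q ^ 2 / 2 * (Nat.doubleFactorial (2 * (a + 4) - 1) / 0.829 ^ (2 * a + 9)) with hA
  have hA0 : 0 ≤ A := by positivity
  have hAc : 0.39895 * A ≤ c := by
    refine le_trans ?_ hc
    rw [hA]
    gcongr
  rw [div_mul_eq_mul_div, div_mul_eq_mul_div]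
  refine div_le_div_of_nonneg_right ?_ (by positivity)
  calc Real.sqrt (2 * Real.pi) * A ≤ 0.39895 * (2 * Real.pi) * A :=
        mul_le_mul_of_nonneg_right h2 hA0
    _ = 0.39895 * A * (2 * Real.pi) := by ring
    _ ≤ c * (2 * Real.pi) := mul_le_mul_of_nonneg_right hAc hpi.le

theorem charMoment_four_le (h : Regular k lam s) :
    charMoment k lam 4 / (2 * Real.pi) ≤ 1.6 / s ^ 5 := by
  have h1 := h.charMoment_le (a := 2) (c := 1.45) (by norm_num [Nat.doubleFactorial])
  have hs := h.s_pos
  refine h1.trans ?_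
  have h2 : 16 * Real.exp (-(0.73 * (lam * ((k : ℝ) + 1 / 2)))) ≤ 0.15 / s ^ 5 := by
    rw [le_div_iff₀ (by positivity)]; exact h.tail_le
  norm_num at h2 ⊢
  have : (8 / 5 : ℝ) / s ^ 5 = 29 / 20 / s ^ 5 + 3 / 20 / s ^ 5 := by ring
  linarith

theorem sixty_le (h : Regular k lam s) : 62.5 ≤ s ^ 2 := by
  have h1 := h.ten_le
  have : (2 : ℝ) ≤ k := by exact_mod_cast h.two_le
  nlinarith

theorem charMoment_two_le (h : Regular k lam s) :
    charMoment k lam 2 / (2 * Real.pi) ≤ 0.425 / s ^ 3 := by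
  have h1 := h.charMoment_le (a := 1) (c := 0.4235) (by norm_num [Nat.doubleFactorial])
  have hs := h.s_pos
  refine h1.trans ?_
  have h2 : 4 * Real.exp (-(0.73 * (lam * ((k : ℝ) + 1 / 2)))) ≤ 0.0015 / s ^ 3 := by
    rw [le_div_iff₀ (by positivity)]
    have h3 := h.tail_le
    have h4 := h.sixty_le
    have h5 : 0 < Real.exp (-(0.73 * (lam * ((k : ℝ) + 1 / 2)))) * s ^ 3 := by positivity
    nlinarith
  norm_num at h2 ⊢
  have : (17 / 40 : ℝ) / s ^ 3 = 847 / 2000 / s ^ 3 + 3 / 2000 / s ^ 3 := by ring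
  linarith

theorem charMoment_three_le (h : Regular k lam s) :
    charMoment k lam 3 / (2 * Real.pi) ≤ 0.85 / s ^ 4 := by
  have hs := h.s_pos
  have hpi := Real.pi_pos
  have h2 := h.charMoment_two_le
  have h4 := h.charMoment_four_le
  have e : charMoment k lam 3 ≤ s⁻¹ * charMoment k lam 2 + s / 4 * charMoment k lam 4 := by
    unfold charMoment
    rw [← intervalIntegral.integral_const_mul, ← intervalIntegral.integral_const_mul,
      ← intervalIntegral.integral_add
        (((continuous_charMoment k lam 2).const_mul _).intervalIntegrable _ _)
        (((continuous_charMoment k lam 4).const_mul _).intervalIntegrable _ _)]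
    refine intervalIntegral.integral_mono_on (by linarith)
      ((continuous_charMoment k lam 3).intervalIntegrable _ _)
      ((((continuous_charMoment k lam 2).const_mul _).add
        ((continuous_charMoment k lam 4).const_mul _)).intervalIntegrable _ _) fun θ _ => ?_
    set x := ‖1 - Complex.exp (θ * Complex.I)‖
    have hx : x ≤ s⁻¹ + s / 4 * x ^ 2 := by
      have : 0 ≤ s⁻¹ * (1 - s * x / 2) ^ 2 := by positivity
      have e : s⁻¹ * (1 - s * x / 2) ^ 2 = s⁻¹ + s / 4 * x ^ 2 - x := by field_simp; ring
      linarith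
    have hE := (Real.exp_pos (-charExp k lam θ)).le
    have : x ^ 3 ≤ s⁻¹ * x ^ 2 + s / 4 * x ^ 4 := by
      nlinarith [mul_le_mul_of_nonneg_left hx (sq_nonneg x)]
    nlinarith [mul_le_mul_of_nonneg_right this hE]
  calc charMoment k lam 3 / (2 * Real.pi)
      ≤ (s⁻¹ * charMoment k lam 2 + s / 4 * charMoment k lam 4) / (2 * Real.pi) :=
        div_le_div_of_nonneg_right e (by positivity)
    _ = s⁻¹ * (charMoment k lam 2 / (2 * Real.pi)) +
        s / 4 * (charMoment k lam 4 / (2 * Real.pi)) := by ring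
    _ ≤ s⁻¹ * (0.425 / s ^ 3) + s / 4 * (1.6 / s ^ 5) := by gcongr
    _ ≤ 0.85 / s ^ 4 := by
        have : s⁻¹ * (0.425 / s ^ 3) + s / 4 * (1.6 / s ^ 5) = 0.825 / s ^ 4 := by
          field_simp; norm_num
        rw [this]
        gcongr
        norm_num

theorem mass_bound (h : Regular k lam s) {M : ℝ} (hM : ∀ n, mass k lam n ≤ M) :
    0.2875 / s * Real.exp (k * lam) ≤ M := by
  have hs := h.s_pos
  have h1 := exp_le_mul_sqrt_of_mass_le h.lam_pos.le hM
  rw [← h.sq_eq] at h1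
  have hM0 : 0 ≤ M := (mass_nonneg h.lam_pos.le 0).trans (hM 0)
  have h2 : Real.sqrt (12 * s ^ 2 + 1) ≤ s / 0.2875 := by
    refine Real.sqrt_le_iff.2 ⟨by positivity, ?_⟩
    have := h.sixty_le
    rw [div_pow]
    norm_num
    linarith
  have h3 : Real.exp (k * lam) ≤ M * (s / 0.2875) :=
    h1.trans (mul_le_mul_of_nonneg_left h2 hM0)
  rw [div_mul_eq_mul_div, div_le_iff₀ hs]
  have : M * (s / 0.2875) * 0.2875 = M * s := by norm_num; ring
  linarith

end Regular

variable {k : ℕ} {lam : ℝ}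

/-- `a` is a global maximiser of the mass function. -/
def IsMode (k : ℕ) (lam : ℝ) (a : ℤ) : Prop := ∀ j, mass k lam j ≤ mass k lam a

theorem IsMode.one_le {a : ℤ} (h : IsMode k lam a) : 1 ≤ mass k lam a :=
  mass_zero k lam ▸ h 0

theorem IsMode.nonneg {a : ℤ} (h : IsMode k lam a) : 0 ≤ a := by
  by_contra hc
  have := h.one_le
  rw [mass_of_neg k lam (not_le.1 hc)] at this
  linarith

theorem IsMode.le_mean {a : ℤ} (hl : 0 ≤ lam) (h : IsMode k lam a) :
    (a : ℝ) ≤ lam * kap k := by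
  have h1 := mass_recurrence k lam a
  have h2 : ∑ i ∈ Finset.range k, ((i : ℝ) + 1) * mass k lam (a - ((i : ℤ) + 1)) ≤
      kap k * mass k lam a := by
    rw [← sum_range_succ_cast, Finset.sum_mul]
    exact Finset.sum_le_sum fun i _ => mul_le_mul_of_nonneg_left (h _) (by positivity)
  have h3 := mul_le_mul_of_nonneg_left h2 hl
  have h4 := h.one_le
  refine le_of_mul_le_mul_right ?_ (by linarith : 0 < mass k lam a)
  linarith

theorem IsMode.lam_le {a : ℤ} (hk : 0 < k) (hl : 0 ≤ lam) (h : IsMode k lam a) :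
    lam ≤ a + 1 := by
  have h1 := mass_recurrence k lam (a + 1)
  have h2 : mass k lam a ≤
      ∑ i ∈ Finset.range k, ((i : ℝ) + 1) * mass k lam (a + 1 - ((i : ℤ) + 1)) := by
    have := Finset.single_le_sum (f := fun i : ℕ => ((i : ℝ) + 1) * mass k lam (a + 1 - ((i : ℤ) + 1)))
      (fun i _ => mul_nonneg (by positivity) (mass_nonneg hl _)) (Finset.mem_range.2 hk)
    simpa using this
  have h3 := mul_le_mul_of_nonneg_left h2 hl
  have h4 := h.one_le
  have h5 := h.nonneg
  have h6 : (0 : ℝ) ≤ a := by exact_mod_cast h5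
  refine le_of_mul_le_mul_right ?_ (by linarith : 0 < mass k lam a)
  have h7 := mul_le_mul_of_nonneg_left (h (a + 1)) (by linarith : (0 : ℝ) ≤ a + 1)
  push_cast at h1
  linarith

theorem exists_isMode (k : ℕ) (lam : ℝ) : ∃ a, IsMode k lam a := by
  have h1 := (hasSum_mass k lam).summable.tendsto_cofinite_zero
  have h2 : {n : ℤ | ¬ mass k lam n < 1}.Finite :=
    Filter.eventually_cofinite.1 (h1.eventually_lt_const one_pos)
  obtain ⟨a, ha, h⟩ := Set.exists_max_image _ (mass k lam) h2
    ⟨0, by simp [mass_zero]⟩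
  refine ⟨a, fun j => ?_⟩
  by_cases hj : mass k lam j < 1
  · exact hj.le.trans (not_lt.1 ha)
  · exact h j hj

theorem continuous_mass (k : ℕ) (n : ℤ) : Continuous fun lam => mass k lam n :=
  continuous_iff_continuousAt.2 fun lam => (hasDerivAt_mass k lam n).continuousAt

theorem isClosed_isMode (k : ℕ) (a : ℤ) : IsClosed {lam | IsMode k lam a} := by
  simp only [IsMode, Set.ofPred_forall]
  exact isClosed_iInter fun j => isClosed_le (continuous_mass k j) (continuous_mass k a)

/-- Some parameter has modes on both sides of a given gap. -/
theorem exists_two_modes (hk : 0 < k) {m : ℤ} (hm : 0 ≤ m) :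
    ∃ lam, 0 < lam ∧ ∃ a b, a ≤ m ∧ m + 1 ≤ b ∧ IsMode k lam a ∧ IsMode k lam b := by
  have hκ := kap_pos hk
  have hm' : (0 : ℝ) ≤ m := by exact_mod_cast hm
  have hκ1 : 1 ≤ kap k := by
    have : (1 : ℝ) ≤ k := by exact_mod_cast hk
    unfold kap; nlinarith
  set l0 : ℝ := (m + 1 / 2) / kap k with hl0
  set l1 : ℝ := m + 2 with hl1
  have h0 : 0 < l0 := by positivity
  have h01 : l0 ≤ l1 := by
    rw [hl0, div_le_iff₀ hκ]; nlinarith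
  set A : Set ℝ := ⋃ a ∈ Set.Iic m ∩ Set.Ici 0, {lam | IsMode k lam a} with hA
  set B : Set ℝ := ⋃ b ∈ Set.Icc (m + 1) ⌊l1 * kap k⌋, {lam | IsMode k lam b} with hB
  have cA : IsClosed A := (Set.Finite.isClosed_biUnion
    ((Set.finite_Icc 0 m).subset fun x hx => ⟨hx.2, hx.1⟩) fun a _ => isClosed_isMode k a)
  have cB : IsClosed B := (Set.Finite.isClosed_biUnion (Set.finite_Icc _ _)
    fun a _ => isClosed_isMode k a)
  have cov : Set.Icc l0 l1 ⊆ A ∪ B := by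
    intro l hl
    obtain ⟨a, ha⟩ := exists_isMode k l
    by_cases h : a ≤ m
    · left; simp only [hA, Set.mem_iUnion]; exact ⟨a, ⟨h, ha.nonneg⟩, ha⟩
    · right; simp only [hB, Set.mem_iUnion]
      refine ⟨a, ⟨by omega, Int.le_floor.2 ?_⟩, ha⟩
      exact (ha.le_mean (h0.le.trans hl.1)).trans (mul_le_mul_of_nonneg_right hl.2 hκ.le)
  have nA : (Set.Icc l0 l1 ∩ A).Nonempty := by
    refine ⟨l0, ⟨le_rfl, h01⟩, ?_⟩
    obtain ⟨a, ha⟩ := exists_isMode k l0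
    simp only [hA, Set.mem_iUnion]
    refine ⟨a, ⟨?_, ha.nonneg⟩, ha⟩
    have := ha.le_mean h0.le
    rw [hl0, div_mul_cancel₀ _ hκ.ne'] at this
    have h3 : (a : ℝ) < ((m + 1 : ℤ) : ℝ) := by push_cast; linarith
    have h4 : a < m + 1 := by exact_mod_cast h3
    exact Int.lt_add_one_iff.1 h4
  have nB : (Set.Icc l0 l1 ∩ B).Nonempty := by
    refine ⟨l1, ⟨h01, le_rfl⟩, ?_⟩
    obtain ⟨a, ha⟩ := exists_isMode k l1
    simp only [hB, Set.mem_iUnion]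
    refine ⟨a, ⟨?_, Int.le_floor.2 (ha.le_mean (h0.le.trans h01))⟩, ha⟩
    have := ha.lam_le hk (h0.le.trans h01)
    have h3 : ((m + 1 : ℤ) : ℝ) ≤ (a : ℝ) := by push_cast; linarith
    exact_mod_cast h3
  obtain ⟨l, hl, h1, h2⟩ := isPreconnected_closed_iff.1 isPreconnected_Icc A B cA cB cov nA nB
  simp only [hA, hB, Set.mem_iUnion] at h1 h2
  obtain ⟨a, ha, ha'⟩ := h1
  obtain ⟨b, hb, hb'⟩ := h2
  exact ⟨l, h0.trans_le hl.1, a, b, ha.1, hb.1, ha', hb'⟩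

theorem sum_range_succ_cast_cube (k : ℕ) :
    ∑ i ∈ Finset.range k, ((i : ℝ) + 1) ^ 3 = kap k ^ 2 := by
  induction k with
  | zero => simp [kap]
  | succ k ih => rw [Finset.sum_range_succ, ih]; unfold kap; push_cast; ring

theorem mass_succ_recurrence (k : ℕ) (lam : ℝ) (a : ℤ) :
    ((a : ℝ) + 1) * bdiff (mass k lam) (a + 1) + mass k lam a =
      lam * ∑ i ∈ Finset.range k, ((i : ℝ) + 1) * bdiff (mass k lam) (a - i) := by
  have h1 := mass_recurrence k lam (a + 1)
  have h2 := mass_recurrence k lam a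
  unfold bdiff
  simp only [mul_sub, Finset.sum_sub_distrib]
  have e1 : ∀ i : ℕ, a + 1 - ((i : ℤ) + 1) = a - i := fun i => by ring
  have e2 : ∀ i : ℕ, a - (i : ℤ) - 1 = a - ((i : ℤ) + 1) := fun i => by ring
  simp only [e1, e2] at h1 ⊢
  rw [← h1, ← h2]
  push_cast
  rw [show a + 1 - 1 = a by ring]; ring

theorem bdiff_sub (f : ℤ → ℝ) (n : ℤ) (j : ℕ) :
    f n - f (n - j) = ∑ i ∈ Finset.range j, bdiff f (n - i) := by
  induction j with
  | zero => simp
  | succ j ih =>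
    rw [Finset.sum_range_succ, ← ih, bdiff]
    push_cast
    rw [show n - ((j : ℤ) + 1) = n - j - 1 by ring]; ring

theorem abs_sub_le_of_bdiff {f : ℤ → ℝ} {B : ℝ} (h : ∀ n, |bdiff f n| ≤ B) (n : ℤ) (j : ℕ) :
    |f n - f (n - j)| ≤ j * B := by
  rw [bdiff_sub]
  refine (Finset.abs_sum_le_sum_abs _ _).trans ?_
  refine (Finset.sum_le_sum (g := fun _ => B) fun i _ => h _).trans ?_
  simp

namespace Regular

variable {k : ℕ} {lam s : ℝ}

theorem abs_bdiff_two_le (h : Regular k lam s) (n : ℤ) :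
    |bdiff^[2] (mass k lam) n| ≤ 0.425 * (Real.exp (k * lam) / s ^ 3) := by
  refine (abs_bdiff_le k lam 2 n).trans ?_
  refine (mul_le_mul_of_nonneg_left h.charMoment_two_le (Real.exp_pos _).le).trans (le_of_eq ?_)
  ring

theorem abs_bdiff_three_le (h : Regular k lam s) (n : ℤ) :
    |bdiff^[3] (mass k lam) n| ≤ 0.85 * (Real.exp (k * lam) / s ^ 4) := by
  refine (abs_bdiff_le k lam 3 n).trans ?_
  refine (mul_le_mul_of_nonneg_left h.charMoment_three_le (Real.exp_pos _).le).trans (le_of_eq ?_)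
  ring

theorem abs_bdiff_four_le (h : Regular k lam s) (n : ℤ) :
    |bdiff^[4] (mass k lam) n| ≤ 1.6 * (Real.exp (k * lam) / s ^ 5) := by
  refine (abs_bdiff_le k lam 4 n).trans ?_
  refine (mul_le_mul_of_nonneg_left h.charMoment_four_le (Real.exp_pos _).le).trans (le_of_eq ?_)
  ring

theorem kap_sq_le (h : Regular k lam s) : kap k ^ 2 ≤ 0.75 * ((k : ℝ) + 1 / 2) * sqs k := by
  have : (2 : ℝ) ≤ k := by exact_mod_cast h.two_le
  unfold kap sqs
  nlinarith [mul_nonneg (by linarith : (0:ℝ) ≤ k) (by linarith : (0:ℝ) ≤ k - 2),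
    mul_nonneg (mul_nonneg (by linarith : (0:ℝ) ≤ k) (by linarith : (0:ℝ) ≤ k)) (by linarith : (0:ℝ) ≤ k - 2)]

theorem mean_sub_mode_le (h : Regular k lam s) {a : ℤ} (ha : IsMode k lam a) :
    (lam * kap k - a) * sqs k ≤ 0.7392 * (kap k ^ 2 + sqs k) := by
  set p := mass k lam with hp
  set W := Real.exp (k * lam) with hW
  have hs := h.s_pos
  have hWs : 0 < W / s ^ 3 := by positivity
  set B := 0.425 * (W / s ^ 3) with hB
  have hD : ∀ i : ℕ, bdiff p (a - i) ≤ (i + 1) * B := by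
    intro i
    have h1 := abs_sub_le_of_bdiff (f := bdiff p) (B := B)
      (fun n => h.abs_bdiff_two_le n) (a + 1) (i + 1)
    have h2 : bdiff p (a + 1) ≤ 0 := by
      unfold bdiff; have := ha (a + 1); rw [show a + 1 - 1 = a by ring]; linarith
    have h3 := (abs_le.1 h1).1
    push_cast at h3
    rw [show a + 1 - ((i : ℤ) + 1) = a - i by ring] at h3
    linarith
  have hsum : ∀ j : ℕ, p a - p (a - j) ≤ (j * (j + 1) / 2 : ℝ) * B := by
    intro j
    rw [bdiff_sub]
    refine (Finset.sum_le_sum fun i _ => hD i).trans ?_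
    rw [← Finset.sum_mul, sum_range_succ_cast, kap]
  have hrec := mass_recurrence k lam a
  have key : (lam * kap k - a) * p a =
      lam * ∑ i ∈ Finset.range k, ((i : ℝ) + 1) * (p a - p (a - ((i : ℤ) + 1))) := by
    simp only [mul_sub, Finset.sum_sub_distrib]
    rw [← Finset.sum_mul, sum_range_succ_cast, sub_mul, hrec]; ring
  have hle : ∑ i ∈ Finset.range k, ((i : ℝ) + 1) * (p a - p (a - ((i : ℤ) + 1))) ≤
      (kap k ^ 2 + sqs k) / 2 * B := by
    have e : (kap k ^ 2 + sqs k) / 2 * B = ∑ i ∈ Finset.range k,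
        ((i : ℝ) + 1) * (((i : ℝ) + 1) * (i + 1 + 1) / 2 * B) := by
      rw [← sum_range_succ_cast_cube, ← sum_range_succ_cast_sq, ← Finset.sum_add_distrib,
        Finset.sum_div, Finset.sum_mul]
      exact Finset.sum_congr rfl fun i _ => by ring
    rw [e]
    refine Finset.sum_le_sum fun i _ => mul_le_mul_of_nonneg_left ?_ (by positivity)
    have := hsum (i + 1)
    push_cast at this
    exact this
  have hM := h.mass_bound (M := p a) ha
  have hq := sqs_pos (k := k) (by have := h.two_le; omega)
  have hm : 0 ≤ lam * kap k - a := by have := ha.le_mean h.lam_pos.le; linarith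
  have h1 := mul_le_mul_of_nonneg_left hle h.lam_pos.le
  rw [← key] at h1
  have h2 := mul_le_mul_of_nonneg_left hM hm
  have h3 := mul_le_mul_of_nonneg_right (h2.trans h1) hq.le
  have e1 : lam * ((kap k ^ 2 + sqs k) / 2 * B) * sqs k =
      s ^ 2 * ((kap k ^ 2 + sqs k) / 2 * B) := by rw [h.sq_eq]; ring
  rw [e1] at h3
  have e2 : s ^ 2 * ((kap k ^ 2 + sqs k) / 2 * B) = 0.2125 * (kap k ^ 2 + sqs k) * (W / s) := by
    rw [hB]; field_simp; ring
  have e3 : (lam * kap k - a) * (0.2875 / s * W) * sqs k =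
      0.2875 * ((lam * kap k - a) * sqs k) * (W / s) := by ring
  rw [e2, e3] at h3
  have h4 := le_of_mul_le_mul_right h3 (by positivity)
  have : 0 ≤ kap k ^ 2 + sqs k := by positivity
  linarith

theorem modes_adjacent (h : Regular k lam s) {a b : ℤ} (ha : IsMode k lam a)
    (hb : IsMode k lam b) : b ≤ a + 1 := by
  by_contra hab
  push Not at hab
  set p := mass k lam with hp
  set W := Real.exp (k * lam) with hW
  have hs := h.s_pos
  have hq := sqs_pos (k := k) (by have := h.two_le; omega)
  have hk2 : (2 : ℝ) ≤ k := by exact_mod_cast h.two_le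
  set B := 0.85 * (W / s ^ 4) with hB
  have hB0 : 0 < B := by positivity
  have hDa : bdiff p (a + 1) ≤ 0 := by
    unfold bdiff; have := ha (a + 1); rw [show a + 1 - 1 = a by ring]; linarith
  have hDb : 0 ≤ bdiff p b := by
    unfold bdiff; have := hb (b - 1); linarith
  -- a point of nonnegative second difference strictly between the modes
  obtain ⟨n0, hn1, hn2, hn3⟩ : ∃ n0, a < n0 ∧ n0 < b ∧ 0 ≤ bdiff (bdiff p) (n0 + 1) := by
    by_contra hcon
    push Not at hcon
    obtain ⟨N, hN⟩ : ∃ N : ℕ, b - (a + 1) = N := Int.eq_ofNat_of_zero_le (by omega)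
    have h1 := bdiff_sub (bdiff p) b N
    rw [← hN, show b - (b - (a + 1)) = a + 1 by ring] at h1
    have h2 : ∑ i ∈ Finset.range N, bdiff (bdiff p) (b - i) < ∑ i ∈ Finset.range N, 0 := by
      refine Finset.sum_lt_sum_of_nonempty (Finset.nonempty_range_iff.2 (by omega)) fun i hi => ?_
      have hi' := Finset.mem_range.1 hi
      have := hcon (b - i - 1) (by omega) (by omega)
      rwa [show b - (i : ℤ) - 1 + 1 = b - i by ring] at this
    simp only [Finset.sum_const_zero] at h2
    linarith
  have hK : ∀ i : ℕ, -(bdiff (bdiff p) (a + 1 - i)) ≤ ((n0 : ℝ) - a + i) * B := by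
    intro i
    obtain ⟨N, hN⟩ : ∃ N : ℕ, n0 - a + i = N := Int.eq_ofNat_of_zero_le (by omega)
    have h1 := abs_sub_le_of_bdiff (f := bdiff (bdiff p)) (B := B)
      (fun n => h.abs_bdiff_three_le n) (n0 + 1) N
    have h3 := (abs_le.1 h1).2
    rw [← hN, show n0 + 1 - (n0 - a + i) = a + 1 - i by ring] at h3
    have e : (N : ℝ) = n0 - a + i := by exact_mod_cast hN.symm
    rw [e] at h3
    linarith
  have hG : ∀ j : ℕ, bdiff p (a + 1 - j) - bdiff p (a + 1) ≤
      (j * ((n0 : ℝ) - a) + j * (j - 1) / 2) * B := by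
    intro j
    have h1 := bdiff_sub (bdiff p) (a + 1) j
    have h2 : ∑ i ∈ Finset.range j, -(bdiff (bdiff p) (a + 1 - i)) ≤
        ∑ i ∈ Finset.range j, ((n0 : ℝ) - a + i) * B := Finset.sum_le_sum fun i _ => hK i
    rw [Finset.sum_neg_distrib, ← h1, ← Finset.sum_mul, Finset.sum_add_distrib] at h2
    have h3 : ∑ i ∈ Finset.range j, (i : ℝ) = j * (j - 1) / 2 := by
      clear h1 h2
      induction j with
      | zero => simp
      | succ j ih => rw [Finset.sum_range_succ, ih]; push_cast; ring
    simp only [Finset.sum_const, Finset.card_range, nsmul_eq_mul] at h2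
    rw [h3] at h2
    linarith
  have hrec := mass_succ_recurrence k lam a
  have key : p a ≤ lam * ∑ i ∈ Finset.range k,
      ((i : ℝ) + 1) * (bdiff p (a + 1 - ((i + 1 : ℕ) : ℤ)) - bdiff p (a + 1)) := by
    have e1 : ∀ i : ℕ, a + 1 - ((i + 1 : ℕ) : ℤ) = a - i := fun i => by push_cast; ring
    simp only [e1, mul_sub, Finset.sum_sub_distrib]
    rw [← Finset.sum_mul, sum_range_succ_cast, ← hrec]
    have hbm := hb.le_mean h.lam_pos.le
    have : ((a + 2 : ℤ) : ℝ) ≤ b := by exact_mod_cast (by omega : a + 2 ≤ b)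
    push_cast at this
    nlinarith
  have hle : ∑ i ∈ Finset.range k,
      ((i : ℝ) + 1) * (bdiff p (a + 1 - ((i + 1 : ℕ) : ℤ)) - bdiff p (a + 1)) ≤
      (((n0 : ℝ) - a) * sqs k + (kap k ^ 2 - sqs k) / 2) * B := by
    have e : (((n0 : ℝ) - a) * sqs k + (kap k ^ 2 - sqs k) / 2) * B = ∑ i ∈ Finset.range k,
        ((i : ℝ) + 1) * ((((i : ℝ) + 1) * ((n0 : ℝ) - a) + ((i : ℝ) + 1) * i / 2) * B) := by
      rw [← sum_range_succ_cast_cube, ← sum_range_succ_cast_sq, ← Finset.sum_sub_distrib,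
        Finset.sum_div, Finset.mul_sum, ← Finset.sum_add_distrib, Finset.sum_mul]
      exact Finset.sum_congr rfl fun i _ => by ring
    rw [e]
    refine Finset.sum_le_sum fun i _ => mul_le_mul_of_nonneg_left ?_ (by positivity)
    have := hG (i + 1)
    push_cast at this ⊢
    simpa using this
  have hM := h.mass_bound (M := p a) ha
  have h1 := hM.trans (key.trans (mul_le_mul_of_nonneg_left hle h.lam_pos.le))
  have hmean := h.mean_sub_mode_le ha
  have hn : (n0 : ℝ) - a ≤ lam * kap k - a - 1 := by
    have h3 := hb.le_mean h.lam_pos.le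
    have : ((n0 + 1 : ℤ) : ℝ) ≤ b := by exact_mod_cast (by omega : n0 + 1 ≤ b)
    push_cast at this
    linarith
  have h2 : ((n0 : ℝ) - a) * sqs k + (kap k ^ 2 - sqs k) / 2 ≤
      0.93 * ((k : ℝ) + 1 / 2) * sqs k := by
    have h3 := h.kap_sq_le
    have h4 := mul_le_mul_of_nonneg_right hn hq.le
    nlinarith
  have h3 : 0.2875 / s * W ≤ lam * (0.93 * ((k : ℝ) + 1 / 2) * sqs k * B) :=
    h1.trans (mul_le_mul_of_nonneg_left (mul_le_mul_of_nonneg_right h2 hB0.le) h.lam_pos.le)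
  have e1 : lam * (0.93 * ((k : ℝ) + 1 / 2) * sqs k * B) =
      (0.7905 * ((k : ℝ) + 1 / 2)) * (W / s ^ 2) := by
    have : lam * (0.93 * ((k : ℝ) + 1 / 2) * sqs k * B) =
      0.93 * ((k : ℝ) + 1 / 2) * B * s ^ 2 := by rw [h.sq_eq]; ring
    rw [this, hB]; field_simp; ring
  have e2 : 0.2875 / s * W = 0.2875 * s * (W / s ^ 2) := by field_simp
  rw [e1, e2] at h3
  have h4 := le_of_mul_le_mul_right h3 (by positivity)
  have h5 := h.ten_le
  nlinarith

end Regular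

/-- Existence of a double mode at prescribed adjacent integers. -/
theorem exists_double_mode {k : ℕ} (hk : 0 < k) {m : ℤ} (hm : 0 ≤ m)
    (hreg : ∀ lam, (m : ℝ) + 1 ≤ lam * kap k → ∃ s, Regular k lam s) :
    ∃ lam, 0 < lam ∧ IsMode k lam m ∧ IsMode k lam (m + 1) := by
  obtain ⟨lam, hl, a, b, ha, hb, hma, hmb⟩ := exists_two_modes hk hm
  have h1 : ((m + 1 : ℤ) : ℝ) ≤ b := by exact_mod_cast hb
  push_cast at h1
  obtain ⟨s, hs⟩ := hreg lam (h1.trans (hmb.le_mean hl.le))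
  have := hs.modes_adjacent hma hmb
  obtain rfl : a = m := by omega
  obtain rfl : b = a + 1 := by omega
  exact ⟨lam, hl, hma, hmb⟩

/-- The limit of `β - m` minus one. -/
noncomputable def skewT (K : ℝ) : ℝ := (3 * K + 2) * (K - 1) / (4 * (2 * K + 1))

/-- The leading coefficient in the expansion of `κλ - m`. -/
noncomputable def tau (K : ℝ) : ℝ :=
  (-1 / 20 - 3 / 10 * K - 11 / 80 * K ^ 2 + 13 / 40 * K ^ 3 + 13 / 80 * K ^ 4) / (2 * K + 1) ^ 2

/-- The Abel summation weights. -/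
noncomputable def omegaW (K l : ℝ) : ℝ :=
  ((-K / 12 - 7 / 24 * K ^ 2 + K ^ 3 / 12 + 7 / 24 * K ^ 4) +
    (1 / 12 + K / 24 - 9 / 8 * K ^ 2 - K ^ 3) * l +
    (1 / 4 + 7 / 8 * K + 3 / 8 * K ^ 2) * l ^ 2 + (1 / 6 + K / 3) * l ^ 3) / (2 * K + 1)

/-- The quadratic factor of the Green function, up to scaling. -/
noncomputable def gammaQ (K l : ℝ) : ℝ :=
  ((1 / 48 + 23 / 160 * K + 5 / 16 * K ^ 2 + 31 / 240 * K ^ 3 - 13 / 160 * K ^ 4) +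
    (7 / 240 + 79 / 480 * K + 133 / 480 * K ^ 2 + 31 / 240 * K ^ 3) * l +
    (1 / 120 + K / 30 + K ^ 2 / 30) * l ^ 2)

/-- The discrete Green function used in the second summation by parts. -/
noncomputable def gammaW (K l : ℝ) : ℝ := l * (K - l) * (K + 1 - l) * gammaQ K l / (2 * K + 1) ^ 2

theorem omegaW_sub (K l : ℝ) (hD : 2 * K + 1 ≠ 0) :
    omegaW K l - omegaW K (l + 1) =
      K * (K + 1) / 2 - (l + 1) * (l + 1 + 1) / 2 - skewT K * (l + 1) := by
  have hT : skewT K * (2 * K + 1) = (3 * K + 2) * (K - 1) / 4 := by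
    rw [skewT, div_mul_eq_mul_div, div_eq_iff (mul_ne_zero four_ne_zero hD)]; ring
  unfold omegaW
  rw [← sub_div, div_eq_iff hD]
  linear_combination (l + 1) * hT

theorem omegaW_self (K : ℝ) : omegaW K K = 0 := by
  unfold omegaW
  rw [div_eq_zero_iff]; left; ring

theorem gammaW_second_diff (K l : ℝ) (hD : 2 * K + 1 ≠ 0) :
    gammaW K (l + 2) - 2 * gammaW K (l + 1) + gammaW K l =
      omegaW K (l + 1) + tau K * (l + 1) := by
  unfold omegaW gammaW gammaQ tau
  field_simp
  ring

theorem omegaW_zero_sub (K : ℝ) :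
    omegaW K 0 - gammaW K 1 = tau K * (K * (K + 1) / 2) := by
  unfold omegaW gammaW gammaQ tau
  field_simp
  ring

theorem sum_mul_abel (ω w g u : ℕ → ℝ) (hω : ∀ l, ω l - ω (l + 1) = w (l + 1))
    (hg : g 0 = 0) (hu : ∀ l, u l = g (l + 1) - g l) (N : ℕ) :
    ∑ i ∈ Finset.range N, w (i + 1) * g (i + 1) =
      ∑ l ∈ Finset.range N, ω l * u l - ω N * g N := by
  induction N with
  | zero => simp [hg]
  | succ N ih =>
    rw [Finset.sum_range_succ, Finset.sum_range_succ, ih, ← hω, hu N]; ring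

theorem sum_green (γ u : ℕ → ℝ) (N : ℕ) :
    ∑ l ∈ Finset.range N, (γ (l + 1) * (u (l + 2) - 2 * u (l + 1) + u l) -
      u (l + 1) * (γ (l + 2) - 2 * γ (l + 1) + γ l)) =
      γ N * u (N + 1) - u N * γ (N + 1) - (γ 0 * u 1 - u 0 * γ 1) := by
  induction N with
  | zero => simp
  | succ N ih => rw [Finset.sum_range_succ, ih]; ring

theorem sum_mul_sum_range (g : ℕ → ℝ) (N : ℕ) :
    ∑ i ∈ Finset.range N, ((i : ℝ) + 1) * ∑ t ∈ Finset.range i, g t =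
      ∑ t ∈ Finset.range N, ((N : ℝ) * (N + 1) / 2 - ((t : ℝ) + 1) * (t + 1 + 1) / 2) * g t := by
  induction N with
  | zero => simp
  | succ N ih =>
    rw [Finset.sum_range_succ, Finset.sum_range_succ, ih]
    have : ∑ t ∈ Finset.range N,
        (((N + 1 : ℕ) : ℝ) * ((N + 1 : ℕ) + 1) / 2 - ((t : ℝ) + 1) * (t + 1 + 1) / 2) * g t =
        ∑ t ∈ Finset.range N, (((N : ℝ) * (N + 1) / 2 - ((t : ℝ) + 1) * (t + 1 + 1) / 2) * g t +
          ((N : ℝ) + 1) * g t) :=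
      Finset.sum_congr rfl fun t _ => by push_cast; ring
    rw [this, Finset.sum_add_distrib, ← Finset.mul_sum]
    push_cast; ring

theorem sum_pow_one (N : ℕ) : ∑ i ∈ Finset.range N, ((i : ℝ) + 1) ^ 1 = (N : ℝ) * (N + 1) / 2 := by
  induction N with
  | zero => simp
  | succ N ih => rw [Finset.sum_range_succ, ih]; push_cast; ring

theorem sum_pow_two (N : ℕ) :
    ∑ i ∈ Finset.range N, ((i : ℝ) + 1) ^ 2 = (N : ℝ) * (N + 1) * (2 * N + 1) / 6 := by
  induction N with
  | zero => simp
  | succ N ih => rw [Finset.sum_range_succ, ih]; push_cast; ring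

theorem sum_pow_three (N : ℕ) :
    ∑ i ∈ Finset.range N, ((i : ℝ) + 1) ^ 3 = ((N : ℝ) * (N + 1) / 2) ^ 2 := by
  induction N with
  | zero => simp
  | succ N ih => rw [Finset.sum_range_succ, ih]; push_cast; ring

theorem sum_pow_four (N : ℕ) :
    ∑ i ∈ Finset.range N, ((i : ℝ) + 1) ^ 4 =
      (N : ℝ) * (N + 1) * (2 * N + 1) * (3 * N ^ 2 + 3 * N - 1) / 30 := by
  induction N with
  | zero => simp
  | succ N ih => rw [Finset.sum_range_succ, ih]; push_cast; ring

theorem sum_pow_five (N : ℕ) :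
    ∑ i ∈ Finset.range N, ((i : ℝ) + 1) ^ 5 =
      (N : ℝ) ^ 2 * (N + 1) ^ 2 * (2 * N ^ 2 + 2 * N - 1) / 12 := by
  induction N with
  | zero => simp
  | succ N ih => rw [Finset.sum_range_succ, ih]; push_cast; ring

theorem sum_pow_six (N : ℕ) :
    ∑ i ∈ Finset.range N, ((i : ℝ) + 1) ^ 6 =
      (N : ℝ) * (N + 1) * (2 * N + 1) * (3 * N ^ 4 + 6 * N ^ 3 - 3 * N + 1) / 42 := by
  induction N with
  | zero => simp
  | succ N ih => rw [Finset.sum_range_succ, ih]; push_cast; ring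

theorem sum_pow_seven (N : ℕ) :
    ∑ i ∈ Finset.range N, ((i : ℝ) + 1) ^ 7 =
      (N : ℝ) ^ 2 * (N + 1) ^ 2 * (3 * N ^ 4 + 6 * N ^ 3 - N ^ 2 - 4 * N + 2) / 24 := by
  induction N with
  | zero => simp
  | succ N ih => rw [Finset.sum_range_succ, ih]; push_cast; ring

theorem sum_cubic_weight (k : ℕ) :
    ∑ i ∈ Finset.range k, ((i : ℝ) + 1) * (k - (i + 1)) * (k + 1 - (i + 1)) =
      (k : ℝ) * (k + 1) * (k + 2) * (k - 1) / 12 := by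
  have e : ∀ i : ℕ, ((i : ℝ) + 1) * (k - (i + 1)) * (k + 1 - (i + 1)) =
      (k : ℝ) * (k + 1) * ((i : ℝ) + 1) ^ 1 - (2 * k + 1) * ((i : ℝ) + 1) ^ 2 + ((i : ℝ) + 1) ^ 3 :=
    fun i => by ring
  simp only [e, Finset.sum_add_distrib, Finset.sum_sub_distrib, ← Finset.mul_sum, sum_pow_one,
    sum_pow_two, sum_pow_three]
  ring

theorem sum_cubic_weight_mul_sq (k : ℕ) (a b c : ℝ) :
    ∑ i ∈ Finset.range k, ((i : ℝ) + 1) * (k - (i + 1)) * (k + 1 - (i + 1)) *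
      (a + b * (i + 1) + c * (i + 1) ^ 2) ^ 2 =
    k * (k + 1) * (a ^ 2) * (k * (k + 1) / 2) +
    (2 * a * b * (k * (k + 1)) - a ^ 2 * (2 * k + 1)) * (k * (k + 1) * (2 * k + 1) / 6) +
    ((2 * a * c + b ^ 2) * (k * (k + 1)) - 2 * a * b * (2 * k + 1) + a ^ 2) *
      ((k : ℝ) * (k + 1) / 2) ^ 2 +
    (2 * b * c * (k * (k + 1)) - (2 * a * c + b ^ 2) * (2 * k + 1) + 2 * a * b) *
      (k * (k + 1) * (2 * k + 1) * (3 * k ^ 2 + 3 * k - 1) / 30) +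
    (c ^ 2 * (k * (k + 1)) - 2 * b * c * (2 * k + 1) + (2 * a * c + b ^ 2)) *
      ((k : ℝ) ^ 2 * (k + 1) ^ 2 * (2 * k ^ 2 + 2 * k - 1) / 12) +
    (2 * b * c - c ^ 2 * (2 * k + 1)) *
      ((k : ℝ) * (k + 1) * (2 * k + 1) * (3 * k ^ 4 + 6 * k ^ 3 - 3 * k + 1) / 42) +
    c ^ 2 * ((k : ℝ) ^ 2 * (k + 1) ^ 2 * (3 * k ^ 4 + 6 * k ^ 3 - k ^ 2 - 4 * k + 2) / 24) := by
  have e : ∀ i : ℕ, ((i : ℝ) + 1) * (k - (i + 1)) * (k + 1 - (i + 1)) *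
      (a + b * (i + 1) + c * (i + 1) ^ 2) ^ 2 =
    (k * (k + 1) * a ^ 2) * ((i : ℝ) + 1) ^ 1 +
    (2 * a * b * (k * (k + 1)) - a ^ 2 * (2 * k + 1)) * ((i : ℝ) + 1) ^ 2 +
    ((2 * a * c + b ^ 2) * (k * (k + 1)) - 2 * a * b * (2 * k + 1) + a ^ 2) * ((i : ℝ) + 1) ^ 3 +
    (2 * b * c * (k * (k + 1)) - (2 * a * c + b ^ 2) * (2 * k + 1) + 2 * a * b) *
      ((i : ℝ) + 1) ^ 4 +
    (c ^ 2 * (k * (k + 1)) - 2 * b * c * (2 * k + 1) + (2 * a * c + b ^ 2)) * ((i : ℝ) + 1) ^ 5 +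
    (2 * b * c - c ^ 2 * (2 * k + 1)) * ((i : ℝ) + 1) ^ 6 + c ^ 2 * ((i : ℝ) + 1) ^ 7 :=
    fun i => by ring
  simp only [e, Finset.sum_add_distrib, ← Finset.mul_sum, sum_pow_one, sum_pow_two,
    sum_pow_three, sum_pow_four, sum_pow_five, sum_pow_six, sum_pow_seven]

/-- Cauchy-Schwarz in the form of a bound on a weighted sum of absolute values. -/
theorem sum_mul_abs_le {k : ℕ} (v x : ℕ → ℝ) (hv : ∀ i ∈ Finset.range k, 0 ≤ v i) {C : ℝ} (hC : 0 ≤ C)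
    (h : (∑ i ∈ Finset.range k, v i) * ∑ i ∈ Finset.range k, v i * x i ^ 2 ≤ C ^ 2) :
    ∑ i ∈ Finset.range k, v i * |x i| ≤ C := by
  refine abs_le_of_sq_le_sq' (le_trans ?_ h) hC |>.2
  refine Finset.sum_sq_le_sum_mul_sum_of_sq_le_mul _ hv
    (fun i hi => mul_nonneg (hv i hi) (sq_nonneg _)) fun i _ => ?_
  rw [mul_pow, sq_abs]; exact le_of_eq (by ring)

theorem sum_abs_gammaW_le {k : ℕ} (hk : 2 ≤ k) :
    ∑ i ∈ Finset.range k, |gammaW k (i + 1)| ≤ tau k * (skewT k + 2) * sqs k / 6 := by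
  have hk' : (2 : ℝ) ≤ k := by exact_mod_cast hk
  obtain ⟨x, hx, hx0⟩ : ∃ x : ℝ, (k : ℝ) = x + 2 ∧ 0 ≤ x := ⟨k - 2, by ring, by linarith⟩
  have hw : ∀ i ∈ Finset.range k, 0 ≤ ((i : ℝ) + 1) * (k - (i + 1)) * (k + 1 - (i + 1)) := by
    intro i hi
    have : ((i + 1 : ℕ) : ℝ) ≤ k := by exact_mod_cast Finset.mem_range.1 hi
    push_cast at this
    exact mul_nonneg (mul_nonneg (by positivity) (by linarith)) (by linarith)
  have e : ∑ i ∈ Finset.range k, |gammaW k (i + 1)| = ∑ i ∈ Finset.range k,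
      (((i : ℝ) + 1) * (k - (i + 1)) * (k + 1 - (i + 1))) * |gammaQ k (i + 1)| /
        (2 * (k : ℝ) + 1) ^ 2 := by
    refine Finset.sum_congr rfl fun i hi => ?_
    rw [gammaW, abs_div, abs_mul, abs_of_nonneg (hw i hi), abs_of_nonneg (sq_nonneg (2 * (k : ℝ) + 1))]
  have hD : (0 : ℝ) < 2 * k + 1 := by linarith
  have e3 : tau k * (skewT k + 2) * sqs k / 6 =
      (-1 / 20 - 3 / 10 * k - 11 / 80 * k ^ 2 + 13 / 40 * k ^ 3 + 13 / 80 * k ^ 4) *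
        (3 * k ^ 2 + 15 * k + 6) * (k * (k + 1)) / 144 / (2 * k + 1) ^ 2 := by
    unfold tau skewT sqs; field_simp; ring
  rw [e, ← Finset.sum_div, e3]
  refine div_le_div_of_nonneg_right (sum_mul_abs_le
    (fun i : ℕ => ((i : ℝ) + 1) * (k - (i + 1)) * (k + 1 - (i + 1)))
    (fun i : ℕ => gammaQ k (i + 1)) hw ?_ ?_) (by positivity)
  · rw [hx]; ring_nf; positivity
  · simp only [gammaQ]
    rw [sum_cubic_weight, sum_cubic_weight_mul_sq, hx, ← sub_nonneg]
    ring_nf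
    positivity

theorem sum_choose_weight (k : ℕ) :
    ∑ i ∈ Finset.range k, ((i : ℝ) + 1) * i / 2 = (k : ℝ) * (k + 1) * (k - 1) / 6 := by
  induction k with
  | zero => simp
  | succ N ih => rw [Finset.sum_range_succ, ih]; push_cast; ring

theorem sum_choose_weight_mul_sq (k : ℕ) (a b c : ℝ) :
    ∑ i ∈ Finset.range k, ((i : ℝ) + 1) * i / 2 * (a + b * (i + 1) + c * (i + 1) ^ 2) ^ 2 =
    -(a ^ 2 / 2) * ((k : ℝ) * (k + 1) / 2) +
    (a ^ 2 / 2 - a * b) * ((k : ℝ) * (k + 1) * (2 * k + 1) / 6) +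
    (a * b - (2 * a * c + b ^ 2) / 2) * ((k : ℝ) * (k + 1) / 2) ^ 2 +
    ((2 * a * c + b ^ 2) / 2 - b * c) *
      ((k : ℝ) * (k + 1) * (2 * k + 1) * (3 * k ^ 2 + 3 * k - 1) / 30) +
    (b * c - c ^ 2 / 2) * ((k : ℝ) ^ 2 * (k + 1) ^ 2 * (2 * k ^ 2 + 2 * k - 1) / 12) +
    c ^ 2 / 2 * ((k : ℝ) * (k + 1) * (2 * k + 1) * (3 * k ^ 4 + 6 * k ^ 3 - 3 * k + 1) / 42) := by
  have e : ∀ i : ℕ, ((i : ℝ) + 1) * i / 2 * (a + b * (i + 1) + c * (i + 1) ^ 2) ^ 2 =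
    -(a ^ 2 / 2) * ((i : ℝ) + 1) ^ 1 + (a ^ 2 / 2 - a * b) * ((i : ℝ) + 1) ^ 2 +
    (a * b - (2 * a * c + b ^ 2) / 2) * ((i : ℝ) + 1) ^ 3 +
    ((2 * a * c + b ^ 2) / 2 - b * c) * ((i : ℝ) + 1) ^ 4 +
    (b * c - c ^ 2 / 2) * ((i : ℝ) + 1) ^ 5 + c ^ 2 / 2 * ((i : ℝ) + 1) ^ 6 :=
    fun i => by ring
  simp only [e, Finset.sum_add_distrib, ← Finset.mul_sum, sum_pow_one, sum_pow_two,
    sum_pow_three, sum_pow_four, sum_pow_five, sum_pow_six]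

theorem sum_abs_skew_le {k : ℕ} (hk : 2 ≤ k) :
    ∑ i ∈ Finset.range k, ((i : ℝ) + 1) * i / 2 *
      |skewT k * (i + 1) - (kap k - ((i : ℝ) + 1) * (i + 1 + 1) / 2)| ≤
      0.11 * ((k : ℝ) + 1 / 2) ^ 2 * sqs k := by
  have hk' : (2 : ℝ) ≤ k := by exact_mod_cast hk
  obtain ⟨x, hx, hx0⟩ : ∃ x : ℝ, (k : ℝ) = x + 2 ∧ 0 ≤ x := ⟨k - 2, by ring, by linarith⟩
  have hD : (0 : ℝ) < 2 * k + 1 := by linarith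
  have e : ∀ i : ℕ, ((i : ℝ) + 1) * i / 2 *
      |skewT k * (i + 1) - (kap k - ((i : ℝ) + 1) * (i + 1 + 1) / 2)| =
      ((i : ℝ) + 1) * i / 2 * |-(2 * (k : ℝ) * (k + 1) * (2 * k + 1)) +
        ((3 * k + 2) * (k - 1) + 2 * (2 * k + 1)) * (i + 1) + 2 * (2 * k + 1) * (i + 1) ^ 2| /
        (4 * (2 * (k : ℝ) + 1)) := by
    intro i
    rw [mul_div_assoc (((i : ℝ) + 1) * i / 2)]
    refine congrArg _ ?_
    conv_rhs => rw [← abs_of_pos (by positivity : (0 : ℝ) < 4 * (2 * (k : ℝ) + 1))]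
    rw [← abs_div]
    congr 1
    unfold skewT kap
    field_simp
    ring
  simp only [e]
  rw [← Finset.sum_div, div_le_iff₀ (by positivity)]
  refine sum_mul_abs_le (fun i : ℕ => ((i : ℝ) + 1) * i / 2)
    (fun i : ℕ => -(2 * (k : ℝ) * (k + 1) * (2 * k + 1)) +
      ((3 * k + 2) * (k - 1) + 2 * (2 * k + 1)) * (i + 1) + 2 * (2 * k + 1) * (i + 1) ^ 2)
    (fun i _ => by positivity) ?_ ?_
  · have := sqs_pos (k := k) (by omega)
    positivity
  · rw [sum_choose_weight, sum_choose_weight_mul_sq]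
    unfold sqs
    rw [hx, ← sub_nonneg]
    ring_nf
    positivity

section Sequences

variable {k : ℕ} {P lam B : ℝ} {g u : ℕ → ℝ}

theorem abs_remainder_le (hu : ∀ l, |u (l + 2) - 2 * u (l + 1) + u l| ≤ B) (l : ℕ) :
    |u l - u 0 - l * (u 1 - u 0)| ≤ l * (l - 1) / 2 * B ∧
      |u (l + 1) - u l - (u 1 - u 0)| ≤ l * B := by
  induction l with
  | zero => simp
  | succ l ih =>
    obtain ⟨h1, h2⟩ := ih
    have h3 := hu l
    rw [abs_le] at h1 h2 h3 ⊢
    rw [abs_le]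
    push_cast
    refine ⟨⟨by linarith, by linarith⟩, by linarith, by linarith⟩

/-- The identity behind the expansion of `κλ - m`. -/
theorem skew_identity (hk : 0 < k) (hg : g 0 = 0) (hu : ∀ l, u l = g (l + 1) - g l) {m : ℝ}
    (h1 : P = lam * ∑ i ∈ Finset.range k, ((i : ℝ) + 1) * g (i + 1))
    (h2 : (lam * kap k - m - 1) * P = lam * ∑ t ∈ Finset.range k,
      ((k : ℝ) * (k + 1) / 2 - ((t : ℝ) + 1) * (t + 1 + 1) / 2) * g (t + 1))
    (h3 : (m - 1) * u 0 = lam * ∑ i ∈ Finset.range k, ((i : ℝ) + 1) * u (i + 1)) :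
    (lam * kap k - m - 1 - skewT k) * P =
      lam * ∑ l ∈ Finset.range k, gammaW k (l + 1) * (u (l + 2) - 2 * u (l + 1) + u l) +
        tau k * (lam * kap k - m + 1) * u 0 := by
  have hD : 2 * (k : ℝ) + 1 ≠ 0 := by positivity
  set w : ℕ → ℝ := fun j => (k : ℝ) * (k + 1) / 2 - (j : ℝ) * (j + 1) / 2 - skewT k * j with hw
  have a1 := sum_mul_abel (fun l => omegaW k l) w g u
    (fun l => by simp only [hw]; push_cast; exact omegaW_sub k l hD) hg hu k
  have a2 : (lam * kap k - m - 1 - skewT k) * P =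
      lam * ∑ i ∈ Finset.range k, w (i + 1) * g (i + 1) := by
    have : ∑ i ∈ Finset.range k, w (i + 1) * g (i + 1) =
        ∑ t ∈ Finset.range k,
          ((k : ℝ) * (k + 1) / 2 - ((t : ℝ) + 1) * (t + 1 + 1) / 2) * g (t + 1) -
        skewT k * ∑ i ∈ Finset.range k, ((i : ℝ) + 1) * g (i + 1) := by
      rw [Finset.mul_sum, ← Finset.sum_sub_distrib]
      exact Finset.sum_congr rfl fun i _ => by simp only [hw]; push_cast; ring
    rw [this, mul_sub, ← h2]
    linear_combination (-skewT k) * h1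
  rw [omegaW_self, zero_mul, sub_zero] at a1
  have a3 := sum_green (fun l => gammaW k l) u k
  have b0 : gammaW k 0 = 0 := by simp [gammaW]
  have bk : gammaW k k = 0 := by simp [gammaW]
  have bk1 : gammaW k ((k : ℝ) + 1) = 0 := by simp [gammaW]
  push_cast at a3
  rw [b0, bk, bk1] at a3
  have a4 : ∑ l ∈ Finset.range k,
      (gammaW k (l + 1) * (u (l + 2) - 2 * u (l + 1) + u l) -
        u (l + 1) * (gammaW k (l + 2) - 2 * gammaW k (l + 1) + gammaW k l)) =
      ∑ l ∈ Finset.range k, gammaW k (l + 1) * (u (l + 2) - 2 * u (l + 1) + u l) -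
      (∑ l ∈ Finset.range k, omegaW k (l + 1) * u (l + 1) +
        tau k * ∑ i ∈ Finset.range k, ((i : ℝ) + 1) * u (i + 1)) := by
    rw [Finset.mul_sum, ← Finset.sum_add_distrib, ← Finset.sum_sub_distrib]
    refine Finset.sum_congr rfl fun l _ => ?_
    rw [gammaW_second_diff _ _ hD]; ring
  have a5 : ∑ l ∈ Finset.range k, omegaW k (l + 1) * u (l + 1) =
      ∑ l ∈ Finset.range k, omegaW k l * u l - omegaW k 0 * u 0 := by
    have h6 := Finset.sum_range_succ' (fun l : ℕ => omegaW k l * u l) k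
    rw [Finset.sum_range_succ, omegaW_self, zero_mul, add_zero] at h6
    rw [h6]; push_cast; ring
  have a6 := omegaW_zero_sub k
  rw [a4, a5] at a3
  rw [a2, a1]
  unfold kap
  linear_combination (-lam) * a3 + tau k * h3 + lam * u 0 * a6

theorem abs_green_sum_le (hk : 2 ≤ k) (hB : ∀ l, |u (l + 2) - 2 * u (l + 1) + u l| ≤ B) :
    |∑ l ∈ Finset.range k, gammaW k (l + 1) * (u (l + 2) - 2 * u (l + 1) + u l)| ≤
      tau k * (skewT k + 2) * sqs k / 6 * B := by
  have hB0 : 0 ≤ B := (abs_nonneg _).trans (hB 0)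
  refine (Finset.abs_sum_le_sum_abs _ _).trans ?_
  refine le_trans (Finset.sum_le_sum fun l _ => ?_)
    ((Finset.sum_mul _ _ _).symm.le.trans
      (mul_le_mul_of_nonneg_right (sum_abs_gammaW_le hk) hB0))
  rw [abs_mul]
  exact mul_le_mul_of_nonneg_left (hB l) (abs_nonneg _)

theorem sum_mul_choose_eq (k : ℕ) :
    ∑ l ∈ Finset.range k, ((l : ℝ) + 1) *
      ((k : ℝ) * (k + 1) / 2 - ((l : ℝ) + 1) * (l + 1 + 1) / 2) = skewT k * sqs k := by
  have e : ∀ l : ℕ, ((l : ℝ) + 1) *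
      ((k : ℝ) * (k + 1) / 2 - ((l : ℝ) + 1) * (l + 1 + 1) / 2) =
      (k : ℝ) * (k + 1) / 2 * ((l : ℝ) + 1) ^ 1 - 1 / 2 * ((l : ℝ) + 1) ^ 2 -
        1 / 2 * ((l : ℝ) + 1) ^ 3 := fun l => by ring
  simp only [e, Finset.sum_sub_distrib, ← Finset.mul_sum, sum_pow_one, sum_pow_two,
    sum_pow_three]
  unfold skewT sqs
  field_simp
  ring

theorem first_diff_ge (hk : 2 ≤ k) (hl : 0 ≤ lam) (hg : g 0 = 0)
    (hu : ∀ l, u l = g (l + 1) - g l) {m : ℝ} (hy : 0 ≤ lam * kap k - m + 1) (hu0 : 0 ≤ u 0)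
    (h1 : P = lam * ∑ i ∈ Finset.range k, ((i : ℝ) + 1) * g (i + 1))
    (h3 : (m - 1) * u 0 = lam * ∑ i ∈ Finset.range k, ((i : ℝ) + 1) * u (i + 1))
    (hB : ∀ l, |u (l + 2) - 2 * u (l + 1) + u l| ≤ B) :
    P - lam * (0.11 * ((k : ℝ) + 1 / 2) ^ 2 * sqs k * B) ≤ lam * sqs k * u 0 := by
  have hB0 : 0 ≤ B := (abs_nonneg _).trans (hB 0)
  have hk' : (2 : ℝ) ≤ k := by exact_mod_cast hk
  set Ω : ℕ → ℝ := fun l => (k : ℝ) * (k + 1) / 2 - (l : ℝ) * (l + 1) / 2 with hΩ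
  have a1 := sum_mul_abel Ω (fun j => (j : ℝ)) g u
    (fun l => by simp only [hΩ]; push_cast; ring) hg hu k
  have hΩk : Ω k = 0 := by simp [hΩ]
  rw [hΩk, zero_mul, sub_zero] at a1
  have a2 : P = lam * ∑ l ∈ Finset.range k, Ω l * u l := by
    rw [h1, ← a1]; push_cast; rfl
  have a3 : ∑ l ∈ Finset.range k, Ω l * u l =
      ∑ l ∈ Finset.range k, Ω (l + 1) * u (l + 1) + kap k * u 0 := by
    have h6 := Finset.sum_range_succ' (fun l : ℕ => Ω l * u l) k
    rw [Finset.sum_range_succ, hΩk, zero_mul, add_zero] at h6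
    rw [h6]; simp [hΩ, kap]
  set e : ℕ → ℝ := fun l => u l - u 0 - l * (u 1 - u 0) with he
  set Z := ∑ i ∈ Finset.range k, (skewT k * (i + 1) - Ω (i + 1)) * e (i + 1) with hZ
  have hZle : -Z ≤ 0.11 * ((k : ℝ) + 1 / 2) ^ 2 * sqs k * B := by
    rw [hZ, ← Finset.sum_neg_distrib]
    refine le_trans (Finset.sum_le_sum fun i _ => ?_)
      ((Finset.sum_mul _ _ _).symm.le.trans
        (mul_le_mul_of_nonneg_right (sum_abs_skew_le hk) hB0))
    have h5 := (abs_remainder_le hB (i + 1)).1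
    push_cast at h5
    refine (neg_le_abs _).trans ?_
    rw [abs_mul]
    have h6 := mul_le_mul_of_nonneg_left h5 (abs_nonneg (skewT k * (i + 1) - Ω (i + 1)))
    simp only [he, hΩ, kap] at h6 ⊢
    push_cast at h6 ⊢
    refine h6.trans (le_of_eq ?_)
    ring
  have hZeq : Z = skewT k * ∑ i ∈ Finset.range k, ((i : ℝ) + 1) * u (i + 1) -
      ∑ i ∈ Finset.range k, Ω (i + 1) * u (i + 1) -
      (skewT k * kap k - ∑ i ∈ Finset.range k, Ω (i + 1)) * u 0 -
      (skewT k * sqs k - ∑ i ∈ Finset.range k, ((i : ℝ) + 1) * Ω (i + 1)) * (u 1 - u 0) := by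
    rw [← sum_range_succ_cast, ← sum_range_succ_cast_sq]
    simp only [Finset.mul_sum, Finset.sum_mul, ← Finset.sum_sub_distrib, hZ]
    refine Finset.sum_congr rfl fun i _ => ?_
    simp only [he]; push_cast; ring
  have hs1 : ∑ i ∈ Finset.range k, Ω (i + 1) = sqs k - kap k := by
    have e : ∀ i : ℕ, Ω (i + 1) = (k : ℝ) * (k + 1) / 2 -
      (1 / 2 * ((i : ℝ) + 1) ^ 1 + 1 / 2 * ((i : ℝ) + 1) ^ 2) := fun i => by
        simp only [hΩ]; push_cast; ring
    simp only [e, Finset.sum_add_distrib, Finset.sum_sub_distrib, ← Finset.mul_sum, sum_pow_one,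
      sum_pow_two, Finset.sum_const, Finset.card_range, nsmul_eq_mul]
    unfold sqs kap; ring
  have hs2 : ∑ i ∈ Finset.range k, ((i : ℝ) + 1) * Ω (i + 1) = skewT k * sqs k := by
    rw [← sum_mul_choose_eq]
    refine Finset.sum_congr rfl fun i _ => ?_
    simp only [hΩ]; push_cast; ring
  rw [hs1, hs2] at hZeq
  have hT : 0 ≤ skewT k := by
    unfold skewT
    exact div_nonneg (mul_nonneg (by linarith) (by linarith)) (by linarith)
  have main : lam * sqs k * u 0 = P + skewT k * (lam * kap k - m + 1) * u 0 + lam * Z := by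
    rw [hZeq, a2, a3]
    linear_combination skewT k * h3
  rw [main]
  have := mul_le_mul_of_nonneg_left hZle hl
  have : 0 ≤ skewT k * (lam * kap k - m + 1) * u 0 := mul_nonneg (mul_nonneg hT hy) hu0
  linarith

end Sequences

theorem tau_pos {k : ℕ} (hk : 2 ≤ k) : 0 < tau k := by
  have hk' : (2 : ℝ) ≤ k := by exact_mod_cast hk
  obtain ⟨x, hx, hx0⟩ : ∃ x : ℝ, (k : ℝ) = x + 2 ∧ 0 ≤ x := ⟨k - 2, by ring, by linarith⟩
  unfold tau
  refine div_pos ?_ (by positivity)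
  rw [hx]; ring_nf; positivity

theorem tau_le {k : ℕ} (hk : 2 ≤ k) : tau k ≤ ((k : ℝ) + 1 / 2) ^ 2 := by
  have hk' : (2 : ℝ) ≤ k := by exact_mod_cast hk
  obtain ⟨x, hx, hx0⟩ : ∃ x : ℝ, (k : ℝ) = x + 2 ∧ 0 ≤ x := ⟨k - 2, by ring, by linarith⟩
  unfold tau
  rw [div_le_iff₀ (by positivity), hx, ← sub_nonneg]
  ring_nf; positivity

theorem skewT_nonneg {k : ℕ} (hk : 2 ≤ k) : 0 ≤ skewT k := by
  have hk' : (2 : ℝ) ≤ k := by exact_mod_cast hk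
  unfold skewT
  exact div_nonneg (mul_nonneg (by linarith) (by linarith)) (by linarith)

namespace Regular

variable {k : ℕ} {lam s : ℝ}

/-- At a double mode `m`, `m + 1` the mean exceeds `m` by slightly more than `skewT k + 1`. -/
theorem double_mode_bounds (h : Regular k lam s) {m : ℤ} (hm : IsMode k lam m)
    (hm1 : IsMode k lam (m + 1)) :
    0 < lam * kap k - m - 1 - skewT k ∧
      lam * kap k - m - 1 - skewT k ≤ 5 * (tau k * (skewT k + 2)) / s ^ 2 := by
  have hk := h.two_le
  have hs := h.s_pos
  have hl := h.lam_pos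
  set p := mass k lam with hp
  set W := Real.exp (k * lam) with hW
  have hW0 : 0 < W := Real.exp_pos _
  have heq : p (m + 1) = p m := le_antisymm (hm _) (hm1 _)
  set g : ℕ → ℝ := fun j => bdiff p (m + 1 - j) with hg
  set u : ℕ → ℝ := fun l => -(bdiff (bdiff p) (m + 1 - l)) with hu
  have hg0 : g 0 = 0 := by
    simp only [hg, bdiff]
    push_cast
    rw [sub_zero, heq, add_sub_cancel_right, sub_self]
  have hgu : ∀ l, u l = g (l + 1) - g l := by
    intro l
    simp only [hu, hg]
    rw [bdiff]
    push_cast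
    rw [show m + 1 - (l : ℤ) - 1 = m + 1 - (l + 1) by ring]; ring
  have hg1 : ∀ i : ℕ, g (i + 1) = bdiff p (m - i) := by
    intro i
    simp only [hg]; push_cast
    rw [show m + 1 - ((i : ℤ) + 1) = m - i by ring]
  have hu0 : u 0 = p m - p (m - 1) := by
    rw [hgu, hg0, hg1]; simp [bdiff]
  have h1 : p m = lam * ∑ i ∈ Finset.range k, ((i : ℝ) + 1) * g (i + 1) := by
    have := mass_succ_recurrence k lam m
    simp only [hg1]
    rw [← this]
    have e : bdiff p (m + 1) = 0 := by simpa [hg] using hg0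
    rw [e]; ring
  have h2 : (lam * kap k - m - 1) * p m = lam * ∑ t ∈ Finset.range k,
      ((k : ℝ) * (k + 1) / 2 - ((t : ℝ) + 1) * (t + 1 + 1) / 2) * g (t + 1) := by
    rw [← sum_mul_sum_range (fun t => g (t + 1)) k]
    have h3 := mass_recurrence k lam (m + 1)
    have e : ∀ i : ℕ, ((i : ℝ) + 1) * ∑ t ∈ Finset.range i, g (t + 1) =
        ((i : ℝ) + 1) * p m - ((i : ℝ) + 1) * p (m + 1 - ((i : ℤ) + 1)) := by
      intro i
      simp only [hg1]
      rw [← bdiff_sub, show m + 1 - ((i : ℤ) + 1) = m - i by ring]; ring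
    simp only [e, Finset.sum_sub_distrib]
    rw [← Finset.sum_mul, sum_range_succ_cast, mul_sub, ← h3, ← hp, heq]
    push_cast; ring
  have h3 : ((m : ℝ) - 1) * u 0 = lam * ∑ i ∈ Finset.range k, ((i : ℝ) + 1) * u (i + 1) := by
    have h4 := mass_succ_recurrence k lam (m - 1)
    have e : ∀ i : ℕ, ((i : ℝ) + 1) * u (i + 1) =
        ((i : ℝ) + 1) * bdiff p (m - 1 - i) - ((i : ℝ) + 1) * g (i + 1) := by
      intro i
      rw [hgu, hg1 (i + 1)]; push_cast
      rw [show m - ((i : ℤ) + 1) = m - 1 - i by ring]; ring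
    simp only [e, Finset.sum_sub_distrib]
    rw [mul_sub, ← h1, ← h4, hu0, sub_add_cancel, bdiff]
    push_cast; ring
  have hB : ∀ l, |u (l + 2) - 2 * u (l + 1) + u l| ≤ 1.6 * (W / s ^ 5) := by
    intro l
    have h5 := h.abs_bdiff_four_le (m + 1 - l)
    have e : u (l + 2) - 2 * u (l + 1) + u l = -(bdiff^[4] p (m + 1 - l)) := by
      simp only [hu]
      change _ = -(bdiff (bdiff (bdiff (bdiff p))) (m + 1 - l))
      rw [bdiff.eq_def (bdiff (bdiff (bdiff p))), bdiff.eq_def (bdiff (bdiff p)) (m + 1 - l),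
        bdiff.eq_def (bdiff (bdiff p)) (m + 1 - l - 1)]
      push_cast
      rw [show m + 1 - ((l : ℤ) + 2) = m + 1 - l - 1 - 1 by ring,
        show m + 1 - ((l : ℤ) + 1) = m + 1 - l - 1 by ring]
      ring
    rw [e, abs_neg]; exact h5
  have hu00 : 0 ≤ u 0 := by rw [hu0]; linarith [hm (m - 1)]
  have hule : u 0 ≤ 0.425 * (W / s ^ 3) := by
    have h5 := (abs_le.1 (h.abs_bdiff_two_le (m + 1))).1
    simp only [hu]; push_cast; rw [sub_zero]
    change -(0.425 * (W / s ^ 3)) ≤ bdiff (bdiff p) (m + 1) at h5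
    linarith
  have hmean : (0 : ℝ) ≤ lam * kap k - m - 1 := by
    have := hm1.le_mean hl.le; push_cast at this; linarith
  have hid := skew_identity (by omega) hg0 hgu h1 h2 h3
  have hZ := abs_le.1 (abs_green_sum_le hk hB)
  have hfd := first_diff_ge hk hl.le hg0 hgu (by linarith : (0 : ℝ) ≤ lam * kap k - m + 1)
    hu00 h1 h3 hB
  have hM := h.mass_bound (M := p m) hm
  set Z := ∑ l ∈ Finset.range k, gammaW k (l + 1) * (u (l + 2) - 2 * u (l + 1) + u l) with hZd
  set d := lam * kap k - m - 1 - skewT k with hd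
  have ht := tau_pos hk
  have hT := skewT_nonneg hk
  have hte := tau_le hk
  have hten := h.ten_le
  set c := tau k * (skewT k + 2) with hc
  have hc0 : 0 < c := by positivity
  -- the coefficient of `d`
  have hcoef : 0.14 * (W / s) ≤ p m - tau k * u 0 := by
    have h6 : tau k * u 0 ≤ (s ^ 2 / 10) * (0.425 * (W / s ^ 3)) :=
      mul_le_mul (by linarith) hule hu00 (by positivity)
    have e : (s ^ 2 / 10) * (0.425 * (W / s ^ 3)) = 0.0425 * (W / s) := by field_simp; norm_num
    have e2 : 0.2875 / s * W = 0.2875 * (W / s) := by ring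
    have : 0 < W / s := by positivity
    rw [e] at h6; rw [e2] at hM; linarith
  have hmain : d * (p m - tau k * u 0) = lam * Z + c * u 0 := by
    rw [hc, mul_sub, hid]; rw [hd]; ring
  have eZ : lam * (tau k * (skewT k + 2) * sqs k / 6 * (1.6 * (W / s ^ 5))) =
      c * (1.6 / 6 * (W / s ^ 3)) := by
    have : lam * (tau k * (skewT k + 2) * sqs k / 6 * (1.6 * (W / s ^ 5))) =
      c * (s ^ 2 / 6 * (1.6 * (W / s ^ 5))) := by rw [h.sq_eq, hc]; ring
    rw [this]; field_simp
  have hZ1 : -(c * (1.6 / 6 * (W / s ^ 3))) ≤ lam * Z := by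
    rw [← eZ]
    have := mul_le_mul_of_nonneg_left hZ.1 hl.le
    linarith
  have hZ2 : lam * Z ≤ c * (1.6 / 6 * (W / s ^ 3)) := by
    rw [← eZ]; exact mul_le_mul_of_nonneg_left hZ.2 hl.le
  have hW3 : 0 < W / s ^ 3 := by positivity
  constructor
  · have hu1 : 1.6 / 6 * (W / s ^ 3) < u 0 := by
      have e1 : lam * (0.11 * ((k : ℝ) + 1 / 2) ^ 2 * sqs k * (1.6 * (W / s ^ 5))) =
          0.176 * ((k : ℝ) + 1 / 2) ^ 2 * (W / s ^ 3) := by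
        have : lam * (0.11 * ((k : ℝ) + 1 / 2) ^ 2 * sqs k * (1.6 * (W / s ^ 5))) =
          0.11 * ((k : ℝ) + 1 / 2) ^ 2 * s ^ 2 * (1.6 * (W / s ^ 5)) := by rw [h.sq_eq]; ring
        rw [this]; field_simp; norm_num
      have e2 : 0.2875 / s * W = 0.2875 * s ^ 2 * (W / s ^ 3) := by field_simp
      rw [e1, ← h.sq_eq] at hfd
      rw [e2] at hM
      have h7 := mul_le_mul_of_nonneg_right hten hW3.le
      have h8 : s ^ 2 * (1.6 / 6 * (W / s ^ 3)) < s ^ 2 * u 0 := by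
        have : 0 < s ^ 2 * (W / s ^ 3) := by positivity
        linarith
      exact lt_of_mul_lt_mul_left h8 (by positivity)
    have h9 : 0 < d * (p m - tau k * u 0) := by
      rw [hmain]
      have := mul_lt_mul_of_pos_left hu1 hc0
      linarith
    have : 0 < W / s := by positivity
    exact pos_of_mul_pos_left h9 (by linarith)
  · by_contra hcon
    push Not at hcon
    have h9 : d * (p m - tau k * u 0) ≤ c * (0.7 * (W / s ^ 3)) := by
      rw [hmain]
      have := mul_le_mul_of_nonneg_left hule hc0.le
      have : 0 < c * (W / s ^ 3) := by positivity
      linarith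
    have h10 : 0 < 5 * c / s ^ 2 := by positivity
    have h11 : 5 * c / s ^ 2 * (0.14 * (W / s)) < d * (p m - tau k * u 0) := by
      have : 0 < W / s := by positivity
      refine mul_lt_mul hcon hcoef (by positivity) (by linarith)
    have e : 5 * c / s ^ 2 * (0.14 * (W / s)) = c * (0.7 * (W / s ^ 3)) := by
      field_simp; norm_num
    linarith

end Regular

theorem mul_le_exp_of_le {c z₀ z : ℝ} (hz₀ : 1 ≤ z₀) (hz : z₀ ≤ z)
    (h : c * z₀ ≤ Real.exp z₀) (hc : 0 ≤ c) : c * z ≤ Real.exp z := by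
  have e : Real.exp z = Real.exp z₀ * Real.exp (z - z₀) := by rw [← Real.exp_add]; ring_nf
  have h1 : z - z₀ + 1 ≤ Real.exp (z - z₀) := Real.add_one_le_exp _
  rw [e]
  calc c * z ≤ c * (z₀ * (z - z₀ + 1)) := by
        refine mul_le_mul_of_nonneg_left ?_ hc
        nlinarith [mul_nonneg (sub_nonneg.2 hz₀) (sub_nonneg.2 hz)]
    _ = c * z₀ * (z - z₀ + 1) := by ring
    _ ≤ _ := mul_le_mul h h1 (by linarith) (Real.exp_pos _).le

theorem regular_of_exp_le {k : ℕ} {lam z₀ : ℝ} (hk : 2 ≤ k) (hl : 0 < lam) (h1 : 1 ≤ z₀)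
    (hz : z₀ ≤ 0.292 * (lam * ((k : ℝ) + 1 / 2)))
    (he : 7.4 * ((k : ℝ) * (k + 1)) * z₀ ≤ Real.exp z₀)
    (hten : 10 * ((k : ℝ) + 1 / 2) ^ 2 ≤ lam * sqs k) :
    Regular k lam (Real.sqrt (lam * sqs k)) := by
  have hs2 : 0 < lam * sqs k := mul_pos hl (sqs_pos (by omega))
  have hsq : Real.sqrt (lam * sqs k) ^ 2 = lam * sqs k := Real.sq_sqrt hs2.le
  refine ⟨hk, hl, Real.sqrt_pos.2 hs2, hsq, by rw [hsq]; exact hten, ?_⟩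
  set s := Real.sqrt (lam * sqs k) with hs
  set z := 0.292 * (lam * ((k : ℝ) + 1 / 2)) with hzd
  have hc : 7.4 * ((k : ℝ) * (k + 1)) * z ≤ Real.exp z :=
    mul_le_exp_of_le h1 hz he (by positivity)
  have hz0 : 0 < z := by linarith
  have hE := Real.exp_pos z
  have hq : s ^ 2 * Real.exp (-z) ≤ 1 / (7.4 * 0.876) := by
    have e : s ^ 2 = z * ((k : ℝ) * (k + 1)) / 0.876 := by
      rw [hsq, hzd]; unfold sqs; ring
    rw [Real.exp_neg, ← div_eq_mul_inv, div_le_iff₀ hE, e]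
    norm_num at hc ⊢
    linarith
  have hX : (16 * Real.exp (-(0.73 * (lam * ((k : ℝ) + 1 / 2)))) * s ^ 5) ^ 2 ≤ 0.15 ^ 2 := by
    have e1 : Real.exp (-(0.73 * (lam * ((k : ℝ) + 1 / 2)))) ^ 2 = Real.exp (-z) ^ 5 := by
      rw [← Real.exp_nat_mul, ← Real.exp_nat_mul]; congr 1; rw [hzd]; push_cast; ring
    calc _ = 256 * Real.exp (-(0.73 * (lam * ((k : ℝ) + 1 / 2)))) ^ 2 * (s ^ 2) ^ 5 := by ring
      _ = 256 * (s ^ 2 * Real.exp (-z)) ^ 5 := by rw [e1]; ring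
      _ ≤ 256 * (1 / (7.4 * 0.876)) ^ 5 := by
        refine mul_le_mul_of_nonneg_left (pow_le_pow_left₀ ?_ hq 5) (by norm_num)
        positivity
      _ ≤ _ := by norm_num
  exact (sq_le_sq₀ (by positivity) (by norm_num)).1 hX

theorem le_exp_half_of_sq_le {x : ℝ} (a : ℕ) (h : x ^ 2 ≤ 2.7182818283 ^ a) :
    x ≤ Real.exp (a / 2) := by
  refine le_of_sq_le_sq (h.trans ?_) (Real.exp_pos _).le
  have e : Real.exp ((a : ℝ) / 2) ^ 2 = Real.exp 1 ^ a := by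
    rw [← Real.exp_nat_mul, ← Real.exp_nat_mul]; congr 1; push_cast; ring
  rw [e]
  exact pow_le_pow_left₀ (by norm_num) Real.exp_one_gt_d9.le a

theorem regular_of_mode_ge {k a : ℕ} {lam x : ℝ} (hk : 2 ≤ k) (ha : 2 ≤ a)
    (hx : 0 < x) (hlam : x ≤ lam * kap k)
    (he : (7.4 * ((k : ℝ) * (k + 1)) * (a / 2)) ^ 2 ≤ 2.7182818283 ^ a)
    (h1 : a / 2 * kap k ≤ 0.292 * ((k : ℝ) + 1 / 2) * x)
    (h2 : 10 * ((k : ℝ) + 1 / 2) ^ 2 * kap k ≤ x * sqs k) :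
    Regular k lam (Real.sqrt (lam * sqs k)) := by
  have hkap : 0 < kap k := kap_pos (by omega)
  have hs := sqs_pos (k := k) (by omega)
  have hl : 0 < lam := pos_of_mul_pos_left (hx.trans_le hlam) hkap.le
  have ha' : (2 : ℝ) ≤ a := by exact_mod_cast ha
  refine regular_of_exp_le hk hl (z₀ := a / 2) (by linarith) ?_ (le_exp_half_of_sq_le a he) ?_
  · refine le_of_mul_le_mul_right ?_ hkap
    have := mul_le_mul_of_nonneg_left hlam (by positivity : 0 ≤ 0.292 * ((k : ℝ) + 1 / 2))
    linarith
  · refine le_of_mul_le_mul_right ?_ hkap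
    have := mul_le_mul_of_nonneg_right hlam hs.le
    linarith

theorem regular_of_eighteen_le {k : ℕ} {lam : ℝ} (hk : 18 ≤ k)
    (hlam : (k : ℝ) * (k + 1) + 1 - (3 * k + 5) / 8 ≤ lam * kap k) :
    Regular k lam (Real.sqrt (lam * sqs k)) := by
  have hk' : (18 : ℝ) ≤ k := by exact_mod_cast hk
  have hkap : 0 < kap k := kap_pos (by omega)
  have hl : 1.96 ≤ lam := by
    refine le_of_mul_le_mul_right (le_trans ?_ hlam) hkap
    unfold kap
    nlinarith
  obtain ⟨h, hh⟩ : ∃ h : ℝ, h = (k : ℝ) + 1 / 2 := ⟨_, rfl⟩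
  have hh' : 18.5 ≤ h := by rw [hh]; linarith
  have hkk : (k : ℝ) * (k + 1) = h ^ 2 - 1 / 4 := by rw [hh]; ring
  refine regular_of_exp_le (by omega) (by linarith) (z₀ := 0.57 * h) (by linarith) ?_ ?_ ?_
  · rw [← hh]; nlinarith
  · set y := 0.19 * h with hy
    have e1 : Real.exp (0.57 * h) = Real.exp y ^ 3 := by
      rw [← Real.exp_nat_mul]; congr 1; rw [hy]; push_cast; ring
    have h33 : (33 : ℝ) ≤ Real.exp ((7 : ℕ) / 2) := le_exp_half_of_sq_le 7 (by norm_num)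
    have h2 : 8.51 * y ≤ Real.exp y := by
      have e : Real.exp y = Real.exp ((7 : ℕ) / 2) * Real.exp (y - 3.5) := by
        rw [← Real.exp_add]; congr 1; push_cast; ring
      have h3 : y - 3.5 + 1 ≤ Real.exp (y - 3.5) := Real.add_one_le_exp _
      have h4 := mul_le_mul h33 h3 (by rw [hy]; linarith) (Real.exp_pos _).le
      rw [e]; rw [hy] at h4 ⊢; linarith
    have h3 := pow_le_pow_left₀ (by rw [hy]; positivity) h2 3
    rw [e1, hkk]
    refine le_trans ?_ h3
    have : 0 < h ^ 3 := by positivity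
    rw [hy]
    have e : (8.51 * (0.19 * h)) ^ 3 = (8.51 * 0.19) ^ 3 * h ^ 3 := by ring
    rw [e]
    norm_num
    nlinarith
  · rw [← hh]
    have e : sqs k = h * (h ^ 2 - 1 / 4) / 3 := by unfold sqs; rw [hh]; ring
    have h0 : 0 ≤ sqs k := (sqs_pos (by omega)).le
    have := mul_le_mul_of_nonneg_right hl h0
    refine le_trans ?_ this
    rw [e]
    have : 0 ≤ h * (0.65 * (h ^ 2 - 1 / 4) - 10 * h) := by
      apply mul_nonneg (by linarith)
      nlinarith
    nlinarith

/-- Evaluation of `f x` that first brings `x` to the form of a numeral. -/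
noncomputable def forceNat {α : Type} (x : ℕ) (f : ℕ → α) : α :=
  Nat.rec (f 0) (fun n _ => f (Nat.succ n)) x

theorem forceNat_eq {α : Type} (x : ℕ) (f : ℕ → α) : forceNat x f = f x := by
  cases x <;> rfl

/-- The weighted sum `x₀ + 2 x₁ + 3 x₂ + ⋯` of a list. -/
def weightedSum : List ℕ → ℕ
  | [] => 0
  | x :: l => x + (l.sum + weightedSum l)

theorem sum_le_weightedSum (l : List ℕ) : l.sum ≤ weightedSum l := by
  induction l with
  | nil => rfl
  | cons x l ih => simp only [List.sum_cons, weightedSum]; omega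

theorem take_sum_eq (l : List ℕ) (k : ℕ) :
    (l.take k).sum = ∑ i ∈ Finset.range k, l.getD i 0 := by
  induction k generalizing l with
  | zero => simp
  | succ k ih =>
    cases l with
    | nil => simp
    | cons x l => rw [Finset.sum_range_succ']; simp [ih, add_comm]

theorem weightedSum_take (l : List ℕ) (k : ℕ) :
    weightedSum (l.take k) = ∑ i ∈ Finset.range k, (i + 1) * l.getD i 0 := by
  induction k generalizing l with
  | zero => simp [weightedSum]
  | succ k ih =>
    cases l with
    | nil => simp [weightedSum]
    | cons x l =>
      rw [Finset.sum_range_succ']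
      simp only [List.take_succ_cons, weightedSum, ih, take_sum_eq, List.getD_cons_succ,
        List.getD_cons_zero, ← Finset.sum_add_distrib, zero_add, one_mul]
      rw [add_comm]
      congr 1
      exact Finset.sum_congr rfl fun i _ => by ring

theorem mul_ofDigits_eq (Y : ℕ) (l : List ℕ) :
    ∃ q, (Y + 1) * Nat.ofDigits (Y + 1) l = l.sum + Y * weightedSum l + Y * Y * q := by
  induction l with
  | nil => exact ⟨0, by simp [weightedSum]⟩
  | cons x l ih =>
    obtain ⟨q, hq⟩ := ih
    refine ⟨weightedSum l + (Y + 1) * q, ?_⟩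
    rw [Nat.ofDigits_cons, hq, weightedSum, List.sum_cons]
    ring

theorem mul_ofDigits_mod_div {Y : ℕ} {l : List ℕ} (h : weightedSum l < Y) :
    ((Y + 1) * Nat.ofDigits (Y + 1) l) % (Y * Y) / Y = weightedSum l := by
  obtain ⟨q, hq⟩ := mul_ofDigits_eq Y l
  have hA := (sum_le_weightedSum l).trans_lt h
  rw [hq, Nat.add_mul_mod_self_left, Nat.mod_eq_of_lt, Nat.add_mul_div_left _ _ (by omega),
    Nat.div_eq_of_lt hA, zero_add]
  nlinarith

/-- The next approximate mass, from the number `H` whose base-`X` digits are the previous ones. -/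
noncomputable def nextMass (a b Xk X Y M n H : ℕ) : ℕ :=
  Nat.div (Nat.mul a (Nat.div (Nat.mod (Nat.mul X (Nat.mod H Xk)) M) Y)) (Nat.mul b n)

/-- Compute `t` further masses and check that they increase, then continue with `cont`. -/
noncomputable def checkUp (a b Xk X Y M S S' : ℕ) (cont : ℕ → ℕ → Bool) : ℕ → ℕ → ℕ → Bool :=
  fun t => Nat.rec (fun n H => cont n H) (fun _ ih n H =>
    forceNat (nextMass a b Xk X Y M n H) fun x =>
      and (Nat.ble (Nat.mul S (Nat.mod H X)) (Nat.mul S' x))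
        (forceNat (Nat.add x (Nat.mul X H)) (ih (Nat.succ n)))) t

/-- Compute `t` further masses and check that they decrease, while staying above the masses
`k` places earlier. -/
noncomputable def checkDown (a b Xk X Y M S S' : ℕ) : ℕ → ℕ → ℕ → Bool :=
  fun t => Nat.rec (fun _ _ => true) (fun _ ih n H =>
    forceNat (nextMass a b Xk X Y M n H) fun x =>
    forceNat (Nat.mul S' (Nat.mod H X)) fun y =>
      and (Nat.ble (Nat.succ (Nat.mul S x)) y)
        (and (Nat.ble (Nat.mul S (Nat.mod (Nat.div H Xk) X)) y)
          (forceNat (Nat.add x (Nat.mul X H)) (ih (Nat.succ n))))) t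

/-- The digits of the list `l` are approximations of the `n` masses before index `n`. -/
structure Approx (k : ℕ) (lam : ℝ) (S n : ℕ) (l : List ℕ) : Prop where
  upper : ∀ i : ℕ, (l.getD i 0 : ℝ) ≤ S * mass k lam (n - (i + 1))
  lower : ∀ i : ℕ, ((S : ℝ) - 2 * n) * mass k lam (n - (i + 1)) ≤ l.getD i 0

theorem approx_one (k : ℕ) (lam : ℝ) (S : ℕ) : Approx k lam S 1 [S] := by
  constructor <;> rintro (_ | i)
  · simp [mass_zero]
  · rw [mass_of_neg _ _ (by push_cast; omega)]; simp
  · simp [mass_zero]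
  · rw [mass_of_neg _ _ (by push_cast; omega)]; simp

theorem mass_le_exp (k : ℕ) {lam : ℝ} (h : 0 ≤ lam) (n : ℤ) :
    mass k lam n ≤ Real.exp (k * lam) :=
  le_hasSum (hasSum_mass k lam) n fun _ _ => mass_nonneg h _

/-- The numerical conditions under which the approximation scheme is sound. -/
structure Scale (k a b S X : ℕ) (lam : ℝ) : Prop where
  b_pos : 0 < b
  lam_eq : lam * b = a
  lam_nonneg : 0 ≤ lam
  two_le : 2 ≤ k
  large : (S : ℝ) * Real.exp (k * lam) * kap k + 1 < X

namespace Scale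

variable {k a b S X : ℕ} {lam : ℝ}

theorem weightedSum_lt (h : Scale k a b S X lam) {n : ℕ} {l : List ℕ}
    (hl : Approx k lam S n l) : weightedSum (l.take k) + 1 < X := by
  have e : ((weightedSum (l.take k) : ℕ) : ℝ) ≤ S * Real.exp (k * lam) * kap k := by
    rw [weightedSum_take]
    push_cast
    calc ∑ i ∈ Finset.range k, ((i : ℝ) + 1) * (l.getD i 0 : ℝ)
        ≤ ∑ i ∈ Finset.range k, ((i : ℝ) + 1) * (S * Real.exp (k * lam)) := by
          refine Finset.sum_le_sum fun i _ => mul_le_mul_of_nonneg_left ?_ (by positivity)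
          exact (hl.upper i).trans
            (mul_le_mul_of_nonneg_left (mass_le_exp k h.lam_nonneg _) (by positivity))
      _ = _ := by rw [← Finset.sum_mul, sum_range_succ_cast, mul_comm]
  have := h.large
  have h2 : ((weightedSum (l.take k) + 1 : ℕ) : ℝ) < X := by push_cast; linarith
  exact_mod_cast h2

theorem getD_lt (h : Scale k a b S X lam) {n : ℕ} {l : List ℕ}
    (hl : Approx k lam S n l) (i : ℕ) : l.getD i 0 < X := by
  have hk : 1 ≤ kap k := by
    have : (2 : ℝ) ≤ k := by exact_mod_cast h.two_le
    unfold kap; nlinarith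
  have h1 : (l.getD i 0 : ℝ) ≤ S * Real.exp (k * lam) := (hl.upper i).trans
    (mul_le_mul_of_nonneg_left (mass_le_exp k h.lam_nonneg _) (by positivity))
  have h2 : (S : ℝ) * Real.exp (k * lam) * 1 ≤ S * Real.exp (k * lam) * kap k :=
    mul_le_mul_of_nonneg_left hk (by positivity)
  have h3 : (l.getD i 0 : ℝ) < X := by linarith [h.large]
  exact_mod_cast h3

theorem mem_lt (h : Scale k a b S X lam) {n : ℕ} {l : List ℕ}
    (hl : Approx k lam S n l) : ∀ d ∈ l, d < X := by
  intro d hd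
  obtain ⟨i, hi, rfl⟩ := List.getElem_of_mem hd
  have := h.getD_lt hl i
  rwa [List.getD_eq_getElem _ _ hi] at this

theorem one_lt (h : Scale k a b S X lam) : 1 < X := by
  have h2 : (1 : ℝ) < X := lt_of_le_of_lt (by
    have : 0 ≤ (S : ℝ) * Real.exp (k * lam) * kap k := by
      have := (kap_pos (k := k) (by have := h.two_le; omega)).le
      positivity
    linarith) h.large
  exact_mod_cast h2

theorem digit_eq (h : Scale k a b S X lam) {n : ℕ} {l : List ℕ}
    (hl : Approx k lam S n l) (i : ℕ) : Nat.ofDigits X l / X ^ i % X = l.getD i 0 := by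
  have hX := h.one_lt
  rw [Nat.ofDigits_div_pow_eq_ofDigits_drop i (by omega) l (h.mem_lt hl)]
  by_cases hi : i < l.length
  · rw [List.drop_eq_getElem_cons hi, Nat.ofDigits_cons, Nat.add_mul_mod_self_left,
      List.getD_eq_getElem _ _ hi]
    exact Nat.mod_eq_of_lt (h.mem_lt hl _ (List.getElem_mem hi))
  · rw [List.drop_eq_nil_of_le (by omega), List.getD_eq_default _ _ (by omega)]
    simp

theorem nextMass_eq (h : Scale k a b S X lam) {n : ℕ} {l : List ℕ} (hl : Approx k lam S n l) :
    nextMass a b (X ^ k) X (X - 1) ((X - 1) * (X - 1)) n (Nat.ofDigits X l) =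
      a * weightedSum (l.take k) / (b * n) := by
  have hX := h.one_lt
  have hw := h.weightedSum_lt hl
  have e : X * (Nat.ofDigits X l % X ^ k) % ((X - 1) * (X - 1)) / (X - 1) =
      weightedSum (l.take k) := by
    rw [Nat.ofDigits_mod_pow_eq_ofDigits_take k (by omega) l (h.mem_lt hl)]
    obtain ⟨Y, rfl⟩ : ∃ Y, X = Y + 1 := ⟨X - 1, by omega⟩
    rw [Nat.add_sub_cancel]
    exact mul_ofDigits_mod_div (by omega)
  rw [← e]
  rfl

theorem approx_succ (h : Scale k a b S X lam) {n : ℕ} (hn : 1 ≤ n) {l : List ℕ}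
    (hl : Approx k lam S n l) (hp : 1 / 2 ≤ mass k lam n) :
    Approx k lam S (n + 1) (a * weightedSum (l.take k) / (b * n) :: l) := by
  have hb : (0 : ℝ) < b := by exact_mod_cast h.b_pos
  have hn' : (0 : ℝ) < n := by exact_mod_cast hn
  have hrec := mass_recurrence k lam n
  have hw : ((weightedSum (l.take k) : ℕ) : ℝ) =
      ∑ i ∈ Finset.range k, ((i : ℝ) + 1) * (l.getD i 0 : ℝ) := by
    rw [weightedSum_take]; push_cast; rfl
  have e : ((a * weightedSum (l.take k) : ℕ) : ℝ) / ((b * n : ℕ) : ℝ) =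
      lam * (weightedSum (l.take k) : ℕ) / n := by
    push_cast; rw [← h.lam_eq]; field_simp
  have key : ∀ c : ℝ, c * mass k lam n =
      lam * (∑ i ∈ Finset.range k, ((i : ℝ) + 1) * (c * mass k lam (n - ((i : ℤ) + 1)))) / n := by
    intro c
    rw [eq_div_iff hn'.ne']
    have : ∑ i ∈ Finset.range k, ((i : ℝ) + 1) * (c * mass k lam (n - ((i : ℤ) + 1))) =
        c * ∑ i ∈ Finset.range k, ((i : ℝ) + 1) * mass k lam (n - ((i : ℤ) + 1)) := by
      rw [Finset.mul_sum]; exact Finset.sum_congr rfl fun i _ => by ring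
    rw [this]
    push_cast at hrec
    linear_combination c * hrec
  constructor
  · rintro (_ | i)
    · rw [List.getD_cons_zero]
      refine Nat.cast_div_le.trans ?_
      rw [e]
      have e1 : ((n + 1 : ℕ) : ℤ) - (((0 : ℕ) : ℤ) + 1) = n := by push_cast; ring
      rw [e1, key S, hw]
      refine div_le_div_of_nonneg_right (mul_le_mul_of_nonneg_left ?_ h.lam_nonneg) hn'.le
      exact Finset.sum_le_sum fun i _ =>
        mul_le_mul_of_nonneg_left (hl.upper i) (by positivity)
    · rw [List.getD_cons_succ]
      have e1 : ((n + 1 : ℕ) : ℤ) - (((i + 1 : ℕ) : ℤ) + 1) = n - (i + 1) := by push_cast; ring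
      rw [e1]
      exact hl.upper i
  · rintro (_ | i)
    · rw [List.getD_cons_zero]
      have e1 : ((n + 1 : ℕ) : ℤ) - (((0 : ℕ) : ℤ) + 1) = n := by push_cast; ring
      have h1 : lam * (weightedSum (l.take k) : ℕ) / n - 1 ≤
          ((a * weightedSum (l.take k) / (b * n) : ℕ) : ℝ) := by
        rw [← e]
        have := Nat.lt_floor_add_one (((a * weightedSum (l.take k) : ℕ) : ℝ) / ((b * n : ℕ) : ℝ))
        rw [Nat.floor_div_eq_div] at this
        linarith
      have h2 : ((S : ℝ) - 2 * n) * mass k lam n ≤ lam * (weightedSum (l.take k) : ℕ) / n := by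
        rw [key, hw]
        refine div_le_div_of_nonneg_right (mul_le_mul_of_nonneg_left ?_ h.lam_nonneg) hn'.le
        exact Finset.sum_le_sum fun i _ =>
          mul_le_mul_of_nonneg_left (hl.lower i) (by positivity)
      rw [e1]
      push_cast at h1 h2 ⊢
      linarith
    · rw [List.getD_cons_succ]
      have e1 : ((n + 1 : ℕ) : ℤ) - (((i + 1 : ℕ) : ℤ) + 1) = n - (i + 1) := by push_cast; ring
      rw [e1]
      refine le_trans ?_ (hl.lower i)
      have := mass_nonneg h.lam_nonneg (k := k) (n - (i + 1) : ℤ)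
      refine mul_le_mul_of_nonneg_right ?_ this
      push_cast; linarith

theorem checkUp_sound (h : Scale k a b S X lam) {S' : ℕ} (hS' : 0 < S')
    {cont : ℕ → ℕ → Bool} (t : ℕ) :
    ∀ {n : ℕ} {l : List ℕ}, 1 ≤ n → Approx k lam S n l → S' + 2 * (n + t) ≤ S →
    (∀ j : ℕ, j < n + t → 1 / 2 ≤ mass k lam j) →
    checkUp a b (X ^ k) X (X - 1) ((X - 1) * (X - 1)) S S' cont t n (Nat.ofDigits X l) = true →
    (∀ i : ℕ, n ≤ i → i < n + t → mass k lam (i - 1) ≤ mass k lam i) ∧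
      ∃ l', Approx k lam S (n + t) l' ∧ cont (n + t) (Nat.ofDigits X l') = true := by
  induction t with
  | zero =>
    intro n l _ hl _ _ hc
    exact ⟨fun i h1 h2 => by omega, l, hl, hc⟩
  | succ t ih =>
    intro n l hn hl hS hp hc
    simp only [checkUp, forceNat_eq, Bool.and_eq_true] at hc ih
    rw [h.nextMass_eq hl] at hc
    obtain ⟨hc1, hc2⟩ := hc
    have hl' := h.approx_succ hn hl (hp n (by omega))
    set x := a * weightedSum (l.take k) / (b * n) with hx
    have e : Nat.add x (Nat.mul X (Nat.ofDigits X l)) = Nat.ofDigits X (x :: l) := by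
      rw [Nat.ofDigits_cons]; rfl
    rw [e] at hc2
    obtain ⟨h1, l', h2, h3⟩ := ih (by omega : 1 ≤ n + 1) hl' (by omega)
      (fun j hj => hp j (by omega)) hc2
    have e2 : n + 1 + t = n + (t + 1) := by ring
    rw [e2] at h1 h2 h3
    refine ⟨fun i hi1 hi2 => ?_, l', h2, h3⟩
    rcases eq_or_lt_of_le hi1 with rfl | hi
    · have hd := h.digit_eq hl 0
      rw [pow_zero, Nat.div_one] at hd
      have hc1' : S * (Nat.ofDigits X l % X) ≤ S' * x := Nat.le_of_ble_eq_true hc1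
      rw [hd] at hc1'
      have hc' : (S : ℝ) * l.getD 0 0 ≤ S' * x := by exact_mod_cast hc1'
      have u1 := hl'.upper 0
      have u2 := hl.lower 0
      have e3 : ((n + 1 : ℕ) : ℤ) - (((0 : ℕ) : ℤ) + 1) = n := by push_cast; ring
      have e4 : (n : ℤ) - (((0 : ℕ) : ℤ) + 1) = n - 1 := by push_cast; ring
      rw [e3, List.getD_cons_zero] at u1
      rw [e4] at u2
      have hSS : (S' : ℝ) + 2 * (n + (t + 1)) ≤ S := by exact_mod_cast hS
      have hS0 : (0 : ℝ) < S' := by exact_mod_cast hS'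
      have hS1 : (0 : ℝ) < S := by
        have : (0 : ℝ) ≤ 2 * (n + (t + 1)) := by positivity
        linarith
      have u3 : (S' : ℝ) * mass k lam (n - 1) ≤ l.getD 0 0 := by
        refine le_trans (mul_le_mul_of_nonneg_right ?_ (mass_nonneg h.lam_nonneg _)) u2
        have : (0 : ℝ) ≤ t := by positivity
        linarith
      have u4 := mul_le_mul_of_nonneg_left u3 hS1.le
      have u5 := mul_le_mul_of_nonneg_left u1 hS0.le
      refine le_of_mul_le_mul_left ?_ (mul_pos hS1 hS0)
      linarith
    · exact h1 i hi hi2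

theorem checkDown_sound (h : Scale k a b S X lam) {S' : ℕ} (hS' : 0 < S') (t : ℕ) :
    ∀ {n : ℕ} {l : List ℕ}, 1 ≤ n → Approx k lam S n l → S' + 2 * (n + t) ≤ S →
    (∀ j : ℕ, j < n + t → 1 / 2 ≤ mass k lam j) →
    checkDown a b (X ^ k) X (X - 1) ((X - 1) * (X - 1)) S S' t n (Nat.ofDigits X l) = true →
    ∀ i : ℕ, n ≤ i → i < n + t → mass k lam i < mass k lam (i - 1) ∧
      mass k lam (i - 1 - k) ≤ mass k lam (i - 1) := by
  induction t with
  | zero => intro n l _ _ _ _ _ i h1 h2; omega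
  | succ t ih =>
    intro n l hn hl hS hp hc
    simp only [checkDown, forceNat_eq, Bool.and_eq_true] at hc ih
    rw [h.nextMass_eq hl] at hc
    obtain ⟨hc1, hc3, hc2⟩ := hc
    have hl' := h.approx_succ hn hl (hp n (by omega))
    set x := a * weightedSum (l.take k) / (b * n) with hx
    have e : Nat.add x (Nat.mul X (Nat.ofDigits X l)) = Nat.ofDigits X (x :: l) := by
      rw [Nat.ofDigits_cons]; rfl
    rw [e] at hc2
    have h1 := ih (by omega : 1 ≤ n + 1) hl' (by omega)
      (fun j hj => hp j (by omega)) hc2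
    have e2 : n + 1 + t = n + (t + 1) := by ring
    rw [e2] at h1
    intro i hi1 hi2
    rcases eq_or_lt_of_le hi1 with rfl | hi
    · have hd := h.digit_eq hl 0
      rw [pow_zero, Nat.div_one] at hd
      have hdk := h.digit_eq hl k
      have hc1' : S * x < S' * (Nat.ofDigits X l % X) := Nat.le_of_ble_eq_true hc1
      have hc3' : S * (Nat.ofDigits X l / X ^ k % X) ≤ S' * (Nat.ofDigits X l % X) :=
        Nat.le_of_ble_eq_true hc3
      rw [hd] at hc1' hc3'
      rw [hdk] at hc3'
      have hc' : (S : ℝ) * x < S' * l.getD 0 0 := by exact_mod_cast hc1'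
      have hc'' : (S : ℝ) * l.getD k 0 ≤ S' * l.getD 0 0 := by exact_mod_cast hc3'
      have u1 := hl'.lower 0
      have u2 := hl.upper 0
      have uk := hl.lower k
      have e3 : ((n + 1 : ℕ) : ℤ) - (((0 : ℕ) : ℤ) + 1) = n := by push_cast; ring
      have e4 : (n : ℤ) - (((0 : ℕ) : ℤ) + 1) = n - 1 := by push_cast; ring
      have e5 : (n : ℤ) - ((k : ℤ) + 1) = n - 1 - k := by ring
      rw [e3, List.getD_cons_zero] at u1
      rw [e4] at u2
      rw [e5] at uk
      have hSS : (S' : ℝ) + 2 * (n + (t + 1)) ≤ S := by exact_mod_cast hS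
      have hS0 : (0 : ℝ) < S' := by exact_mod_cast hS'
      have hS1 : (0 : ℝ) < S := by
        have : (0 : ℝ) ≤ 2 * (n + (t + 1)) := by positivity
        linarith
      have ht : (0 : ℝ) ≤ t := by positivity
      have u3 : (S' : ℝ) * mass k lam n ≤ x := by
        refine le_trans (mul_le_mul_of_nonneg_right ?_ (mass_nonneg h.lam_nonneg _)) u1
        push_cast
        linarith
      have u3k : (S' : ℝ) * mass k lam (n - 1 - k) ≤ l.getD k 0 := by
        refine le_trans (mul_le_mul_of_nonneg_right ?_ (mass_nonneg h.lam_nonneg _)) uk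
        linarith
      have u4 := mul_le_mul_of_nonneg_left u3 hS1.le
      have u4k := mul_le_mul_of_nonneg_left u3k hS1.le
      have u5 := mul_le_mul_of_nonneg_left u2 hS0.le
      constructor
      · refine lt_of_mul_lt_mul_left ?_ (mul_pos hS1 hS0).le
        linarith
      · refine le_of_mul_le_mul_left ?_ (mul_pos hS1 hS0)
        linarith
    · exact h1 i hi hi2

end Scale

open Finset in
theorem min_le_mul_mass {k n : ℕ} {lam : ℝ} (hl : 1 ≤ lam)
    (h : ∀ j : ℕ, j < n → 1 ≤ mass k lam j) :
    (n : ℝ) ≤ n * mass k lam n ∨ lam * kap k ≤ n * mass k lam n := by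
  have hrec := mass_recurrence k lam n
  push_cast at hrec
  rw [hrec]
  have hterm : ∀ i : ℕ, i < n → ((i : ℝ) + 1) ≤ (i + 1) * mass k lam (n - ((i : ℤ) + 1)) := by
    intro i hi
    have := h (n - (i + 1)) (by omega)
    rw [show ((n - (i + 1) : ℕ) : ℤ) = n - ((i : ℤ) + 1) by omega] at this
    nlinarith [(by positivity : (0 : ℝ) ≤ i)]
  rcases le_or_gt k n with hkn | hkn
  · right
    refine mul_le_mul_of_nonneg_left ?_ (by linarith)
    rw [← sum_range_succ_cast]
    exact sum_le_sum fun i hi => hterm i (by have := mem_range.1 hi; omega)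
  · left
    have h1 : (n : ℝ) ≤ ∑ i ∈ range n, ((i : ℝ) + 1) := by
      calc (n : ℝ) = ∑ i ∈ range n, (1 : ℝ) := by simp
        _ ≤ _ := sum_le_sum fun i _ => by linarith [(by positivity : (0 : ℝ) ≤ i)]
    have h2 : ∑ i ∈ range n, ((i : ℝ) + 1) ≤
        ∑ i ∈ range k, ((i : ℝ) + 1) * mass k lam (n - ((i : ℤ) + 1)) := by
      refine (sum_le_sum fun i hi => hterm i (mem_range.1 hi)).trans ?_
      refine sum_le_sum_of_subset_of_nonneg (range_subset_range.2 hkn.le) fun i _ _ => ?_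
      exact mul_nonneg (by positivity) (mass_nonneg (by linarith) _)
    have h3 : 0 ≤ ∑ i ∈ range k, ((i : ℝ) + 1) * mass k lam (n - ((i : ℤ) + 1)) :=
      le_trans (by positivity) (h1.trans h2)
    nlinarith

theorem one_le_mass {k : ℕ} {lam : ℝ} (hl : 1 ≤ lam) (n : ℕ) :
    (n : ℝ) ≤ lam * kap k → 1 ≤ mass k lam n := by
  induction n using Nat.strong_induction_on with
  | _ n ih =>
    intro hn
    rcases Nat.eq_zero_or_pos n with rfl | hn0
    · exact (mass_zero k lam).ge
    have hn' : (0 : ℝ) < n := by exact_mod_cast hn0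
    have := min_le_mul_mass (k := k) (n := n) hl fun j hj =>
      ih j hj (le_trans (by exact_mod_cast hj.le) hn)
    refine le_of_mul_le_mul_left ?_ hn'
    rcases this with h | h <;> linarith

theorem half_le_mass {k : ℕ} (hk : 0 < k) {lam : ℝ} (hl : 1 ≤ lam) {n : ℕ} (hn : (n : ℝ) ≤ lam * kap k + 1) :
    1 / 2 ≤ mass k lam n := by
  rcases le_or_gt n 1 with h | h
  · have hc : n = 0 ∨ n = 1 := by omega
    rcases hc with rfl | rfl
    · rw [Nat.cast_zero, mass_zero]; norm_num
    · have hkr : (1 : ℝ) ≤ k := by exact_mod_cast hk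
      have hkap : 1 ≤ kap k := by unfold kap; nlinarith
      exact le_trans (by norm_num) (one_le_mass (k := k) hl 1 (by push_cast; nlinarith))
  · have hn' : (2 : ℝ) ≤ n := by exact_mod_cast h
    have := min_le_mul_mass (k := k) (n := n) hl fun j hj =>
      one_le_mass hl j (by
        have : (j : ℝ) + 1 ≤ n := by exact_mod_cast hj
        linarith)
    rcases this with h | h <;> nlinarith

/-- Near the mode the masses increase up to index `m`, decrease on `[m, m + L + 1]`, and exceed
the masses `k` places earlier up to index `m + L`. -/
structure Pattern (k m L : ℕ) (lam : ℝ) : Prop where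
  lam_pos : 0 < lam
  up : ∀ i : ℕ, 1 ≤ i → i ≤ m → mass k lam (i - 1) ≤ mass k lam i
  down : ∀ i : ℕ, m ≤ i → i ≤ m + L → mass k lam (i + 1) < mass k lam i
  shift : ∀ i : ℕ, m ≤ i → i ≤ m + L → mass k lam (i - k) ≤ mass k lam i

/-- The floor of `skewT k + 1`. -/
def skewFloor (k : ℕ) : ℕ := (3 * k * k + 7 * k + 2) / (4 * (2 * k + 1))

noncomputable def massCheck (k m : ℕ) : Bool :=
  forceNat (Nat.pow 2 128) fun X => forceNat (Nat.pow X k) fun Xk =>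
  forceNat (Nat.sub X 1) fun Y => forceNat (Nat.mul Y Y) fun M =>
  forceNat (4 * (2 * k + 1) * m + (3 * k * k + 7 * k + 2)) fun a =>
  forceNat (2 * (2 * k + 1) * (k * (k + 1))) fun b =>
    checkUp a b Xk X Y M 10000000000000000 9999999999999200
      (checkDown a b Xk X Y M 10000000000000000 9999999999999200 (Nat.succ (skewFloor k)))
      m 1 10000000000000000

noncomputable def massCheckRange (k : ℕ) : ℕ → ℕ → Bool :=
  fun t => Nat.rec (fun _ => true) (fun _ ih m => and (massCheck k m) (ih (Nat.succ m))) t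

theorem massCheckRange_sound {k t : ℕ} : ∀ {m : ℕ}, massCheckRange k t m = true →
    ∀ i, m ≤ i → i < m + t → massCheck k i = true := by
  induction t with
  | zero => intro m _ i h1 h2; omega
  | succ t ih =>
    intro m h i h1 h2
    obtain ⟨h3, h4⟩ := (Bool.and_eq_true _ _ ▸ h : massCheck k m = true ∧
      massCheckRange k t (m + 1) = true)
    rcases eq_or_lt_of_le h1 with rfl | h5
    · exact h3
    · exact ih h4 i h5 (by omega)

theorem skewT_add_one {k : ℕ} : (skewT k + 1) * (4 * (2 * k + 1)) = 3 * (k : ℝ) * k + 7 * k + 2 := by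
  unfold skewT; field_simp; ring

theorem skewFloor_le {k : ℕ} : (skewFloor k : ℝ) ≤ skewT k + 1 := by
  have h : (0 : ℝ) < 4 * (2 * k + 1) := by positivity
  refine le_of_mul_le_mul_right ?_ h
  rw [skewT_add_one]
  exact_mod_cast Nat.div_mul_le_self (3 * k * k + 7 * k + 2) (4 * (2 * k + 1))

theorem lt_skewFloor {k : ℕ} : skewT k + 1 < (skewFloor k : ℝ) + 1 := by
  have h : (0 : ℝ) < 4 * (2 * k + 1) := by positivity
  refine lt_of_mul_lt_mul_right ?_ h.le
  rw [skewT_add_one]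
  have := Nat.lt_div_mul_add (a := 3 * k * k + 7 * k + 2) (b := 4 * (2 * k + 1)) (by positivity)
  have h2 : 3 * k * k + 7 * k + 2 < (skewFloor k + 1) * (4 * (2 * k + 1)) := by
    unfold skewFloor; linarith
  exact_mod_cast h2

theorem pattern_of_massCheck {k m : ℕ} (hk : 2 ≤ k) (hk' : k ≤ 17) (hm : k * (k + 1) ≤ 2 * m)
    (hm' : m + k ≤ 20 * (k + 1)) (hm2 : m ≤ 380) (h : massCheck k m = true) :
    Pattern k m (skewFloor k) ((m + (skewT k + 1)) / kap k) := by
  have hkap : 0 < kap k := kap_pos (by omega)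
  have hT := skewT_nonneg hk
  have hkr : (2 : ℝ) ≤ k := by exact_mod_cast hk
  have hTk : skewT k + 1 ≤ k := by
    have h : (0 : ℝ) < 4 * (2 * k + 1) := by positivity
    refine le_of_mul_le_mul_right ?_ h
    rw [skewT_add_one]; nlinarith
  set lam := ((m : ℝ) + (skewT k + 1)) / kap k with hlam
  have hmean : lam * kap k = m + (skewT k + 1) := div_mul_cancel₀ _ hkap.ne'
  have hl1 : 1 ≤ lam := by
    rw [hlam, le_div_iff₀ hkap]
    have : (k : ℝ) * (k + 1) ≤ 2 * m := by exact_mod_cast hm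
    unfold kap; linarith
  have hLk : skewFloor k ≤ k := by
    have : (skewFloor k : ℝ) ≤ k := skewFloor_le.trans hTk
    exact_mod_cast this
  simp only [massCheck, forceNat_eq] at h
  set a := 4 * (2 * k + 1) * m + (3 * k * k + 7 * k + 2) with ha
  set b := 2 * (2 * k + 1) * (k * (k + 1)) with hb
  have hX : (Nat.pow 2 128) = 2 ^ 128 := rfl
  set S := 10000000000000000 with hS
  have hscale : Scale k a b S (2 ^ 128) lam := by
    refine ⟨by positivity, ?_, by linarith, hk, ?_⟩
    · have e1 : (b : ℝ) = 4 * (2 * k + 1) * kap k := by rw [hb]; unfold kap; push_cast; ring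
      have e2 : (a : ℝ) = 4 * (2 * k + 1) * (m + (skewT k + 1)) := by
        rw [ha]; push_cast; linear_combination - (skewT_add_one (k := k))
      rw [e1, e2, ← hmean]; ring
    · have h40 : (k : ℝ) * lam ≤ 40 := by
        refine le_of_mul_le_mul_right (a := kap k) ?_ hkap
        rw [mul_assoc, hmean]
        have : (m : ℝ) + k ≤ 20 * (k + 1) := by exact_mod_cast hm'
        unfold kap; nlinarith
      have he : Real.exp (k * lam) ≤ 2.7182818286 ^ 40 := by
        calc Real.exp (k * lam) ≤ Real.exp (40 : ℕ) := Real.exp_le_exp.2 (by exact_mod_cast h40)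
          _ = Real.exp 1 ^ 40 := by rw [← Real.exp_nat_mul]; simp
          _ ≤ _ := pow_le_pow_left₀ (Real.exp_pos _).le Real.exp_one_lt_d9.le 40
      have hkap' : kap k ≤ 153 := by
        have : (k : ℝ) ≤ 17 := by exact_mod_cast hk'
        unfold kap; nlinarith
      have := mul_le_mul he hkap' hkap.le (by positivity)
      rw [hS]
      push_cast
      have h3 : (10000000000000000 : ℝ) * (2.7182818286 ^ 40 * 153) + 1 < 2 ^ 128 := by norm_num
      rw [mul_assoc]
      linarith
  have hhalf : ∀ j : ℕ, j < 1 + m + (skewFloor k + 1) → 1 / 2 ≤ mass k lam j := by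
    intro j hj
    refine half_le_mass (by omega) hl1 ?_
    rw [hmean]
    have h1 : (j : ℝ) ≤ m + skewFloor k + 1 := by
      have : j ≤ m + skewFloor k + 1 := by omega
      exact_mod_cast this
    linarith [skewFloor_le (k := k)]
  have e0 : S = Nat.ofDigits (2 ^ 128) [S] := by simp
  rw [hX] at h
  have h' := hscale.checkUp_sound (S' := 9999999999999200) (by norm_num) m le_rfl
    (approx_one k lam S) (by omega) (fun j hj => hhalf j (by omega)) (by rw [← e0]; exact h)
  obtain ⟨hup, l, hl, hc⟩ := h'
  have hdown := hscale.checkDown_sound (S' := 9999999999999200) (by norm_num) (skewFloor k + 1)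
    (by omega) hl (by omega) (fun j hj => hhalf j (by omega)) hc
  refine ⟨by linarith, fun i h1 h2 => hup i h1 (by omega), fun i h1 h2 => ?_, fun i h1 h2 => ?_⟩
  · have := (hdown (i + 1) (by omega) (by omega)).1
    push_cast at this
    rwa [add_sub_cancel_right] at this
  · have := (hdown (i + 1) (by omega) (by omega)).2
    push_cast at this
    rwa [add_sub_cancel_right] at this

theorem shift_nonneg_persists {k : ℕ} {lam₀ : ℝ} {J : ℤ}
    (h0 : ∀ j, j ≤ J → mass k lam₀ (j - k) ≤ mass k lam₀ j) {j : ℤ} (hj : j ≤ J) :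
    ∀ {lam : ℝ}, lam₀ ≤ lam → mass k lam (j - k) ≤ mass k lam j := by
  rcases lt_or_ge j 0 with hneg | hnn
  · intro lam _
    rw [mass_of_neg _ _ hneg, mass_of_neg _ _ (by omega)]
  obtain ⟨n, rfl⟩ := Int.eq_ofNat_of_zero_le hnn
  induction n using Nat.strong_induction_on with
  | _ n ih =>
    intro lam hlam
    have hd : ∀ x, HasDerivAt (fun x => mass k x n - mass k x (n - k))
        (∑ i ∈ Finset.range k, (mass k x (n - ((i : ℤ) + 1)) - mass k x (n - ((i : ℤ) + 1) - k))) x := by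
      intro x
      refine ((hasDerivAt_mass k x n).sub (hasDerivAt_mass k x (n - k))).congr_deriv ?_
      rw [← Finset.sum_sub_distrib]
      refine Finset.sum_congr rfl fun i _ => ?_
      congr 2; ring
    have hmono : MonotoneOn (fun x => mass k x n - mass k x (n - k)) (Set.Ici lam₀) := by
      refine monotoneOn_of_deriv_nonneg (convex_Ici _)
        (fun x _ => (hd x).continuousAt.continuousWithinAt)
        (fun x _ => (hd x).differentiableAt.differentiableWithinAt) fun x hx => ?_
      rw [interior_Ici] at hx
      rw [(hd x).deriv]
      refine Finset.sum_nonneg fun i _ => sub_nonneg.2 ?_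
      rcases lt_or_ge (n : ℤ) (i + 1) with h | h
      · rw [mass_of_neg _ _ (by omega), mass_of_neg _ _ (by omega)]
      · have := ih (n - (i + 1)) (by omega) (by omega) (by omega) (le_of_lt hx)
        rwa [show ((n - (i + 1) : ℕ) : ℤ) = n - ((i : ℤ) + 1) by omega] at this
    have h1 := hmono (Set.mem_Ici.2 le_rfl) (Set.mem_Ici.2 hlam) hlam
    have h2 := h0 n hj
    simp only at h1
    linarith

theorem mass_succ_sub_le {k : ℕ} {lam₀ : ℝ} {n : ℤ}
    (h0 : ∀ lam, lam₀ ≤ lam → mass k lam (n - k) ≤ mass k lam n) {x y : ℝ}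
    (hx : lam₀ ≤ x) (hxy : x ≤ y) :
    mass k x (n + 1) - mass k x n ≤ mass k y (n + 1) - mass k y n := by
  have hd : ∀ x, HasDerivAt (fun x => mass k x (n + 1) - mass k x n)
      (mass k x n - mass k x (n - k)) x := by
    intro x
    refine ((hasDerivAt_mass k x (n + 1)).sub (hasDerivAt_mass k x n)).congr_deriv ?_
    rw [← Finset.sum_sub_distrib]
    have := Finset.sum_range_sub' (fun i : ℕ => mass k x (n - i)) k
    simp only [Nat.cast_zero, sub_zero] at this
    rw [← this]
    refine Finset.sum_congr rfl fun i _ => ?_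
    congr 2
    · ring
  have hmono : MonotoneOn (fun x => mass k x (n + 1) - mass k x n) (Set.Ici lam₀) := by
    refine monotoneOn_of_deriv_nonneg (convex_Ici _)
      (fun x _ => (hd x).continuousAt.continuousWithinAt)
      (fun x _ => (hd x).differentiableAt.differentiableWithinAt) fun x hx => ?_
    rw [interior_Ici] at hx
    rw [(hd x).deriv]
    exact sub_nonneg.2 (h0 x (le_of_lt hx))
  exact hmono (Set.mem_Ici.2 hx) (Set.mem_Ici.2 (hx.trans hxy)) hxy

namespace Pattern

variable {k m L : ℕ} {lam : ℝ}

theorem le_of_le (h : Pattern k m L lam) {i j : ℤ} (hij : i ≤ j) (hj : j ≤ m) :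
    mass k lam i ≤ mass k lam j := by
  obtain ⟨t, rfl⟩ : ∃ t : ℕ, i = j - t := ⟨(j - i).toNat, by omega⟩
  clear hij
  induction t with
  | zero => simp
  | succ t ih =>
    refine le_trans ?_ ih
    rcases lt_or_ge (j - ((t + 1 : ℕ) : ℤ)) 0 with hneg | hnn
    · rw [mass_of_neg _ _ hneg]
      exact mass_nonneg h.lam_pos.le _
    · have := h.up (j - t).toNat (by omega) (by omega)
      rw [show (((j - t).toNat : ℕ) : ℤ) = j - t by omega] at this
      rwa [show j - t - 1 = j - ((t + 1 : ℕ) : ℤ) by push_cast; ring] at this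

theorem shift_le (h : Pattern k m L lam) {j : ℤ} (hj : j ≤ m + L) :
    mass k lam (j - k) ≤ mass k lam j := by
  rcases le_or_gt j m with h1 | h1
  · exact h.le_of_le (by omega) h1
  · have := h.shift j.toNat (by omega) (by omega)
    rwa [show ((j.toNat : ℕ) : ℤ) = j by omega] at this

theorem shift_le_of_le (h : Pattern k m L lam) {j : ℤ} (hj : j ≤ m + L) {x : ℝ} (hx : lam ≤ x) :
    mass k x (j - k) ≤ mass k x j :=
  shift_nonneg_persists (fun _ hi => h.shift_le hi) hj hx

theorem diff_le (h : Pattern k m L lam) {j : ℤ} (hj : j ≤ m + L) {x y : ℝ} (hx : lam ≤ x)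
    (hxy : x ≤ y) : mass k x (j + 1) - mass k x j ≤ mass k y (j + 1) - mass k y j :=
  mass_succ_sub_le (fun _ => h.shift_le_of_le hj) hx hxy

theorem exists_double_mode (hk : 2 ≤ k) (h : Pattern k m (skewFloor k) ((m + (skewT k + 1)) / kap k))
    (h' : Pattern k (m + 1) (skewFloor k) (((m + 1 : ℕ) + (skewT k + 1)) / kap k)) :
    ∃ lam, 0 < lam ∧ IsMode k lam m ∧ IsMode k lam (m + 1) := by
  have hkap : 0 < kap k := kap_pos (by omega)
  set x := ((m : ℝ) + (skewT k + 1)) / kap k with hx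
  set y := (((m + 1 : ℕ) : ℝ) + (skewT k + 1)) / kap k with hy
  have hxy : x ≤ y := by
    rw [hx, hy]; push_cast
    exact div_le_div_of_nonneg_right (by linarith) hkap.le
  have hcont : Continuous fun z => mass k z (m + 1) - mass k z m :=
    (continuous_mass k _).sub (continuous_mass k _)
  have hD0 := h.down m le_rfl (by omega)
  have hD1 := h'.le_of_le (i := m) (j := m + 1) (by omega) (by push_cast; omega)
  obtain ⟨z, ⟨hz1, hz2⟩, hz⟩ := intermediate_value_Icc hxy hcont.continuousOn
    (show (0 : ℝ) ∈ Set.Icc _ _ from ⟨by linarith, by linarith⟩)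
  simp only at hz
  have hz0 : 0 < z := h.lam_pos.trans_le hz1
  have hup : ∀ t : ℕ, mass k z (m - t) ≤ mass k z m := by
    intro t
    induction t with
    | zero => simp
    | succ t ih =>
      refine le_trans ?_ ih
      have h1 := h.diff_le (j := m - ((t + 1 : ℕ) : ℤ)) (by omega) le_rfl hz1
      have h2 := h.le_of_le (i := m - ((t + 1 : ℕ) : ℤ)) (j := m - ((t + 1 : ℕ) : ℤ) + 1)
        (by omega) (by push_cast; omega)
      rw [show (m : ℤ) - t = m - ((t + 1 : ℕ) : ℤ) + 1 by push_cast; ring]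
      linarith
  have hdown : ∀ t : ℕ, t ≤ skewFloor k → mass k z (m + 1 + t) ≤ mass k z (m + 1) := by
    intro t
    induction t with
    | zero => intro _; simp
    | succ t ih =>
      intro ht
      refine le_trans ?_ (ih (by omega))
      have h1 := h.diff_le (j := m + 1 + t) (by omega) hz1 hz2
      have h2 := h'.down (m + 1 + t) (by omega) (by omega)
      push_cast at h2 ⊢
      rw [← add_assoc]
      linarith
  obtain ⟨a, ha⟩ := exists_isMode k z
  have ham : mass k z a ≤ mass k z m := by
    rcases le_or_gt a m with h1 | h1
    · have := hup (m - a).toNat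
      rwa [show (m : ℤ) - (((m - a).toNat : ℕ) : ℤ) = a by omega] at this
    · have h2 := ha.le_mean hz0.le
      have h3 : z * kap k ≤ (m + 1 : ℕ) + (skewT k + 1) := by
        rw [← le_div_iff₀ hkap]; exact hz2
      have h4 : (a : ℝ) < ((m + 1 + skewFloor k + 1 : ℤ) : ℝ) := by
        have := lt_skewFloor (k := k)
        push_cast at h3 ⊢
        linarith
      have h5 : a < m + 1 + skewFloor k + 1 := by exact_mod_cast h4
      have := hdown (a - m - 1).toNat (by omega)
      rw [show (m : ℤ) + 1 + (((a - m - 1).toNat : ℕ) : ℤ) = a by omega] at this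
      linarith
  have hm : IsMode k z m := fun j => (ha j).trans ham
  refine ⟨z, hz0, hm, fun j => (hm j).trans ?_⟩
  linarith

theorem lt_mean_of_double_mode (hk : 2 ≤ k) {m' : ℕ} (hm' : m = m' + skewFloor k)
    (h' : Pattern k m' (skewFloor k) ((m' + (skewT k + 1)) / kap k))
    (h : Pattern k m (skewFloor k) ((m + (skewT k + 1)) / kap k)) {lam : ℝ} (hl : 0 < lam)
    (h1 : IsMode k lam m) (h2 : IsMode k lam (m + 1)) : 0 < lam * kap k - m - 1 - skewT k := by
  have hkap : 0 < kap k := kap_pos (by omega)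
  by_contra hcon
  push Not at hcon
  have hmean := h2.le_mean hl.le
  push_cast at hmean
  have ha : ((m' : ℝ) + (skewT k + 1)) / kap k ≤ lam := by
    rw [div_le_iff₀ hkap]
    have : (m : ℝ) = m' + skewFloor k := by exact_mod_cast hm'
    linarith [lt_skewFloor (k := k)]
  have hb : lam ≤ ((m : ℝ) + (skewT k + 1)) / kap k := by
    rw [le_div_iff₀ hkap]; linarith
  have h3 := h'.diff_le (j := m) (by omega) ha hb
  have h4 := h.down m le_rfl (by omega)
  have h5 := h1 (m + 1)
  have h6 := h2 m
  linarith

end Pattern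

/-- A double mode at `m` and `m + 1` exists, and it forces the mean above `m + 1 + skewT k`. -/
def DoubleModeBound (k m : ℕ) : Prop :=
  (∃ lam, 0 < lam ∧ IsMode k lam m ∧ IsMode k lam (m + 1)) ∧
    ∀ lam, 0 < lam → IsMode k lam m → IsMode k lam (m + 1) → 0 < lam * kap k - m - 1 - skewT k

theorem doubleModeBound_of_regular {k m : ℕ} (hk : 2 ≤ k)
    (h : ∀ lam, (m : ℝ) + 1 ≤ lam * kap k → Regular k lam (Real.sqrt (lam * sqs k))) :
    DoubleModeBound k m := by
  refine ⟨exists_double_mode (by omega) (by positivity)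
    fun lam hl => ⟨_, h lam (by exact_mod_cast hl)⟩, fun lam hl h1 h2 => ?_⟩
  have hmean := h2.le_mean hl.le
  push_cast at hmean
  exact ((h lam hmean).double_mode_bounds h1 h2).1

theorem doubleModeBound_of_check {k lo t a m : ℕ} (hk : 2 ≤ k) (hk' : k ≤ 17) (ha : 2 ≤ a)
    (he : (7.4 * ((k : ℝ) * (k + 1)) * (a / 2)) ^ 2 ≤ 2.7182818283 ^ a)
    (h1 : a / 2 * kap k ≤ 0.292 * ((k : ℝ) + 1 / 2) * ((lo + t : ℕ) : ℝ))
    (h2 : 10 * ((k : ℝ) + 1 / 2) ^ 2 * kap k ≤ ((lo + t : ℕ) : ℝ) * sqs k)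
    (hlo : k * (k + 1) ≤ 2 * lo) (ht : lo + t + k ≤ 20 * (k + 1)) (_ : lo + t ≤ 380)
    (hc : massCheckRange k t lo = true) (hm : lo + skewFloor k ≤ m) : DoubleModeBound k m := by
  have hkpos : 0 < k * (k + 1) := by positivity
  rcases le_or_gt (lo + t) (m + 1) with hmt | hmt
  · refine doubleModeBound_of_regular hk fun lam hlam => ?_
    have hx : ((lo + t : ℕ) : ℝ) ≤ m + 1 := by exact_mod_cast hmt
    refine regular_of_mode_ge hk ha ?_ (hx.trans hlam) he h1 h2
    exact_mod_cast (by omega : 0 < lo + t)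
  · have hp : ∀ i, lo ≤ i → i < lo + t →
        Pattern k i (skewFloor k) ((i + (skewT k + 1)) / kap k) := fun i hi1 hi2 =>
      pattern_of_massCheck hk hk' (by omega) (by omega) (by omega)
        (massCheckRange_sound hc i hi1 hi2)
    refine ⟨(hp m (by omega) (by omega)).exists_double_mode hk (hp (m + 1) (by omega) (by omega)),
      fun lam hl hm1 hm2 => ?_⟩
    exact Pattern.lt_mean_of_double_mode hk (m' := m - skewFloor k) (by omega)
      (hp _ (by omega) (by omega)) (hp m (by omega) (by omega)) hl hm1 hm2

theorem doubleModeBound_two {m : ℕ} (hm : 14 ≤ m) : DoubleModeBound 2 m :=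
  doubleModeBound_of_check (lo := 13) (t := 25) (a := 11) (by norm_num) (by norm_num) (by norm_num)
    (by norm_num) (by norm_num [kap]) (by norm_num [kap, sqs]) (by norm_num) (by norm_num)
    (by norm_num) (by decide +kernel) hm

theorem doubleModeBound_three {m : ℕ} (hm : 17 ≤ m) : DoubleModeBound 3 m :=
  doubleModeBound_of_check (lo := 16) (t := 37) (a := 13) (by norm_num) (by norm_num) (by norm_num)
    (by norm_num) (by norm_num [kap]) (by norm_num [kap, sqs]) (by norm_num) (by norm_num)
    (by norm_num) (by decide +kernel) hm

theorem doubleModeBound_four {m : ℕ} (hm : 28 ≤ m) : DoubleModeBound 4 m :=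
  doubleModeBound_of_check (lo := 26) (t := 42) (a := 14) (by norm_num) (by norm_num) (by norm_num)
    (by norm_num) (by norm_num [kap]) (by norm_num [kap, sqs]) (by norm_num) (by norm_num)
    (by norm_num) (by decide +kernel) hm

theorem doubleModeBound_five {m : ℕ} (hm : 28 ≤ m) : DoubleModeBound 5 m :=
  doubleModeBound_of_check (lo := 26) (t := 57) (a := 15) (by norm_num) (by norm_num) (by norm_num)
    (by norm_num) (by norm_num [kap]) (by norm_num [kap, sqs]) (by norm_num) (by norm_num)
    (by norm_num) (by decide +kernel) hm

theorem doubleModeBound_six {m : ℕ} (hm : 40 ≤ m) : DoubleModeBound 6 m :=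
  doubleModeBound_of_check (lo := 38) (t := 60) (a := 16) (by norm_num) (by norm_num) (by norm_num)
    (by norm_num) (by norm_num [kap]) (by norm_num [kap, sqs]) (by norm_num) (by norm_num)
    (by norm_num) (by decide +kernel) hm

theorem doubleModeBound_seven {m : ℕ} (hm : 53 ≤ m) : DoubleModeBound 7 m :=
  doubleModeBound_of_check (lo := 50) (t := 63) (a := 17) (by norm_num) (by norm_num) (by norm_num)
    (by norm_num) (by norm_num [kap]) (by norm_num [kap, sqs]) (by norm_num) (by norm_num)
    (by norm_num) (by decide +kernel) hm

theorem doubleModeBound_eight {m : ℕ} (hm : 69 ≤ m) : DoubleModeBound 8 m :=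
  doubleModeBound_of_check (lo := 66) (t := 62) (a := 17) (by norm_num) (by norm_num) (by norm_num)
    (by norm_num) (by norm_num [kap]) (by norm_num [kap, sqs]) (by norm_num) (by norm_num)
    (by norm_num) (by decide +kernel) hm

theorem doubleModeBound_nine {m : ℕ} (hm : 86 ≤ m) : DoubleModeBound 9 m :=
  doubleModeBound_of_check (lo := 82) (t := 64) (a := 18) (by norm_num) (by norm_num) (by norm_num)
    (by norm_num) (by norm_num [kap]) (by norm_num [kap, sqs]) (by norm_num) (by norm_num)
    (by norm_num) (by decide +kernel) hm

theorem doubleModeBound_ten {m : ℕ} (hm : 106 ≤ m) : DoubleModeBound 10 m :=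
  doubleModeBound_of_check (lo := 102) (t := 60) (a := 18) (by norm_num) (by norm_num) (by norm_num)
    (by norm_num) (by norm_num [kap]) (by norm_num [kap, sqs]) (by norm_num) (by norm_num)
    (by norm_num) (by decide +kernel) hm

theorem doubleModeBound_eleven {m : ℕ} (hm : 128 ≤ m) : DoubleModeBound 11 m :=
  doubleModeBound_of_check (lo := 124) (t := 63) (a := 19) (by norm_num) (by norm_num) (by norm_num)
    (by norm_num) (by norm_num [kap]) (by norm_num [kap, sqs]) (by norm_num) (by norm_num)
    (by norm_num) (by decide +kernel) hm

theorem doubleModeBound_twelve {m : ℕ} (hm : 151 ≤ m) : DoubleModeBound 12 m :=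
  doubleModeBound_of_check (lo := 146) (t := 58) (a := 19) (by norm_num) (by norm_num) (by norm_num)
    (by norm_num) (by norm_num [kap]) (by norm_num [kap, sqs]) (by norm_num) (by norm_num)
    (by norm_num) (by decide +kernel) hm

theorem doubleModeBound_thirteen {m : ℕ} (hm : 177 ≤ m) : DoubleModeBound 13 m :=
  doubleModeBound_of_check (lo := 172) (t := 48) (a := 19) (by norm_num) (by norm_num) (by norm_num)
    (by norm_num) (by norm_num [kap]) (by norm_num [kap, sqs]) (by norm_num) (by norm_num)
    (by norm_num) (by decide +kernel) hm

theorem doubleModeBound_fourteen {m : ℕ} (hm : 205 ≤ m) : DoubleModeBound 14 m :=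
  doubleModeBound_of_check (lo := 200) (t := 48) (a := 20) (by norm_num) (by norm_num) (by norm_num)
    (by norm_num) (by norm_num [kap]) (by norm_num [kap, sqs]) (by norm_num) (by norm_num)
    (by norm_num) (by decide +kernel) hm

theorem doubleModeBound_fifteen {m : ℕ} (hm : 234 ≤ m) : DoubleModeBound 15 m :=
  doubleModeBound_of_check (lo := 228) (t := 38) (a := 20) (by norm_num) (by norm_num) (by norm_num)
    (by norm_num) (by norm_num [kap]) (by norm_num [kap, sqs]) (by norm_num) (by norm_num)
    (by norm_num) (by decide +kernel) hm

theorem doubleModeBound_sixteen {m : ℕ} (hm : 266 ≤ m) : DoubleModeBound 16 m :=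
  doubleModeBound_of_check (lo := 260) (t := 23) (a := 20) (by norm_num) (by norm_num) (by norm_num)
    (by norm_num) (by norm_num [kap]) (by norm_num [kap, sqs]) (by norm_num) (by norm_num)
    (by norm_num) (by decide +kernel) hm

theorem doubleModeBound_seventeen {m : ℕ} (hm : 299 ≤ m) : DoubleModeBound 17 m :=
  doubleModeBound_of_check (lo := 292) (t := 23) (a := 21) (by norm_num) (by norm_num) (by norm_num)
    (by norm_num) (by norm_num [kap]) (by norm_num [kap, sqs]) (by norm_num) (by norm_num)
    (by norm_num) (by decide +kernel) hm

theorem doubleModeBound_of_range {k n : ℕ}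
    (h : (k = 2 ∧ 5 * (k * (k + 1) / 2) ≤ n) ∨
      (3 ≤ k ∧ k ≤ 4 ∧ 3 * (k * (k + 1) / 2) ≤ n) ∨ (5 ≤ k ∧ 2 * (k * (k + 1) / 2) ≤ n)) :
    DoubleModeBound k (n - (3 * k + 5) / 8) ∧ (3 * k + 5) / 8 ≤ n := by
  rcases le_or_gt k 17 with hk | hk
  · have hk2 : 2 ≤ k := by omega
    interval_cases k
    · exact ⟨doubleModeBound_two (by omega), by omega⟩
    · exact ⟨doubleModeBound_three (by omega), by omega⟩
    · exact ⟨doubleModeBound_four (by omega), by omega⟩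
    · exact ⟨doubleModeBound_five (by omega), by omega⟩
    · exact ⟨doubleModeBound_six (by omega), by omega⟩
    · exact ⟨doubleModeBound_seven (by omega), by omega⟩
    · exact ⟨doubleModeBound_eight (by omega), by omega⟩
    · exact ⟨doubleModeBound_nine (by omega), by omega⟩
    · exact ⟨doubleModeBound_ten (by omega), by omega⟩
    · exact ⟨doubleModeBound_eleven (by omega), by omega⟩
    · exact ⟨doubleModeBound_twelve (by omega), by omega⟩
    · exact ⟨doubleModeBound_thirteen (by omega), by omega⟩
    · exact ⟨doubleModeBound_fourteen (by omega), by omega⟩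
    · exact ⟨doubleModeBound_fifteen (by omega), by omega⟩
    · exact ⟨doubleModeBound_sixteen (by omega), by omega⟩
    · exact ⟨doubleModeBound_seventeen (by omega), by omega⟩
  · have hn : k * (k + 1) ≤ n := by
      have := Nat.two_mul_div_two_of_even (Nat.even_mul_succ_self k)
      omega
    have hkn : 19 * k ≤ n := le_trans (by nlinarith) hn
    refine ⟨doubleModeBound_of_regular (by omega) fun lam hlam =>
      regular_of_eighteen_le (by omega) (le_trans ?_ hlam), by omega⟩
    have h1 : k * (k + 1) ≤ n - (3 * k + 5) / 8 + (3 * k + 5) / 8 := by omega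
    have h2 : ((3 * k + 5) / 8) * 8 ≤ 3 * k + 5 := Nat.div_mul_le_self _ _
    have h1' : (k : ℝ) * (k + 1) ≤ (n - (3 * k + 5) / 8 : ℕ) + ((3 * k + 5) / 8 : ℕ) := by
      exact_mod_cast h1
    have h2' : (((3 * k + 5) / 8 : ℕ) : ℝ) * 8 ≤ 3 * k + 5 := by exact_mod_cast h2
    linarith

theorem isMode_iff {k : ℕ} {lam : ℝ} (hl : 0 ≤ lam) (m : ℕ) :
    IsMode k lam m ↔ ∀ j : ℕ, poissonOrderKPmf k lam j ≤ poissonOrderKPmf k lam m := by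
  simp only [pmf_eq_mass, mul_le_mul_iff_right₀ (Real.exp_pos _)]
  refine ⟨fun h j => h j, fun h j => ?_⟩
  rcases lt_or_ge j 0 with hj | hj
  · rw [mass_of_neg _ _ hj]; exact mass_nonneg hl _
  · obtain ⟨i, rfl⟩ := Int.eq_ofNat_of_zero_le hj
    exact h i

theorem doubleModeSet_eq (k m : ℕ) :
    {lam : ℝ | 0 < lam ∧ poissonOrderKPmf k lam m = poissonOrderKPmf k lam (m + 1) ∧
      ∀ j : ℕ, poissonOrderKPmf k lam j ≤ poissonOrderKPmf k lam m} =
    {lam | 0 < lam ∧ IsMode k lam m ∧ IsMode k lam (m + 1)} := by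
  ext lam
  simp only [Set.mem_ofPred_eq]
  refine and_congr_right fun hl => ?_
  rw [show (m : ℤ) + 1 = ((m + 1 : ℕ) : ℤ) by push_cast; ring, isMode_iff hl.le, isMode_iff hl.le]
  exact ⟨fun ⟨h1, h2⟩ => ⟨h2, fun j => h1 ▸ h2 j⟩, fun ⟨h1, h2⟩ => ⟨le_antisymm (h2 m) (h1 _), h1⟩⟩

theorem sInf_doubleModeSet_mem {k m : ℕ} (hk : 0 < k)
    (h : ∃ lam, 0 < lam ∧ IsMode k lam m ∧ IsMode k lam (m + 1)) :
    sInf {lam | 0 < lam ∧ IsMode k lam m ∧ IsMode k lam (m + 1)} ∈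
      {lam | 0 < lam ∧ IsMode k lam m ∧ IsMode k lam (m + 1)} := by
  have hkap := kap_pos hk
  have e : {lam | 0 < lam ∧ IsMode k lam m ∧ IsMode k lam (m + 1)} =
      Set.Ici (((m : ℝ) + 1) / kap k) ∩
        ({lam | IsMode k lam m} ∩ {lam | IsMode k lam (m + 1)}) := by
    ext lam
    simp only [Set.mem_ofPred_eq, Set.mem_inter_iff, Set.mem_Ici]
    refine ⟨fun ⟨h1, h2, h3⟩ => ⟨?_, h2, h3⟩, fun ⟨h1, h2, h3⟩ => ⟨?_, h2, h3⟩⟩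
    · rw [div_le_iff₀ hkap]
      exact_mod_cast h3.le_mean h1.le
    · exact lt_of_lt_of_le (by positivity) h1
  refine IsClosed.csInf_mem ?_ h ⟨0, fun lam hlam => hlam.1.le⟩
  rw [e]
  exact isClosed_Ici.inter ((isClosed_isMode k _).inter (isClosed_isMode k _))

theorem cast_triangular (k : ℕ) : ((k * (k + 1) / 2 : ℕ) : ℝ) = kap k := by
  rw [Nat.cast_div (Nat.even_mul_succ_self k).two_dvd (by norm_num)]
  unfold kap; push_cast; ring

theorem exists_beta_eq {k n : ℕ} (hk : 0 < k)
    (h : ∃ lam, 0 < lam ∧ IsMode k lam (n - (3 * k + 5) / 8 : ℕ) ∧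
      IsMode k lam ((n - (3 * k + 5) / 8 : ℕ) + 1)) :
    ∃ lam, 0 < lam ∧ IsMode k lam (n - (3 * k + 5) / 8 : ℕ) ∧
      IsMode k lam ((n - (3 * k + 5) / 8 : ℕ) + 1) ∧ poissonOrderKBeta k n = lam * kap k := by
  obtain ⟨h1, h2, h3⟩ := sInf_doubleModeSet_mem hk h
  refine ⟨_, h1, h2, h3, ?_⟩
  rw [poissonOrderKBeta, doubleModeSet_eq, cast_triangular, mul_comm]

theorem exists_exp_bound (c : ℝ) : ∃ a : ℕ, 2 ≤ a ∧ (c * (a / 2)) ^ 2 ≤ 2.7182818283 ^ a := by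
  have h := tendsto_pow_const_div_const_pow_of_one_lt 2 (show (1 : ℝ) < 2.7182818283 by norm_num)
  have h2 := (h.const_mul (c ^ 2 / 4)).eventually_le_const
    (show c ^ 2 / 4 * 0 < (1 : ℝ) by norm_num)
  obtain ⟨a, ha, ha2⟩ := (h2.and (Filter.eventually_ge_atTop 2)).exists
  refine ⟨a, ha2, ?_⟩
  have hp : (0 : ℝ) < 2.7182818283 ^ a := by positivity
  rw [← mul_div_assoc, div_le_one hp] at ha
  linarith [show (c * (a / 2)) ^ 2 = c ^ 2 / 4 * (a : ℝ) ^ 2 by ring]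

theorem exists_regular_threshold {k : ℕ} (hk : 2 ≤ k) : ∃ x₀ : ℝ, ∀ x lam : ℝ, x₀ ≤ x →
    x ≤ lam * kap k → Regular k lam (Real.sqrt (lam * sqs k)) := by
  obtain ⟨a, ha, he⟩ := exists_exp_bound (7.4 * ((k : ℝ) * (k + 1)))
  have hs := sqs_pos (k := k) (by omega)
  refine ⟨max 1 (max (a / 2 * kap k / (0.292 * ((k : ℝ) + 1 / 2)))
    (10 * ((k : ℝ) + 1 / 2) ^ 2 * kap k / sqs k)), fun x lam hx hlam => ?_⟩
  have h1 := (le_max_left _ _).trans hx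
  have h2 := ((le_max_left _ _).trans (le_max_right _ _)).trans hx
  have h3 := ((le_max_right _ _).trans (le_max_right _ _)).trans hx
  rw [div_le_iff₀ (by positivity)] at h2
  rw [div_le_iff₀ hs] at h3
  exact regular_of_mode_ge hk ha (by linarith) hlam he (by linarith) h3

theorem tendsto_beta_sub_mode {k : ℕ} (hk : 2 ≤ k) :
    Filter.Tendsto (fun n : ℕ => poissonOrderKBeta k n - ((n - (3 * k + 5) / 8 : ℕ) : ℝ))
      Filter.atTop (nhds (skewT k + 1)) := by
  have hkap : 0 < kap k := kap_pos (by omega)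
  have hs := sqs_pos (k := k) (by omega)
  obtain ⟨x₀, hx₀⟩ := exists_regular_threshold hk
  have hm : Filter.Tendsto (fun n : ℕ => ((n - (3 * k + 5) / 8 : ℕ) : ℝ) + 1)
      Filter.atTop Filter.atTop :=
    Filter.tendsto_atTop_add_const_right _ _
      (tendsto_natCast_atTop_atTop.comp (Filter.tendsto_sub_atTop_nat _))
  set C := 5 * (tau k * (skewT k + 2)) * kap k / sqs k with hC
  have hC0 : 0 < C := by
    have := tau_pos hk
    have := skewT_nonneg hk
    positivity
  have key : ∀ᶠ n : ℕ in Filter.atTop,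
      skewT k + 1 ≤ poissonOrderKBeta k n - ((n - (3 * k + 5) / 8 : ℕ) : ℝ) ∧
      poissonOrderKBeta k n - ((n - (3 * k + 5) / 8 : ℕ) : ℝ) ≤
        skewT k + 1 + C / (((n - (3 * k + 5) / 8 : ℕ) : ℝ) + 1) := by
    filter_upwards [hm.eventually_ge_atTop x₀] with n hn
    have hreg : ∀ lam, ((n - (3 * k + 5) / 8 : ℕ) : ℝ) + 1 ≤ lam * kap k →
        Regular k lam (Real.sqrt (lam * sqs k)) := fun lam hl => hx₀ _ lam hn hl
    obtain ⟨lam, hl, h1, h2, hb⟩ :=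
      exists_beta_eq (by omega) (doubleModeBound_of_regular hk hreg).1
    have hmean := h2.le_mean hl.le
    push_cast at hmean
    have hr := hreg lam hmean
    obtain ⟨h3, h4⟩ := hr.double_mode_bounds h1 h2
    push_cast at h3 h4
    rw [hb]
    refine ⟨by linarith, ?_⟩
    have hmp : (0 : ℝ) < ((n - (3 * k + 5) / 8 : ℕ) : ℝ) + 1 := by positivity
    have h5 : 5 * (tau k * (skewT k + 2)) / Real.sqrt (lam * sqs k) ^ 2 ≤
        C / (((n - (3 * k + 5) / 8 : ℕ) : ℝ) + 1) := by
      rw [hr.sq_eq]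
      have e : 5 * (tau k * (skewT k + 2)) / (lam * sqs k) = C / (lam * kap k) := by
        rw [hC]; field_simp
      rw [e]
      exact div_le_div_of_nonneg_left hC0.le hmp hmean
    linarith
  have hlim : Filter.Tendsto (fun n : ℕ => skewT k + 1 + C / (((n - (3 * k + 5) / 8 : ℕ) : ℝ) + 1))
      Filter.atTop (nhds (skewT k + 1)) := by
    simpa using (tendsto_const_nhds (x := skewT k + 1)).add (hm.const_div_atTop C)
  exact tendsto_of_tendsto_of_tendsto_of_le_of_le' tendsto_const_nhds hlim
    (key.mono fun _ h => h.1) (key.mono fun _ h => h.2)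

theorem fract_add_eq (k : ℕ) :
    Int.fract ((3 * (k : ℝ) + 5) / 8) + ((k : ℝ) - 1) / (8 * (2 * (k : ℝ) + 1)) =
      skewT k + 1 - ((3 * k + 5) / 8 : ℕ) := by
  have h : ⌊(3 * (k : ℝ) + 5) / 8⌋ = (((3 * k + 5) / 8 : ℕ) : ℤ) := by
    rw [Int.floor_eq_iff]
    have h1 : ((3 * k + 5) / 8) * 8 ≤ 3 * k + 5 := Nat.div_mul_le_self _ _
    have h2 : 3 * k + 5 < ((3 * k + 5) / 8 + 1) * 8 := by omega
    have h1' : (((3 * k + 5) / 8 : ℕ) : ℝ) * 8 ≤ 3 * k + 5 := by exact_mod_cast h1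
    have h2' : 3 * (k : ℝ) + 5 < (((3 * k + 5) / 8 : ℕ) + 1) * 8 := by exact_mod_cast h2
    rw [Int.cast_natCast]
    constructor <;> linarith
  rw [Int.fract, h, Int.cast_natCast]
  unfold skewT
  field_simp
  ring

theorem mode_gap_eq (k : ℕ) :
    (6 * (k : ℝ) + 11) / 16 - 3 / (16 * (2 * (k : ℝ) + 1)) = skewT k + 1 := by
  unfold skewT
  field_simp
  ring

end PoissonOrderK

/-- Conjecture: For fixed k > 1,
lim_{n→∞} (β_(k,n) − n) = frac((3k+5)/8) + (k−1)/(8(2k+1)), and this is a sharp lower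
bound for β_(k,n) − n over the range of n on which β_(k,n) − n is decreasing;
equivalently lim_{n→∞} (β_(k,n) − m_k(n/κ)) = (6k+11)/16 − 3/(16(2k+1)), a sharp lower
bound for β_(k,n) − m_k(n/κ) (with m_k(n/κ) = n − ⌊(3k+5)/8⌋). -/
theorem poissonOrderK_beta_limit (k : ℕ) (hk : 1 < k) :
    Filter.Tendsto (fun n : ℕ => poissonOrderKBeta k n - (n : ℝ)) Filter.atTop
      (nhds (Int.fract ((3 * (k : ℝ) + 5) / 8) +
        ((k : ℝ) - 1) / (8 * (2 * (k : ℝ) + 1)))) ∧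
    (∀ n : ℕ,
      ((k = 2 ∧ 5 * (k * (k + 1) / 2) ≤ n) ∨
       (3 ≤ k ∧ k ≤ 4 ∧ 3 * (k * (k + 1) / 2) ≤ n) ∨
       (5 ≤ k ∧ 2 * (k * (k + 1) / 2) ≤ n)) →
      Int.fract ((3 * (k : ℝ) + 5) / 8) + ((k : ℝ) - 1) / (8 * (2 * (k : ℝ) + 1)) <
        poissonOrderKBeta k n - (n : ℝ)) ∧
    Filter.Tendsto
      (fun n : ℕ => poissonOrderKBeta k n - ((n - (3 * k + 5) / 8 : ℕ) : ℝ)) Filter.atTop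
      (nhds ((6 * (k : ℝ) + 11) / 16 - 3 / (16 * (2 * (k : ℝ) + 1)))) ∧
    (∀ n : ℕ,
      ((k = 2 ∧ 5 * (k * (k + 1) / 2) ≤ n) ∨
       (3 ≤ k ∧ k ≤ 4 ∧ 3 * (k * (k + 1) / 2) ≤ n) ∨
       (5 ≤ k ∧ 2 * (k * (k + 1) / 2) ≤ n)) →
      (6 * (k : ℝ) + 11) / 16 - 3 / (16 * (2 * (k : ℝ) + 1)) <
        poissonOrderKBeta k n - ((n - (3 * k + 5) / 8 : ℕ) : ℝ)) := by
  rw [PoissonOrderK.fract_add_eq, PoissonOrderK.mode_gap_eq]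
  have hlim := PoissonOrderK.tendsto_beta_sub_mode (k := k) hk
  have hcast : ∀ n : ℕ, (3 * k + 5) / 8 ≤ n →
      ((n - (3 * k + 5) / 8 : ℕ) : ℝ) = n - ((3 * k + 5) / 8 : ℕ) := fun n hn =>
    Nat.cast_sub hn
  have hbound : ∀ n : ℕ,
      ((k = 2 ∧ 5 * (k * (k + 1) / 2) ≤ n) ∨
       (3 ≤ k ∧ k ≤ 4 ∧ 3 * (k * (k + 1) / 2) ≤ n) ∨
       (5 ≤ k ∧ 2 * (k * (k + 1) / 2) ≤ n)) →
      PoissonOrderK.skewT k + 1 < poissonOrderKBeta k n - ((n - (3 * k + 5) / 8 : ℕ) : ℝ) := by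
    intro n hn
    obtain ⟨⟨hex, hlow⟩, -⟩ := PoissonOrderK.doubleModeBound_of_range hn
    obtain ⟨lam, hl, h1, h2, hb⟩ := PoissonOrderK.exists_beta_eq (by omega) hex
    have := hlow lam hl h1 h2
    rw [hb]
    linarith
  refine ⟨?_, fun n hn => ?_, hlim, hbound⟩
  · refine (hlim.sub_const _).congr' ?_
    filter_upwards [Filter.eventually_ge_atTop ((3 * k + 5) / 8)] with n hn
    rw [hcast n hn]
    ring
  · have h1 := hbound n hn
    rw [hcast n (PoissonOrderK.doubleModeBound_of_range hn).2] at h1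
    linarith
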